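/- arXiv:2405.02736 — 2 statements merged into one kernel-verified Lean document; each statement's English description precedes it below -/
import Mathlib

section
/- Let Λ be a finite-dimensional algebra over a field, T a tilting right Λ-module such that A := End_Λ(T) is Iwanaga–Gorenstein. Then (A, T) is a relative n-Auslander–Gorenstein pair for some n with n ≤ pd_A T + id_A T, and moreover pd_A T = pd T_Λ and id_A T = id T_Λ. -/
universe u
open MulOpposite

noncomputable section
namespace Paper

section RingDefs
variable (B : Type u) [Ring B]

/-- `X` belongs to `add Q`: it is a direct summand of a finite direct sum of copies of `Q`. -/
def InAdd (Q X : ModuleCat.{u} B) : Prop :=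
  ∃ (n : ℕ) (s : X →ₗ[B] (Fin n → Q)) (r : (Fin n → Q) →ₗ[B] X), r ∘ₗ s = LinearMap.id

/-- A superfluous (small) submodule. -/
def Superfluous {P : ModuleCat.{u} B} (N : Submodule B P) : Prop :=
  ∀ K : Submodule B P, K ⊔ N = ⊤ → K = ⊤

/-- An essential (large) submodule. -/
def Essential {P : ModuleCat.{u} B} (N : Submodule B P) : Prop :=
  ∀ K : Submodule B P, K ⊓ N = ⊥ → K = ⊥

/-- `p : P → X` is a projective cover. -/
def IsProjCover {P X : ModuleCat.{u} B} (p : P →ₗ[B] X) : Prop :=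
  Module.Projective B P ∧ Function.Surjective p ∧ Superfluous B (LinearMap.ker p)

/-- `ι : X → I` is an injective envelope. -/
def IsInjEnvelope {X I : ModuleCat.{u} B} (ι : X →ₗ[B] I) : Prop :=
  Module.Injective B I ∧ Function.Injective ι ∧ Essential B (LinearMap.range ι)

/-- The zero module. -/
def zeroMod : ModuleCat.{u} B := ModuleCat.of B PUnit

/-- An exact sequence `0 → P_m → ⋯ → P_1 → P_0 → X → 0` whose terms satisfy the
predicate `T` and which remains exact under `Hom(test, −)`. -/
def ResLE (test : ModuleCat.{u} B) (T : ModuleCat.{u} B → Prop)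
    (X : ModuleCat.{u} B) (m : ℕ) : Prop :=
  ∃ (P : ℕ → ModuleCat.{u} B) (d : ∀ j, P (j+1) →ₗ[B] P j) (aug : P 0 →ₗ[B] X),
    (∀ j, j ≤ m → T (P j)) ∧ (∀ j, m < j → Subsingleton (P j)) ∧
    Function.Surjective aug ∧ Function.Exact (d 0) aug ∧
    (∀ j, Function.Exact (d (j+1)) (d j)) ∧
    (∀ f : test →ₗ[B] X, ∃ h : test →ₗ[B] P 0, aug ∘ₗ h = f) ∧
    (∀ f : test →ₗ[B] P 0, aug ∘ₗ f = 0 → ∃ h : test →ₗ[B] P 1, d 0 ∘ₗ h = f) ∧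
    (∀ j, ∀ f : test →ₗ[B] P (j+1), d j ∘ₗ f = 0 →
      ∃ h : test →ₗ[B] P (j+2), d (j+1) ∘ₗ h = f)

/-- An exact sequence `0 → X → I_0 → ⋯ → I_m → 0` whose terms satisfy the predicate `T`
and which remains exact under `Hom(−, test)`. -/
def CoresLE (test : ModuleCat.{u} B) (T : ModuleCat.{u} B → Prop)
    (X : ModuleCat.{u} B) (m : ℕ) : Prop :=
  ∃ (M : ℕ → ModuleCat.{u} B) (ι : X →ₗ[B] M 0) (d : ∀ j, M j →ₗ[B] M (j+1)),
    (∀ j, j ≤ m → T (M j)) ∧ (∀ j, m < j → Subsingleton (M j)) ∧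
    Function.Injective ι ∧ Function.Exact ι (d 0) ∧
    (∀ j, Function.Exact (d j) (d (j+1))) ∧
    (∀ f : X →ₗ[B] test, ∃ h : M 0 →ₗ[B] test, h ∘ₗ ι = f) ∧
    (∀ f : M 0 →ₗ[B] test, f ∘ₗ ι = 0 → ∃ h : M 1 →ₗ[B] test, h ∘ₗ d 0 = f) ∧
    (∀ j, ∀ f : M (j+1) →ₗ[B] test, f ∘ₗ d j = 0 →
      ∃ h : M (j+2) →ₗ[B] test, h ∘ₗ d (j+1) = f)

/-- Projective dimension at most `n`. -/
def pdLE (X : ModuleCat.{u} B) (n : ℕ) : Prop :=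
  ResLE B (zeroMod B) (fun P => Module.Projective B P) X n

/-- Injective dimension at most `n`. -/
def idLE (X : ModuleCat.{u} B) (n : ℕ) : Prop :=
  CoresLE B (zeroMod B) (fun I => Module.Injective B I) X n

/-- Projective dimension equal to `n`. -/
def pdEq (X : ModuleCat.{u} B) (n : ℕ) : Prop :=
  pdLE B X n ∧ ∀ j, pdLE B X j → n ≤ j

/-- Injective dimension equal to `n`. -/
def idEq (X : ModuleCat.{u} B) (n : ℕ) : Prop :=
  idLE B X n ∧ ∀ j, idLE B X j → n ≤ j

/-- Projective dimension as an element of `ℕ∞`. -/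
def pdDim (X : ModuleCat.{u} B) : ℕ∞ :=
  sInf {c : ℕ∞ | ∃ n : ℕ, c = n ∧ pdLE B X n}

/-- Injective dimension as an element of `ℕ∞`. -/
def idDim (X : ModuleCat.{u} B) : ℕ∞ :=
  sInf {c : ℕ∞ | ∃ n : ℕ, c = n ∧ idLE B X n}

/-- Relative dominant dimension of `X` with respect to `Q` is at least `n`:
there is an exact sequence `0 → X → Q_1 → ⋯ → Q_n` with `Q_i ∈ add Q`
remaining exact under `Hom(−, Q)`. -/
def domdimGE (Q X : ModuleCat.{u} B) (n : ℕ) : Prop :=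
  n = 0 ∨ ∃ (M : ℕ → ModuleCat.{u} B) (ι : X →ₗ[B] M 0) (d : ∀ j, M j →ₗ[B] M (j+1)),
    (∀ j, j + 1 ≤ n → InAdd B Q (M j)) ∧
    Function.Injective ι ∧ (2 ≤ n → Function.Exact ι (d 0)) ∧
    (∀ j, j + 3 ≤ n → Function.Exact (d j) (d (j+1))) ∧
    (∀ f : X →ₗ[B] Q, ∃ h : M 0 →ₗ[B] Q, h ∘ₗ ι = f) ∧
    (2 ≤ n → ∀ f : M 0 →ₗ[B] Q, f ∘ₗ ι = 0 → ∃ h : M 1 →ₗ[B] Q, h ∘ₗ d 0 = f) ∧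
    (∀ j, j + 3 ≤ n → ∀ f : M (j+1) →ₗ[B] Q, f ∘ₗ d j = 0 →
      ∃ h : M (j+2) →ₗ[B] Q, h ∘ₗ d (j+1) = f)

/-- Relative codominant dimension of `X` with respect to `Q` is at least `n`. -/
def codomdimGE (Q X : ModuleCat.{u} B) (n : ℕ) : Prop :=
  n = 0 ∨ ∃ (M : ℕ → ModuleCat.{u} B) (aug : M 0 →ₗ[B] X) (d : ∀ j, M (j+1) →ₗ[B] M j),
    (∀ j, j + 1 ≤ n → InAdd B Q (M j)) ∧
    Function.Surjective aug ∧ (2 ≤ n → Function.Exact (d 0) aug) ∧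
    (∀ j, j + 3 ≤ n → Function.Exact (d (j+1)) (d j)) ∧
    (∀ f : Q →ₗ[B] X, ∃ h : Q →ₗ[B] M 0, aug ∘ₗ h = f) ∧
    (2 ≤ n → ∀ f : Q →ₗ[B] M 0, aug ∘ₗ f = 0 → ∃ h : Q →ₗ[B] M 1, d 0 ∘ₗ h = f) ∧
    (∀ j, j + 3 ≤ n → ∀ f : Q →ₗ[B] M (j+1), d j ∘ₗ f = 0 →
      ∃ h : Q →ₗ[B] M (j+2), d (j+1) ∘ₗ h = f)

/-- Relative dominant dimension with respect to `Q`, as an element of `ℕ∞`. -/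
def relDomDim (Q X : ModuleCat.{u} B) : ℕ∞ :=
  sSup {c : ℕ∞ | ∃ n : ℕ, c = n ∧ domdimGE B Q X n}

/-- Relative codominant dimension with respect to `Q`, as an element of `ℕ∞`. -/
def relCodomDim (Q X : ModuleCat.{u} B) : ℕ∞ :=
  sSup {c : ℕ∞ | ∃ n : ℕ, c = n ∧ codomdimGE B Q X n}

/-- A projective resolution. -/
structure ProjRes (X : ModuleCat.{u} B) where
  P : ℕ → ModuleCat.{u} B
  d : ∀ j, P (j+1) →ₗ[B] P j
  aug : P 0 →ₗ[B] X
  proj : ∀ j, Module.Projective B (P j)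
  augSurj : Function.Surjective aug
  exact0 : Function.Exact (d 0) aug
  exact : ∀ j, Function.Exact (d (j+1)) (d j)

/-- Vanishing of `Ext^i(X, Y)`, expressed via projective resolutions. -/
def ExtVanish (X Y : ModuleCat.{u} B) : ℕ → Prop
  | 0 => Subsingleton (X →ₗ[B] Y)
  | (i+1) => ∀ R : ProjRes B X, ∀ f : R.P (i+1) →ₗ[B] Y,
      f ∘ₗ R.d (i+1) = 0 → ∃ g : R.P i →ₗ[B] Y, f = g ∘ₗ R.d i

/-- `Q` is self-orthogonal: `Ext^i(Q, Q) = 0` for all `i > 0`. -/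
def SelfOrth (Q : ModuleCat.{u} B) : Prop := ∀ i, 1 ≤ i → ExtVanish B Q Q i

/-- `Z` is a (first, minimal) syzygy of `X`. -/
def IsSyzygyOf (X Z : ModuleCat.{u} B) : Prop :=
  ∃ (P : ModuleCat.{u} B) (p : P →ₗ[B] X), IsProjCover B p ∧
    Nonempty (Z ≃ₗ[B] LinearMap.ker p)

/-- `Z` is an `n`-th syzygy `Ω^n X`. -/
def IsOmegaOf : ℕ → ModuleCat.{u} B → ModuleCat.{u} B → Prop
  | 0, X, Z => Nonempty (Z ≃ₗ[B] X)
  | (n+1), X, Z => ∃ Y, IsSyzygyOf B X Y ∧ IsOmegaOf n Y Z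

/-- `Z` is a (first, minimal) cosyzygy of `X`. -/
def IsCosyzygyOf (X Z : ModuleCat.{u} B) : Prop :=
  ∃ (I : ModuleCat.{u} B) (ι : X →ₗ[B] I), IsInjEnvelope B ι ∧
    Nonempty (Z ≃ₗ[B] (I ⧸ LinearMap.range ι))

/-- `Z` is an `n`-th cosyzygy `Ω^{-n} X`. -/
def IsOmegaInvOf : ℕ → ModuleCat.{u} B → ModuleCat.{u} B → Prop
  | 0, X, Z => Nonempty (Z ≃ₗ[B] X)
  | (n+1), X, Z => ∃ Y, IsCosyzygyOf B X Y ∧ IsOmegaInvOf n Y Z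

/-- Precomposition with `g`, as a map of right `B`-modules `Hom(P₀,B) → Hom(P₁,B)`. -/
def lprecomp {P1 P0 : ModuleCat.{u} B} (g : P1 →ₗ[B] P0) :
    (P0 →ₗ[B] B) →ₗ[Bᵐᵒᵖ] (P1 →ₗ[B] B) where
  toFun h := h ∘ₗ g
  map_add' _ _ := rfl
  map_smul' _ _ := rfl

/-- `T` is a transpose `Tr X` (computed from a minimal projective presentation). -/
def IsTransposeOf (X : ModuleCat.{u} B) (T : ModuleCat.{u} Bᵐᵒᵖ) : Prop :=
  ∃ (P1 P0 : ModuleCat.{u} B) (g : P1 →ₗ[B] P0) (p : P0 →ₗ[B] X),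
    IsProjCover B p ∧ Module.Projective B P1 ∧ Function.Exact g p ∧
    Superfluous B (LinearMap.ker g) ∧
    Nonempty (T ≃ₗ[Bᵐᵒᵖ] ((P1 →ₗ[B] B) ⧸ LinearMap.range (lprecomp B g)))

/-- The canonical ring homomorphism `B →+* Bᵐᵒᵖᵐᵒᵖ`. -/
def opOpHom : B →+* Bᵐᵒᵖᵐᵒᵖ where
  toFun b := op (op b)
  map_one' := rfl
  map_mul' _ _ := rfl
  map_zero' := rfl
  map_add' _ _ := rfl


/-- An `F_Mo`-projective resolution: terms in `add(B ⊕ Mo)`, exact, and remaining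
exact under `Hom(Mo, −)`. -/
structure FProjRes (Mo X : ModuleCat.{u} B) where
  P : ℕ → ModuleCat.{u} B
  d : ∀ j, P (j+1) →ₗ[B] P j
  aug : P 0 →ₗ[B] X
  mem : ∀ j, InAdd B (ModuleCat.of B (B × Mo)) (P j)
  augSurj : Function.Surjective aug
  exact0 : Function.Exact (d 0) aug
  exact : ∀ j, Function.Exact (d (j+1)) (d j)
  lift0 : ∀ f : Mo →ₗ[B] X, ∃ h : Mo →ₗ[B] P 0, aug ∘ₗ h = f
  lift1 : ∀ f : Mo →ₗ[B] P 0, aug ∘ₗ f = 0 → ∃ h : Mo →ₗ[B] P 1, d 0 ∘ₗ h = f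
  lift : ∀ j, ∀ f : Mo →ₗ[B] P (j+1), d j ∘ₗ f = 0 →
    ∃ h : Mo →ₗ[B] P (j+2), d (j+1) ∘ₗ h = f

/-- Vanishing of the relative extension group `Ext^i_{F_Mo}(X, Y)`, computed via
`F_Mo`-projective resolutions. -/
def FExtVanish (Mo X Y : ModuleCat.{u} B) : ℕ → Prop
  | 0 => True
  | (i+1) => ∀ R : FProjRes B Mo X, ∀ f : R.P (i+1) →ₗ[B] Y,
      f ∘ₗ R.d (i+1) = 0 → ∃ g : R.P i →ₗ[B] Y, f = g ∘ₗ R.d i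

end RingDefs

section Duality
variable (k : Type u) [Field k] (B : Type u) [Ring B] [Algebra k B]

noncomputable instance kmod (X : ModuleCat.{u} B) : Module k X :=
  Module.compHom X (algebraMap k B)

instance kmodSMulComm (X : ModuleCat.{u} B) : SMulCommClass B k X :=
  ⟨fun b c x => by
    show b • ((algebraMap k B c) • x) = (algebraMap k B c) • (b • x)
    rw [← mul_smul, ← mul_smul, Algebra.commutes]⟩

instance kmodTower (X : ModuleCat.{u} B) : IsScalarTower k B X :=
  ⟨fun c b x => by
    show (c • b) • x = (algebraMap k B c) • (b • x)
    rw [Algebra.smul_def, mul_smul]⟩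

noncomputable instance dualModL (X : ModuleCat.{u} B) : Module Bᵐᵒᵖ (X →ₗ[k] k) where
  smul b φ := φ ∘ₗ (DistribMulAction.toLinearMap k X b.unop)
  one_smul φ := by
    ext x
    show φ ((1 : Bᵐᵒᵖ).unop • x) = φ x
    rw [unop_one, one_smul]
  mul_smul b c φ := by
    ext x
    show φ ((b * c).unop • x) = φ (c.unop • b.unop • x)
    rw [unop_mul, mul_smul]
  smul_zero b := rfl
  smul_add b φ ψ := rfl
  add_smul b c φ := by
    ext x
    show φ ((b + c).unop • x) = φ (b.unop • x) + φ (c.unop • x)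
    rw [unop_add, add_smul, map_add]
  zero_smul φ := by
    ext x
    show φ ((0 : Bᵐᵒᵖ).unop • x) = 0
    rw [unop_zero, zero_smul, map_zero]

/-- The standard duality `D = Hom_k(−, k)`, sending a left `B`-module to a right
`B`-module. -/
def Dop (X : ModuleCat.{u} B) : ModuleCat.{u} Bᵐᵒᵖ :=
  ModuleCat.of Bᵐᵒᵖ (X →ₗ[k] k)

noncomputable instance dualModR (Y : ModuleCat.{u} Bᵐᵒᵖ) : Module B (Y →ₗ[k] k) where
  smul b φ := φ ∘ₗ (DistribMulAction.toLinearMap k Y (op b))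
  one_smul φ := by
    ext x
    show φ ((op (1:B)) • x) = φ x
    rw [op_one, one_smul]
  mul_smul b c φ := by
    ext x
    show φ ((op (b * c)) • x) = φ ((op c) • (op b) • x)
    rw [op_mul, mul_smul]
  smul_zero b := rfl
  smul_add b φ ψ := rfl
  add_smul b c φ := by
    ext x
    show φ ((op (b + c)) • x) = φ ((op b) • x) + φ ((op c) • x)
    rw [op_add, add_smul, map_add]
  zero_smul φ := by
    ext x
    show φ ((op (0 : B)) • x) = 0
    rw [op_zero, zero_smul, map_zero]

/-- The standard duality `D = Hom_k(−, k)`, sending a right `B`-module to a left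
`B`-module. -/
def Dunop (Y : ModuleCat.{u} Bᵐᵒᵖ) : ModuleCat.{u} B :=
  ModuleCat.of B (Y →ₗ[k] k)

/-- `D(B_B)`, the standard injective cogenerator of `B`-Mod. -/
def Dcogen : ModuleCat.{u} B := Dunop k B (ModuleCat.of Bᵐᵒᵖ B)

/-- `T ≅ τ X = D Tr X`, the Auslander–Reiten translate. -/
def IsTauOf (X T : ModuleCat.{u} B) : Prop :=
  ∃ Tr : ModuleCat.{u} Bᵐᵒᵖ, IsTransposeOf B X Tr ∧ Nonempty (T ≃ₗ[B] Dunop k B Tr)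

/-- `T ≅ τ_n X = τ Ω^{n-1} X`. -/
def IsTauN (n : ℕ) (X T : ModuleCat.{u} B) : Prop :=
  ∃ Z, IsOmegaOf B (n-1) X Z ∧ IsTauOf k B Z T

/-- `T ≅ τ⁻ X = Tr D X`, the inverse Auslander–Reiten translate. -/
def IsTauInvOf (X T : ModuleCat.{u} B) : Prop :=
  ∃ Tr2 : ModuleCat.{u} Bᵐᵒᵖᵐᵒᵖ, IsTransposeOf Bᵐᵒᵖ (Dop k B X) Tr2 ∧
    Nonempty (T ≃ₗ[B] ((ModuleCat.restrictScalars (opOpHom B)).obj Tr2))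

/-- `T ≅ τ⁻_n X = τ⁻ Ω^{-(n-1)} X`. -/
def IsTauInvN (n : ℕ) (X T : ModuleCat.{u} B) : Prop :=
  ∃ Z, IsOmegaInvOf B (n-1) X Z ∧ IsTauInvOf k B Z T

/-- The Nakayama functor `ν = D Hom_B(−, B)` (on objects). -/
def nu (X : ModuleCat.{u} B) : ModuleCat.{u} B :=
  Dunop k B (ModuleCat.of Bᵐᵒᵖ (X →ₗ[B] B))

/-- The inverse Nakayama functor `ν⁻ = Hom_B(D(−), B)` (on objects). -/
def nuInv (X : ModuleCat.{u} B) : ModuleCat.{u} B :=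
  (ModuleCat.restrictScalars (opOpHom B)).obj
    (ModuleCat.of Bᵐᵒᵖᵐᵒᵖ ((Dop k B X) →ₗ[Bᵐᵒᵖ] Bᵐᵒᵖ))

/-- Relative `add Q`-dimension of `X` is at most `m`. -/
def RelAddDimLE (Q X : ModuleCat.{u} B) (m : ℕ) : Prop :=
  ResLE B Q (InAdd B Q) X m

/-- Relative `add Q`-codimension of `X` is at most `m`. -/
def RelAddCodimLE (Q X : ModuleCat.{u} B) (m : ℕ) : Prop :=
  CoresLE B Q (InAdd B Q) X m

/-- `Q` is an `l`-quasi-generator (without minimality of `l`). -/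
def QuasiGenLE (Q : ModuleCat.{u} B) (l : ℕ) : Prop :=
  CoresLE B Q (InAdd B Q) (ModuleCat.of B B) l

/-- `Q` is an `l`-quasi-generator: `l` is minimal. -/
def IsQuasiGen (Q : ModuleCat.{u} B) (l : ℕ) : Prop :=
  QuasiGenLE B Q l ∧ ∀ j, QuasiGenLE B Q j → l ≤ j

/-- `Q` is an `m`-quasi-cogenerator (without minimality of `m`). -/
def QuasiCogenLE (Q : ModuleCat.{u} B) (m : ℕ) : Prop :=
  ResLE B Q (InAdd B Q) (Dcogen k B) m

/-- `Q` is an `m`-quasi-cogenerator: `m` is minimal. -/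
def IsQuasiCogen (Q : ModuleCat.{u} B) (m : ℕ) : Prop :=
  QuasiCogenLE k B Q m ∧ ∀ j, QuasiCogenLE k B Q j → m ≤ j

/-- `(B, Q)` is a relative `n`-Auslander–Gorenstein pair. -/
def IsRelAGPair (Q : ModuleCat.{u} B) (n : ℕ) : Prop :=
  idLE B (ModuleCat.of B B) n ∧ idLE Bᵐᵒᵖ (ModuleCat.of Bᵐᵒᵖ Bᵐᵒᵖ) n ∧
  SelfOrth B Q ∧ domdimGE B Q (ModuleCat.of B B) n

/-- `Q` is an `(n, m, l)`-quasi-precluster tilting module. -/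
def IsQPCT (Q : ModuleCat.{u} B) (n m l : ℕ) : Prop :=
  (∀ i, 1 ≤ i → i ≤ n - 2 → ExtVanish B Q Q i) ∧
  IsQuasiGen B Q l ∧
  IsQuasiCogen k B Q m ∧
  (∃ T, IsTauN k B (n - m - 1) Q T ∧ RelAddDimLE B Q T m) ∧
  (∃ T, IsTauInvN k B (n - l - 1) Q T ∧ RelAddCodimLE B Q T l)

/-- Precomposition with `g`, as a `k`-linear map between Hom spaces. -/
def pcompk {X Y Z : ModuleCat.{u} B} (g : X →ₗ[B] Y) :
    (Y →ₗ[B] Z) →ₗ[k] (X →ₗ[B] Z) where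
  toFun h := h ∘ₗ g
  map_add' _ _ := rfl
  map_smul' _ _ := rfl


/-- `I` is an injective object for the exact structure `F_Mo`: it lies in
`add(DB ⊕ τ Mo)`. -/
def IsFInj (Mo I : ModuleCat.{u} B) : Prop :=
  ∃ T, IsTauOf k B Mo T ∧ InAdd B (ModuleCat.of B ((Dcogen k B) × T)) I

/-- `T` is an `F_Mo`-cotilting object: finite relative injective dimension, no relative
self-extensions, and the relative injectives `DB ⊕ τ Mo` admit a finite `F_Mo`-exact
resolution by objects of `add T`. -/
def FCotilting (Mo T : ModuleCat.{u} B) : Prop :=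
  (∃ r, CoresLE B Mo (IsFInj k B Mo) T r) ∧
  (∀ i, 1 ≤ i → FExtVanish B Mo T T i) ∧
  (∃ τM, IsTauOf k B Mo τM ∧
    ∃ r, ResLE B Mo (InAdd B T) (ModuleCat.of B ((Dcogen k B) × τM)) r)

end Duality

section EndStuff
variable (A : Type u) [Ring A] (Q : ModuleCat.{u} A)

/-- The canonical ring homomorphism `A → End_{End_A(Q)}(Q)`. -/
def toEndE : A →+* Module.End (Module.End A Q) Q where
  toFun a :=
    { toFun := fun q => a • q
      map_add' := fun x y => smul_add a x y
      map_smul' := fun e q => (e.map_smul a q).symm }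
  map_one' := by ext q; exact one_smul A q
  map_mul' x y := by ext q; exact mul_smul x y q
  map_zero' := by ext q; exact zero_smul A q
  map_add' x y := by ext q; exact add_smul x y q

/-- `Hom_A(Q, X)` as a left module over `End_A(Q)ᵐᵒᵖ` (i.e. a left `Λ`-module) by
precomposition. -/
noncomputable instance homPrecompMod (X : ModuleCat.{u} A) :
    Module (Module.End A Q)ᵐᵒᵖ (Q →ₗ[A] X) where
  smul e f := f ∘ₗ e.unop
  one_smul f := by ext q; rfl
  mul_smul e e' f := by ext q; rfl
  smul_zero e := rfl
  smul_add e f g := rfl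
  add_smul e e' f := by ext q; exact map_add f _ _
  zero_smul f := by ext q; exact map_zero f

/-- The actions of `A` and of `End_A(Q)` on `Q` commute. -/
instance endSMulComm : SMulCommClass (Module.End A Q) A Q :=
  ⟨fun e a q => e.map_smul a q⟩

instance endSMulComm' : SMulCommClass A (Module.End A Q) Q :=
  ⟨fun a e q => (e.map_smul a q).symm⟩

end EndStuff

end Paper
end


noncomputable section
namespace Paper
open CategoryTheory CategoryTheory.Abelian

section ExtBasics

/-- Vanishing of `Ext^i`. -/
def EV (R : Type) [Ring R] (X Y : Type) [AddCommGroup X] [Module R X] [AddCommGroup Y] [Module R Y]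
    (i : ℕ) : Prop := Subsingleton (Ext (ModuleCat.of R X) (ModuleCat.of R Y) i)

/-- Short exact sequences of modules. -/
structure SES {R : Type} [Ring R] {X Y Z : Type} [AddCommGroup X] [Module R X]
    [AddCommGroup Y] [Module R Y] [AddCommGroup Z] [Module R Z]
    (f : X →ₗ[R] Y) (g : Y →ₗ[R] Z) : Prop where
  inj : Function.Injective f
  ex : Function.Exact f g
  surj : Function.Surjective g

variable {R : Type} [Ring R] {X Y Z W : Type} [AddCommGroup X] [Module R X]
    [AddCommGroup Y] [Module R Y] [AddCommGroup Z] [Module R Z] [AddCommGroup W] [Module R W]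

/-- The associated short complex. -/
abbrev SES.sc {f : X →ₗ[R] Y} {g : Y →ₗ[R] Z} (h : SES f g) : ShortComplex (ModuleCat.{0} R) :=
  ShortComplex.mk (ModuleCat.ofHom f) (ModuleCat.ofHom g) (by
    ext x; exact h.ex.apply_apply_eq_zero x)

lemma SES.se {f : X →ₗ[R] Y} {g : Y →ₗ[R] Z} (h : SES f g) : h.sc.ShortExact :=
  ModuleCat.shortComplex_shortExact h.sc h.ex h.inj h.surj

variable {f : X →ₗ[R] Y} {g : Y →ₗ[R] Z}

lemma SES.contra3 (h : SES f g) {i : ℕ} (h1 : EV R X W i) (h2 : EV R Y W (i+1)) :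
    EV R Z W (i+1) := by
  refine ⟨fun a b => ?_⟩
  have key : ∀ a : Ext (ModuleCat.of R Z) (ModuleCat.of R W) (i+1), a = 0 := by
    intro a
    obtain ⟨x, hx⟩ := Ext.contravariant_sequence_exact₃ h.se (ModuleCat.of R W) a
      (h2.elim _ _) (add_comm 1 i)
    have hx0 : x = 0 := h1.elim _ _
    rw [← hx, hx0, Ext.comp_zero]
  rw [key a, key b]

lemma SES.contra1 (h : SES f g) {i : ℕ} (h1 : EV R Y W i) (h2 : EV R Z W (i+1)) :
    EV R X W i := by
  refine ⟨fun a b => ?_⟩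
  have key : ∀ a : Ext (ModuleCat.of R X) (ModuleCat.of R W) i, a = 0 := by
    intro a
    obtain ⟨x, hx⟩ := Ext.contravariant_sequence_exact₁ h.se (ModuleCat.of R W) a
      (add_comm 1 i) (h2.elim _ _)
    have hx0 : x = 0 := h1.elim _ _
    rw [← hx, hx0, Ext.comp_zero]
  rw [key a, key b]

lemma SES.cov1 (h : SES f g) {i : ℕ} (h1 : EV R W Z i) (h2 : EV R W Y (i+1)) :
    EV R W X (i+1) := by
  refine ⟨fun a b => ?_⟩
  have key : ∀ a : Ext (ModuleCat.of R W) (ModuleCat.of R X) (i+1), a = 0 := by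
    intro a
    obtain ⟨x, hx⟩ := Ext.covariant_sequence_exact₁ (ModuleCat.of R W) h.se a
      (h2.elim _ _) rfl
    have hx0 : x = 0 := h1.elim _ _
    rw [← hx, hx0, Ext.zero_comp]
  rw [key a, key b]

lemma SES.cov3 (h : SES f g) {i : ℕ} (h1 : EV R W Y i) (h2 : EV R W X (i+1)) :
    EV R W Z i := by
  refine ⟨fun a b => ?_⟩
  have key : ∀ a : Ext (ModuleCat.of R W) (ModuleCat.of R Z) i, a = 0 := by
    intro a
    obtain ⟨x, hx⟩ := Ext.covariant_sequence_exact₃ (ModuleCat.of R W) h.se a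
      rfl (h2.elim _ _)
    have hx0 : x = 0 := h1.elim _ _
    rw [← hx, hx0, Ext.zero_comp]
  rw [key a, key b]

lemma SES.extend (h : SES f g) (h1 : EV R Z W 1) (φ : X →ₗ[R] W) :
    ∃ ψ : Y →ₗ[R] W, ψ ∘ₗ f = φ := by
  obtain ⟨x, hx⟩ := Ext.contravariant_sequence_exact₁ h.se (ModuleCat.of R W)
      (Ext.mk₀ (ModuleCat.ofHom φ)) (add_zero 1) (h1.elim _ _)
  obtain ⟨y, rfl⟩ := (Ext.mk₀_bijective _ _).2 x
  rw [Ext.mk₀_comp_mk₀] at hx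
  have := (Ext.mk₀_bijective _ _).1 hx
  exact ⟨y.hom, congrArg ModuleCat.Hom.hom this⟩

lemma SES.lift (h : SES f g) (h1 : EV R W X 1) (φ : W →ₗ[R] Z) :
    ∃ ψ : W →ₗ[R] Y, g ∘ₗ ψ = φ := by
  obtain ⟨x, hx⟩ := Ext.covariant_sequence_exact₃ (ModuleCat.of R W) h.se
      (Ext.mk₀ (ModuleCat.ofHom φ)) (zero_add 1) (h1.elim _ _)
  obtain ⟨y, rfl⟩ := (Ext.mk₀_bijective _ _).2 x
  rw [Ext.mk₀_comp_mk₀] at hx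
  have := (Ext.mk₀_bijective _ _).1 hx
  exact ⟨y.hom, congrArg ModuleCat.Hom.hom this⟩

lemma SES.ev_of_extend (h : SES f g) (h1 : EV R Y W 1)
    (he : ∀ φ : X →ₗ[R] W, ∃ ψ : Y →ₗ[R] W, ψ ∘ₗ f = φ) : EV R Z W 1 := by
  refine ⟨fun a b => ?_⟩
  have key : ∀ a : Ext (ModuleCat.of R Z) (ModuleCat.of R W) 1, a = 0 := by
    intro a
    obtain ⟨x, hx⟩ := Ext.contravariant_sequence_exact₃ h.se (ModuleCat.of R W) a
      (h1.elim _ _) (add_zero 1)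
    obtain ⟨y, rfl⟩ := (Ext.mk₀_bijective _ _).2 x
    obtain ⟨ψ, hψ⟩ := he y.hom
    have : y = h.sc.f ≫ ModuleCat.ofHom ψ := by
      ext1; exact hψ.symm
    rw [← hx, this, ← Ext.mk₀_comp_mk₀]
    rw [← Ext.comp_assoc_of_second_deg_zero, h.se.extClass_comp, Ext.zero_comp]
  rw [key a, key b]

lemma EV.of_proj [Module.Projective R X] (i : ℕ) : EV R X W (i+1) := by
  have : Projective (ModuleCat.of R X) := inferInstance
  exact Ext.subsingleton_of_projective _ _ _

lemma EV.of_inj [Module.Injective R W] (i : ℕ) : EV R X W (i+1) := by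
  have : Injective (ModuleCat.of R W) := Module.injective_object_of_injective_module R W
  exact Ext.subsingleton_of_injective _ _ _

/-- unbundled `InAdd` -/
def IA (R : Type) [Ring R] (Q X : Type) [AddCommGroup X] [Module R X] [AddCommGroup Q]
    [Module R Q] : Prop :=
  ∃ (n : ℕ) (s : X →ₗ[R] (Fin n → Q)) (r : (Fin n → Q) →ₗ[R] X), r ∘ₗ s = LinearMap.id

lemma EV.ia_left {Q : Type} [AddCommGroup Q] [Module R Q] {i : ℕ} (h : EV R Q W i)
    (hX : IA R Q X) : EV R X W i := by
  obtain ⟨n, s, r, hrs⟩ := hX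
  refine ⟨fun a b => ?_⟩
  have key : ∀ a : Ext (ModuleCat.of R X) (ModuleCat.of R W) i, a = 0 := by
    intro a
    have e : 𝟙 (ModuleCat.of R X) = ∑ j : Fin n, ModuleCat.ofHom (LinearMap.proj j ∘ₗ s) ≫
        ModuleCat.ofHom (r ∘ₗ LinearMap.single R (fun _ => Q) j) := by
      ext x
      simp only [ModuleCat.hom_sum, LinearMap.sum_apply]
      have := congrArg r (LinearMap.sum_single_apply (φ := fun _ : Fin n => Q) (s x))
      rw [map_sum] at this
      exact (LinearMap.congr_fun hrs x).symm.trans this.symm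
    rw [← Ext.mk₀_id_comp a, e, Ext.mk₀_sum, Ext.sum_comp]
    refine Finset.sum_eq_zero fun j _ => ?_
    rw [← Ext.mk₀_comp_mk₀_assoc, h.elim (Ext.comp _ a _) 0, Ext.comp_zero]
  rw [key a, key b]

lemma EV.ia_right {Q : Type} [AddCommGroup Q] [Module R Q] {i : ℕ} (h : EV R W Q i)
    (hX : IA R Q X) : EV R W X i := by
  obtain ⟨n, s, r, hrs⟩ := hX
  refine ⟨fun a b => ?_⟩
  have key : ∀ a : Ext (ModuleCat.of R W) (ModuleCat.of R X) i, a = 0 := by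
    intro a
    have e : 𝟙 (ModuleCat.of R X) = ∑ j : Fin n, ModuleCat.ofHom (LinearMap.proj j ∘ₗ s) ≫
        ModuleCat.ofHom (r ∘ₗ LinearMap.single R (fun _ => Q) j) := by
      ext x
      simp only [ModuleCat.hom_sum, LinearMap.sum_apply]
      have := congrArg r (LinearMap.sum_single_apply (φ := fun _ : Fin n => Q) (s x))
      rw [map_sum] at this
      exact (LinearMap.congr_fun hrs x).symm.trans this.symm
    rw [← Ext.comp_mk₀_id a, e, Ext.mk₀_sum, Ext.comp_sum]
    refine Finset.sum_eq_zero fun j _ => ?_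
    rw [← Ext.mk₀_comp_mk₀, ← Ext.comp_assoc_of_second_deg_zero, h.elim (Ext.comp a _ _) 0,
      Ext.zero_comp]
  rw [key a, key b]

lemma IA.self : IA R X X :=
  ⟨1, LinearMap.pi fun _ => LinearMap.id, LinearMap.proj 0, by ext; rfl⟩

lemma IA.retract {Q : Type} [AddCommGroup Q] [Module R Q] (hX : IA R Q X) (s : Y →ₗ[R] X)
    (r : X →ₗ[R] Y) (h : r ∘ₗ s = LinearMap.id) : IA R Q Y := by
  obtain ⟨n, s', r', h'⟩ := hX
  refine ⟨n, s' ∘ₗ s, r ∘ₗ r', ?_⟩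
  rw [LinearMap.comp_assoc, ← LinearMap.comp_assoc s, h', LinearMap.id_comp, h]

lemma IA.equiv {Q : Type} [AddCommGroup Q] [Module R Q] (hX : IA R Q X) (e : X ≃ₗ[R] Y) :
    IA R Q Y := hX.retract e.symm.toLinearMap e.toLinearMap (by ext; simp)

lemma IA.pow {Q : Type} [AddCommGroup Q] [Module R Q] (n : ℕ) : IA R Q (Fin n → Q) :=
  ⟨n, LinearMap.id, LinearMap.id, rfl⟩

lemma EV.equiv_left {i : ℕ} (h : EV R X W i) (e : X ≃ₗ[R] Y) : EV R Y W i :=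
  h.ia_left (IA.self.equiv e)

lemma EV.equiv_right {i : ℕ} (h : EV R W X i) (e : X ≃ₗ[R] Y) : EV R W Y i :=
  h.ia_right (IA.self.equiv e)

end ExtBasics
end Paper
end

noncomputable section
namespace Paper
open CategoryTheory CategoryTheory.Abelian

section Dims
variable {R : Type} [Ring R] {X Y Z W : Type} [AddCommGroup X] [Module R X]
    [AddCommGroup Y] [Module R Y] [AddCommGroup Z] [Module R Z] [AddCommGroup W] [Module R W]
    {f : X →ₗ[R] Y} {g : Y →ₗ[R] Z}

def PDL (R : Type) [Ring R] (X : Type) [AddCommGroup X] [Module R X] (n : ℕ) : Prop :=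
  ∀ (Y : Type) [AddCommGroup Y] [Module R Y] (i : ℕ), n < i → EV R X Y i

def IDL (R : Type) [Ring R] (X : Type) [AddCommGroup X] [Module R X] (n : ℕ) : Prop :=
  ∀ (Y : Type) [AddCommGroup Y] [Module R Y] (i : ℕ), n < i → EV R Y X i

lemma PDL.mono {m n : ℕ} (h : PDL R X m) (hmn : m ≤ n) : PDL R X n :=
  fun Y _ _ i hi => h Y i (by omega)

lemma IDL.mono {m n : ℕ} (h : IDL R X m) (hmn : m ≤ n) : IDL R X n :=
  fun Y _ _ i hi => h Y i (by omega)

lemma PDL.of_proj [Module.Projective R X] (n : ℕ) : PDL R X n := fun Y _ _ i hi => by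
  obtain ⟨j, rfl⟩ : ∃ j, i = j + 1 := ⟨i - 1, by omega⟩
  exact EV.of_proj j

lemma IDL.of_inj [Module.Injective R X] (n : ℕ) : IDL R X n := fun Y _ _ i hi => by
  obtain ⟨j, rfl⟩ : ∃ j, i = j + 1 := ⟨i - 1, by omega⟩
  exact EV.of_inj j

lemma PDL.equiv {n : ℕ} (h : PDL R X n) (e : X ≃ₗ[R] Y) : PDL R Y n :=
  fun Y _ _ i hi => (h Y i hi).equiv_left e

lemma IDL.equiv {n : ℕ} (h : IDL R X n) (e : X ≃ₗ[R] Y) : IDL R Y n :=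
  fun Y _ _ i hi => (h Y i hi).equiv_right e

lemma PDL.ia {n : ℕ} (h : PDL R X n) (e : IA R X Y) : PDL R Y n :=
  fun Y _ _ i hi => (h Y i hi).ia_left e

lemma IDL.ia {n : ℕ} (h : IDL R X n) (e : IA R X Y) : IDL R Y n :=
  fun Y _ _ i hi => (h Y i hi).ia_right e

lemma SES.pdl3 (h : SES f g) {n : ℕ} (h1 : PDL R X n) (h2 : PDL R Y (n+1)) : PDL R Z (n+1) :=
  fun W _ _ i hi => by
  obtain ⟨j, rfl⟩ : ∃ j, i = j + 1 := ⟨i - 1, by omega⟩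
  exact h.contra3 (h1 W j (by omega)) (h2 W _ hi)

lemma SES.pdl1 (h : SES f g) {n : ℕ} (h1 : PDL R Y n) (h2 : PDL R Z (n+1)) : PDL R X n :=
  fun W _ _ i hi => h.contra1 (h1 W i hi) (h2 W _ (by omega))

lemma SES.idl1 (h : SES f g) {n : ℕ} (h1 : IDL R Z n) (h2 : IDL R Y (n+1)) : IDL R X (n+1) :=
  fun W _ _ i hi => by
  obtain ⟨j, rfl⟩ : ∃ j, i = j + 1 := ⟨i - 1, by omega⟩
  exact h.cov1 (h1 W j (by omega)) (h2 W _ hi)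

lemma SES.idl3 (h : SES f g) {n : ℕ} (h1 : IDL R Y n) (h2 : IDL R X (n+1)) : IDL R Z n :=
  fun W _ _ i hi => h.cov3 (h1 W i hi) (h2 W _ (by omega))

lemma SES.of_surj (g : Y →ₗ[R] Z) (hg : Function.Surjective g) :
    SES (LinearMap.ker g).subtype g where
  inj := Subtype.val_injective
  ex := LinearMap.exact_subtype_ker_map g
  surj := hg

lemma SES.of_inj (f : X →ₗ[R] Y) (hf : Function.Injective f) :
    SES f (LinearMap.range f).mkQ where
  inj := hf
  ex := LinearMap.exact_map_mkQ_range f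
  surj := Submodule.mkQ_surjective _

variable (R X) in
abbrev freeCov : (X →₀ R) →ₗ[R] X := Finsupp.linearCombination R id

variable (R X) in
lemma freeCov_surj : Function.Surjective (freeCov R X) := by
  intro x; exact ⟨Finsupp.single x 1, by simp⟩

lemma SES.proj_of_ev (h : SES f g) [Module.Projective R Y] (h1 : EV R Z X 1) :
    Module.Projective R Z := by
  obtain ⟨s, hs⟩ := h.lift h1 LinearMap.id
  exact Module.Projective.of_split s g hs

lemma PDL.proj (h : PDL R X 0) : Module.Projective R X :=
  (SES.of_surj _ (freeCov_surj R X)).proj_of_ev (h _ 1 one_pos)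

lemma IDL.inj (h : IDL R X 0) : Module.Injective R X := by
  refine ⟨fun A B _ _ _ _ f hf g => ?_⟩
  obtain ⟨ψ, hψ⟩ := (SES.of_inj f hf).extend (h _ 1 one_pos) g
  exact ⟨ψ, fun x => LinearMap.congr_fun hψ x⟩

variable (R X) in
lemma exists_inj : ∃ (I : ModuleCat.{0} R) (f : X →ₗ[R] I), Module.Injective R I ∧
    Function.Injective f := by
  refine ⟨Injective.under (ModuleCat.of R X), (Injective.ι (ModuleCat.of R X)).hom, ?_, ?_⟩
  · have := Injective.injective_under (ModuleCat.of R X)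
    exact Module.injective_module_of_injective_object R _
  · exact (ModuleCat.mono_iff_injective _).1 (Injective.ι_mono _)

instance zeroModSub : Subsingleton (zeroMod R) := inferInstanceAs (Subsingleton PUnit)

lemma zhom_l (f g : zeroMod R →ₗ[R] X) : f = g := by
  ext x; rw [Subsingleton.elim x 0, map_zero, map_zero]

lemma zhom_r (f g : X →ₗ[R] zeroMod R) : f = g := by
  ext x; exact Subsingleton.elim _ _

lemma ResLE.zero_iff' (C : ModuleCat.{0} R → Prop) (M : ModuleCat.{0} R)
    (h : ResLE R (zeroMod R) C M 0) : ∃ P : ModuleCat.{0} R, C P ∧ Nonempty (P ≃ₗ[R] M) := by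
  obtain ⟨P, d, aug, h1, h2, h3, h4, -⟩ := h
  refine ⟨P 0, h1 0 le_rfl, ⟨LinearEquiv.ofBijective aug ⟨?_, h3⟩⟩⟩
  have := h2 1 one_pos
  rw [injective_iff_map_eq_zero]
  intro a ha
  obtain ⟨b, rfl⟩ := (h4 a).1 ha
  rw [Subsingleton.elim b 0, map_zero]

lemma ResLE.of_equiv0 (C : ModuleCat.{0} R → Prop) (M P : ModuleCat.{0} R) (hC : C P)
    (e : P ≃ₗ[R] M) : ResLE R (zeroMod R) C M 0 := by
  refine ⟨fun j => Nat.casesOn j P (fun _ => zeroMod R), fun j => Nat.casesOn j 0 (fun _ => 0),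
    e.toLinearMap, ?_, ?_, e.surjective, ?_, ?_, ?_, ?_, ?_⟩
  · intro j hj; obtain rfl : j = 0 := by omega
    exact hC
  · intro j hj; obtain ⟨j, rfl⟩ : ∃ i, j = i + 1 := ⟨j - 1, by omega⟩
    exact zeroModSub
  · intro x
    constructor
    · intro hx
      exact ⟨0, ((map_eq_zero_iff e e.injective).1 hx).symm⟩
    · rintro ⟨y, rfl⟩; exact map_zero _
  · intro j x
    have : Subsingleton (zeroMod R) := zeroModSub
    constructor
    · intro _; exact ⟨0, this.elim _ _⟩
    · rintro ⟨y, rfl⟩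
      exact (congrArg _ (this.elim _ 0)).trans (map_zero _)
  · exact fun f => ⟨0, zhom_l _ _⟩
  · exact fun f _ => ⟨0, zhom_l _ _⟩
  · exact fun j f _ => ⟨0, zhom_l _ _⟩

lemma ResLE.dec (C : ModuleCat.{0} R → Prop) (M : ModuleCat.{0} R) (n : ℕ)
    (h : ResLE R (zeroMod R) C M (n+1)) : ∃ (P : ModuleCat.{0} R) (p : P →ₗ[R] M),
      C P ∧ Function.Surjective p ∧
        ResLE R (zeroMod R) C (ModuleCat.of R (LinearMap.ker p)) n := by
  obtain ⟨P, d, aug, h1, h2, h3, h4, h5, -⟩ := h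
  refine ⟨P 0, aug, h1 0 (by omega), h3, fun j => P (j+1), fun j => d (j+1),
    (d 0).codRestrict _ (fun x => h4.apply_apply_eq_zero x),
    fun j hj => h1 _ (by omega), fun j hj => h2 _ (by omega), ?_, ?_, fun j => h5 _, ?_, ?_, ?_⟩
  · rintro ⟨x, hx⟩
    obtain ⟨y, rfl⟩ := (h4 x).1 hx
    exact ⟨y, rfl⟩
  · intro x
    rw [← h5 0 x, Subtype.ext_iff]; rfl
  · exact fun f => ⟨0, zhom_l _ _⟩
  · exact fun f _ => ⟨0, zhom_l _ _⟩
  · exact fun j f _ => ⟨0, zhom_l _ _⟩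

lemma ResLE.comp (C : ModuleCat.{0} R → Prop) (M P : ModuleCat.{0} R) (n : ℕ)
    (p : P →ₗ[R] M) (hP : C P) (hp : Function.Surjective p)
    (h : ResLE R (zeroMod R) C (ModuleCat.of R (LinearMap.ker p)) n) :
    ResLE R (zeroMod R) C M (n+1) := by
  obtain ⟨Q, d, aug, h1, h2, h3, h4, h5, -⟩ := h
  refine ⟨fun j => Nat.casesOn j P Q,
    fun j => Nat.casesOn j ((LinearMap.ker p).subtype ∘ₗ aug) d, p, ?_, ?_, hp, ?_, ?_, ?_, ?_, ?_⟩
  · intro j hj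
    cases j with
    | zero => exact hP
    | succ j => exact h1 j (by omega)
  · intro j hj
    cases j with
    | zero => omega
    | succ j => exact h2 j (by omega)
  · intro x
    constructor
    · intro hx
      obtain ⟨y, hy⟩ := h3 ⟨x, hx⟩
      exact ⟨y, congrArg Subtype.val hy⟩
    · rintro ⟨y, rfl⟩
      exact (aug y).2
  · intro j
    cases j with
    | zero =>
      intro x
      rw [← h4 x, Subtype.ext_iff]; rfl
    | succ j => exact h5 j
  · exact fun f => ⟨0, zhom_l _ _⟩
  · exact fun f _ => ⟨0, zhom_l _ _⟩
  · exact fun j f _ => ⟨0, zhom_l _ _⟩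

theorem pdLE_iff (n : ℕ) : ∀ (M : ModuleCat.{0} R), pdLE R M n ↔ PDL R M n := by
  induction n with
  | zero =>
    intro M
    constructor
    · intro h
      obtain ⟨P, hP, ⟨e⟩⟩ := ResLE.zero_iff' _ _ h
      have : Module.Projective R M := Module.Projective.of_equiv e
      exact PDL.of_proj 0
    · intro h
      exact ResLE.of_equiv0 _ M M h.proj (LinearEquiv.refl _ _)
  | succ n ih =>
    intro M
    constructor
    · intro h
      obtain ⟨P, p, hP, hp, hK⟩ := ResLE.dec _ _ _ h
      have hP : Module.Projective R P := hP
      exact (SES.of_surj p hp).pdl3 ((ih _).1 hK) (PDL.of_proj _)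
    · intro h
      have hs := SES.of_surj _ (freeCov_surj R M)
      refine ResLE.comp _ M (ModuleCat.of R (M →₀ R)) n (freeCov R M) ?_ (freeCov_surj R M) ?_
      · exact (inferInstance : Module.Projective R (M →₀ R))
      · exact (ih _).2 (hs.pdl1 (PDL.of_proj _) h)

lemma CoresLE.zero_iff' (C : ModuleCat.{0} R → Prop) (M : ModuleCat.{0} R)
    (h : CoresLE R (zeroMod R) C M 0) : ∃ P : ModuleCat.{0} R, C P ∧ Nonempty (M ≃ₗ[R] P) := by
  obtain ⟨P, ι, d, h1, h2, h3, h4, -⟩ := h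
  refine ⟨P 0, h1 0 le_rfl, ⟨LinearEquiv.ofBijective ι ⟨h3, ?_⟩⟩⟩
  have := h2 1 one_pos
  intro x
  exact (h4 x).1 (Subsingleton.elim _ _)

lemma CoresLE.of_equiv0 (test : ModuleCat.{0} R) (C : ModuleCat.{0} R → Prop)
    (M P : ModuleCat.{0} R) (hC : C P)
    (e : M ≃ₗ[R] P) : CoresLE R test C M 0 := by
  have hs : Subsingleton (zeroMod R) := zeroModSub
  refine ⟨fun j => Nat.casesOn j P (fun _ => zeroMod R), e.toLinearMap,
    fun j => Nat.casesOn j 0 (fun _ => 0),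
    ?_, ?_, e.injective, ?_, ?_, ?_, ?_, ?_⟩
  · intro j hj; obtain rfl : j = 0 := by omega
    exact hC
  · intro j hj; obtain ⟨j, rfl⟩ : ∃ i, j = i + 1 := ⟨j - 1, by omega⟩
    exact zeroModSub
  · intro x
    constructor
    · intro hx
      exact ⟨e.symm x, by simp⟩
    · rintro ⟨y, rfl⟩; rfl
  · intro j x
    constructor
    · intro _
      cases j with
      | zero => exact ⟨0, hs.elim _ _⟩
      | succ j => exact ⟨0, hs.elim _ _⟩
    · rintro ⟨y, rfl⟩
      exact hs.elim _ _
  · exact fun f => ⟨f ∘ₗ e.symm.toLinearMap, by ext; simp⟩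
  · intro f hf
    refine ⟨0, ?_⟩
    ext x
    have := LinearMap.congr_fun hf (e.symm x)
    simp at this
    simpa using this.symm
  · exact fun j f _ => ⟨0, zhom_l _ _⟩

lemma CoresLE.dec (C : ModuleCat.{0} R → Prop) (M : ModuleCat.{0} R) (n : ℕ)
    (h : CoresLE R (zeroMod R) C M (n+1)) : ∃ (P Q : ModuleCat.{0} R) (i : M →ₗ[R] P)
      (p : P →ₗ[R] Q), C P ∧ SES i p ∧ CoresLE R (zeroMod R) C Q n := by
  obtain ⟨P, ι, d, h1, h2, h3, h4, h5, -⟩ := h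
  refine ⟨P 0, ModuleCat.of R (LinearMap.range (d 0)), ι, (d 0).rangeRestrict, h1 0 (by omega),
    ⟨h3, ?_, LinearMap.surjective_rangeRestrict _⟩,
    fun j => P (j+1), (LinearMap.range (d 0)).subtype, fun j => d (j+1),
    fun j hj => h1 _ (by omega), fun j hj => h2 _ (by omega), Subtype.val_injective, ?_,
    fun j => h5 _, ?_, ?_, ?_⟩
  · intro x
    rw [← h4 x, Subtype.ext_iff]; rfl
  · intro x
    rw [h5 0 x]
    exact ⟨fun ⟨y, hy⟩ => ⟨⟨x, y, hy⟩, rfl⟩, fun ⟨⟨_, y, hy⟩, h⟩ => ⟨y, hy.trans h⟩⟩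
  · exact fun f => ⟨0, zhom_r _ _⟩
  · exact fun f _ => ⟨0, zhom_r _ _⟩
  · exact fun j f _ => ⟨0, zhom_r _ _⟩

lemma CoresLE.comp (test : ModuleCat.{0} R) (C : ModuleCat.{0} R → Prop)
    (M P Q : ModuleCat.{0} R) (n : ℕ)
    (i : M →ₗ[R] P) (p : P →ₗ[R] Q) (hP : C P) (hs : SES i p)
    (hext : ∀ φ : M →ₗ[R] test, ∃ ψ : P →ₗ[R] test, ψ ∘ₗ i = φ)
    (h : CoresLE R test C Q n) :
    CoresLE R test C M (n+1) := by
  obtain ⟨N, ι, d, h1, h2, h3, h4, h5, h6, h7, h8⟩ := h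
  refine ⟨fun j => Nat.casesOn j P N, i,
    fun j => Nat.casesOn j (ι ∘ₗ p) d, ?_, ?_, hs.inj, ?_, ?_, hext, ?_, ?_⟩
  · intro j hj
    cases j with
    | zero => exact hP
    | succ j => exact h1 j (by omega)
  · intro j hj
    cases j with
    | zero => omega
    | succ j => exact h2 j (by omega)
  · intro x
    rw [← hs.ex x]
    exact map_eq_zero_iff ι h3
  · intro j
    cases j with
    | zero =>
      intro x
      refine (h4 x).trans ?_
      constructor
      · rintro ⟨y, rfl⟩
        obtain ⟨z, rfl⟩ := hs.surj y
        exact ⟨z, rfl⟩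
      · rintro ⟨z, rfl⟩
        exact ⟨p z, rfl⟩
    | succ j => exact h5 j
  · intro φ hφ
    obtain ⟨φ', hφ'⟩ : ∃ φ' : Q →ₗ[R] test, φ' ∘ₗ p = φ := by
      have hk : LinearMap.ker p ≤ LinearMap.ker φ := by
        intro x hx
        obtain ⟨y, rfl⟩ := (hs.ex x).1 hx
        exact LinearMap.congr_fun hφ y
      refine ⟨(LinearMap.ker p).liftQ φ hk ∘ₗ
        (p.quotKerEquivOfSurjective hs.surj).symm.toLinearMap, ?_⟩
      ext x
      have : (p.quotKerEquivOfSurjective hs.surj).symm (p x) = Submodule.Quotient.mk x := by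
        rw [LinearEquiv.symm_apply_eq]; rfl
      simp [this]
    obtain ⟨ψ, hψ⟩ := h6 φ'
    refine ⟨ψ, ?_⟩
    show ψ ∘ₗ (ι ∘ₗ p) = φ
    rw [← LinearMap.comp_assoc, hψ, hφ']
  · intro j φ hφ
    cases j with
    | zero =>
      refine h7 φ ?_
      ext x
      obtain ⟨z, rfl⟩ := hs.surj x
      exact LinearMap.congr_fun hφ z
    | succ j => exact h8 j φ hφ

theorem idLE_iff (n : ℕ) : ∀ (M : ModuleCat.{0} R), idLE R M n ↔ IDL R M n := by
  induction n with
  | zero =>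
    intro M
    constructor
    · intro h
      obtain ⟨P, hP, ⟨e⟩⟩ := CoresLE.zero_iff' _ _ h
      have hP : Module.Injective R P := hP
      exact IDL.equiv (IDL.of_inj 0) e.symm
    · intro h
      exact CoresLE.of_equiv0 _ _ M M h.inj (LinearEquiv.refl _ _)
  | succ n ih =>
    intro M
    constructor
    · intro h
      obtain ⟨P, Q, i, p, hP, hs, hK⟩ := CoresLE.dec _ _ _ h
      have hP : Module.Injective R P := hP
      exact hs.idl1 ((ih _).1 hK) (IDL.of_inj _)
    · intro h
      obtain ⟨I, i, hI, hi⟩ := exists_inj R M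
      have hs := SES.of_inj i hi
      refine CoresLE.comp _ _ M I (ModuleCat.of R _) n i _ hI hs (fun φ => ⟨0, zhom_r _ _⟩) ?_
      exact (ih _).2 (hs.idl3 (IDL.of_inj _) h)

end Dims
end Paper
end

noncomputable section
namespace Paper
open CategoryTheory CategoryTheory.Abelian

section ExtV
variable {R : Type} [Ring R]

def ProjRes.shift {X : ModuleCat.{0} R} (S : ProjRes R X) :
    ProjRes R (ModuleCat.of R (LinearMap.ker S.aug)) where
  P j := S.P (j+1)
  d j := S.d (j+1)
  aug := (S.d 0).codRestrict _ (fun x => S.exact0.apply_apply_eq_zero x)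
  proj j := S.proj _
  augSurj := by
    rintro ⟨x, hx⟩
    obtain ⟨y, rfl⟩ := (S.exact0 x).1 hx
    exact ⟨y, rfl⟩
  exact0 := by
    intro x
    rw [← S.exact 0 x, Subtype.ext_iff]; rfl
  exact j := S.exact _

def ResProp {X : ModuleCat.{0} R} (S : ProjRes R X) (Y : Type) [AddCommGroup Y] [Module R Y]
    (i : ℕ) : Prop :=
  ∀ f : S.P (i+1) →ₗ[R] Y, f ∘ₗ S.d (i+1) = 0 → ∃ g : S.P i →ₗ[R] Y, f = g ∘ₗ S.d i

lemma resProp_iff (Y : Type) [AddCommGroup Y] [Module R Y] (i : ℕ) :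
    ∀ {X : ModuleCat.{0} R} (S : ProjRes R X), ResProp S Y i ↔ EV R X Y (i+1) := by
  induction i with
  | zero =>
    intro X S
    have hs := SES.of_surj S.aug S.augSurj
    have hp := S.proj 0
    have hsur := S.shift.augSurj
    have hk : LinearMap.ker S.shift.aug = LinearMap.range (S.d 1) := by
      ext x; exact S.shift.exact0 x
    constructor
    · intro h
      refine hs.ev_of_extend (EV.of_proj 0) fun φ => ?_
      obtain ⟨g, hg⟩ := h (φ ∘ₗ S.shift.aug) (by
        ext x
        show φ (S.shift.aug (S.shift.d 0 x)) = 0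
        exact (congrArg φ (S.shift.exact0.apply_apply_eq_zero x)).trans (map_zero φ))
      refine ⟨g, ?_⟩
      ext x
      obtain ⟨y, rfl⟩ := hsur x
      exact (LinearMap.congr_fun hg y).symm
    · intro h f hf
      have hle : LinearMap.ker S.shift.aug ≤ LinearMap.ker f := by
        rw [hk]; rintro _ ⟨y, rfl⟩; exact LinearMap.congr_fun hf y
      obtain ⟨φ, hφ⟩ : ∃ φ : LinearMap.ker S.aug →ₗ[R] Y, φ ∘ₗ S.shift.aug = f := by
        refine ⟨(LinearMap.ker S.shift.aug).liftQ f hle ∘ₗ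
          (S.shift.aug.quotKerEquivOfSurjective hsur).symm.toLinearMap, ?_⟩
        ext x
        have : (S.shift.aug.quotKerEquivOfSurjective hsur).symm (S.shift.aug x) =
          Submodule.Quotient.mk x := by
          rw [LinearEquiv.symm_apply_eq]; rfl
        show (LinearMap.ker S.shift.aug).liftQ f hle
          ((S.shift.aug.quotKerEquivOfSurjective hsur).symm (S.shift.aug x)) = f x
        rw [this]; rfl
      obtain ⟨ψ, hψ⟩ := hs.extend h φ
      refine ⟨ψ, ?_⟩
      rw [← hφ, ← hψ]; rfl
  | succ i ih =>
    intro X S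
    have hs := SES.of_surj S.aug S.augSurj
    have hp := S.proj 0
    refine (ih S.shift).trans ⟨fun h => hs.contra3 h (EV.of_proj _), fun h =>
      hs.contra1 (EV.of_proj _) h⟩

variable (R) in
def syz (X : ModuleCat.{0} R) : ℕ → ModuleCat.{0} R
  | 0 => X
  | (n+1) => ModuleCat.of R (LinearMap.ker (freeCov R (syz X n)))

def stdRes (X : ModuleCat.{0} R) : ProjRes R X where
  P j := ModuleCat.of R (syz R X j →₀ R)
  d j := (LinearMap.ker (freeCov R (syz R X j))).subtype ∘ₗ freeCov R (syz R X (j+1))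
  aug := show (syz R X 0 →₀ R) →ₗ[R] syz R X 0 from freeCov R (syz R X 0)
  proj j := (inferInstance : Module.Projective R (syz R X j →₀ R))
  augSurj := freeCov_surj R (syz R X 0)
  exact0 := by
    intro x
    constructor
    · intro hx
      obtain ⟨y, hy⟩ := freeCov_surj R (syz R X 1) ⟨x, hx⟩
      exact ⟨y, congrArg Subtype.val hy⟩
    · rintro ⟨y, rfl⟩
      exact (freeCov R (syz R X 1) y).2
  exact j := by
    intro x
    have : (LinearMap.ker (freeCov R (syz R X j))).subtype (freeCov R (syz R X (j+1)) x) = 0 ↔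
      freeCov R (syz R X (j+1)) x = 0 := map_eq_zero_iff _ Subtype.val_injective
    refine this.trans ?_
    constructor
    · intro hx
      obtain ⟨y, hy⟩ := freeCov_surj R (syz R X (j+2)) ⟨x, hx⟩
      exact ⟨y, congrArg Subtype.val hy⟩
    · rintro ⟨y, rfl⟩
      exact (freeCov R (syz R X (j+2)) y).2

theorem selfOrth_iff (X : ModuleCat.{0} R) : SelfOrth R X ↔ ∀ i, 0 < i → EV R X X i := by
  constructor
  · intro h i hi
    obtain ⟨j, rfl⟩ : ∃ j, i = j + 1 := ⟨i - 1, by omega⟩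
    exact (resProp_iff X j (stdRes X)).1 (h (j+1) hi (stdRes X))
  · intro h i hi
    obtain ⟨j, rfl⟩ : ∃ j, i = j + 1 := ⟨i - 1, by omega⟩
    exact fun S => (resProp_iff X j S).2 (h (j+1) hi)

end ExtV
end Paper
end

noncomputable section
namespace Paper
open CategoryTheory CategoryTheory.Abelian

section Fg
variable {R : Type} [Ring R] {X Y Z W : Type} [AddCommGroup X] [Module R X]
    [AddCommGroup Y] [Module R Y] [AddCommGroup Z] [Module R Z] [AddCommGroup W] [Module R W]
    {f : X →ₗ[R] Y} {g : Y →ₗ[R] Z}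

lemma IA.of_fg_proj [Module.Finite R X] [Module.Projective R X] : IA R R X := by
  obtain ⟨n, p, hp⟩ := Module.Finite.exists_fin' R X
  obtain ⟨s, hs⟩ := Module.projective_lifting_property p LinearMap.id hp
  exact ⟨n, s, p, hs⟩

lemma IA.fin {Q : Type} [AddCommGroup Q] [Module R Q] [Module.Finite R Q] (h : IA R Q X) :
    Module.Finite R X := by
  obtain ⟨n, s, r, h⟩ := h
  exact Module.Finite.of_surjective r fun x => ⟨s x, LinearMap.congr_fun h x⟩

lemma L2_zero [IsNoetherianRing R] (N : ℕ) : ∀ (X : ModuleCat.{0} R) [Module.Finite R X],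
    PDL R X N → (∀ i, 0 < i → EV R X R i) → PDL R X 0 := by
  induction N with
  | zero => intro X _ h _; exact h
  | succ N ih =>
    intro X _ h he
    obtain ⟨n, p, hp⟩ := Module.Finite.exists_fin' R X
    have hs := SES.of_surj p hp
    have hK : PDL R (LinearMap.ker p) 0 := ih (ModuleCat.of R (LinearMap.ker p))
      (hs.pdl1 (PDL.of_proj _) h) (fun i hi => hs.contra1 (by
        obtain ⟨j, rfl⟩ : ∃ j, i = j + 1 := ⟨i - 1, by omega⟩
        exact EV.of_proj j) (he (i+1) (by omega)))
    have := hK.proj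
    have h1 : EV R X (LinearMap.ker p) 1 := (he 1 one_pos).ia_right IA.of_fg_proj
    have := hs.proj_of_ev h1
    exact PDL.of_proj 0

lemma L2 [IsNoetherianRing R] (n : ℕ) : ∀ (X : ModuleCat.{0} R) [Module.Finite R X] (N : ℕ),
    PDL R X N → (∀ i, n < i → EV R X R i) → PDL R X n := by
  induction n with
  | zero => intro X _ N h he; exact L2_zero N X h he
  | succ n ih =>
    intro X _ N h he
    obtain ⟨m, p, hp⟩ := Module.Finite.exists_fin' R X
    have hs := SES.of_surj p hp
    have hK : PDL R (LinearMap.ker p) n := ih (ModuleCat.of R (LinearMap.ker p)) N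
      (hs.pdl1 (PDL.of_proj _) (h.mono (Nat.le_succ N))) (fun i hi => hs.contra1 (by
        obtain ⟨j, rfl⟩ : ∃ j, i = j + 1 := ⟨i - 1, by omega⟩
        exact EV.of_proj j) (he (i+1) (by omega)))
    exact hs.pdl3 hK (PDL.of_proj _)

end Fg

section CTs
variable (R : Type) [Ring R] (T : Type) [AddCommGroup T] [Module R T]

/-- finite coresolutions by `add T` -/
def CT : ℕ → ModuleCat.{0} R → Prop
  | 0, X => IA R T X
  | (n+1), X => ∃ (M Y : ModuleCat.{0} R) (f : X →ₗ[R] M) (g : M →ₗ[R] Y),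
      SES f g ∧ IA R T M ∧ CT n Y

variable {R T}

lemma SES.equiv {X X' Y Z Z' : Type} [AddCommGroup X] [Module R X] [AddCommGroup X'] [Module R X']
    [AddCommGroup Y] [Module R Y] [AddCommGroup Z] [Module R Z] [AddCommGroup Z'] [Module R Z']
    {f : X →ₗ[R] Y} {g : Y →ₗ[R] Z} (h : SES f g) (e : X' ≃ₗ[R] X) (e' : Z ≃ₗ[R] Z') :
    SES (f ∘ₗ e.toLinearMap) (e'.toLinearMap ∘ₗ g) where
  inj := h.inj.comp e.injective
  surj := e'.surjective.comp h.surj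
  ex := by
    intro x
    have : (e'.toLinearMap ∘ₗ g) x = 0 ↔ g x = 0 := map_eq_zero_iff e' e'.injective
    rw [this, h.ex x]
    constructor
    · rintro ⟨y, rfl⟩; exact ⟨e.symm y, by simp⟩
    · rintro ⟨y, rfl⟩; exact ⟨e y, rfl⟩

lemma CT.equiv {n : ℕ} {X Y : ModuleCat.{0} R} (h : CT R T n X) (e : X ≃ₗ[R] Y) :
    CT R T n Y := by
  cases n with
  | zero => exact IA.equiv h e
  | succ n =>
    obtain ⟨M, Z, f, g, hs, hM, hZ⟩ := h
    exact ⟨M, Z, _, _, hs.equiv e.symm (LinearEquiv.refl _ _), hM, hZ⟩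

lemma CT.ev_left (hT : ∀ i, 0 < i → EV R T T i) {n : ℕ} : ∀ {X : ModuleCat.{0} R},
    CT R T n X → ∀ i, 0 < i → EV R X T i := by
  induction n with
  | zero => intro X h i hi; exact (hT i hi).ia_left h
  | succ n ih =>
    rintro X ⟨M, Z, f, g, hs, hM, hZ⟩ i hi
    exact hs.contra1 ((hT i hi).ia_left hM) (ih hZ (i+1) (by omega))

lemma CT.ev_right {W : Type} [AddCommGroup W] [Module R W]
    (hW : ∀ i, 0 < i → EV R W T i) {n : ℕ} : ∀ {X : ModuleCat.{0} R},
    CT R T n X → ∀ i, n < i → EV R W X i := by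
  induction n with
  | zero => intro X h i hi; exact (hW i hi).ia_right h
  | succ n ih =>
    rintro X ⟨M, Z, f, g, hs, hM, hZ⟩ i hi
    obtain ⟨j, rfl⟩ : ∃ j, i = j + 1 := ⟨i - 1, by omega⟩
    exact hs.cov1 (ih hZ j (by omega)) ((hW _ (by omega)).ia_right hM)

lemma CT.idl {q : ℕ} (hT : IDL R T q) {n : ℕ} : ∀ {X : ModuleCat.{0} R},
    CT R T n X → IDL R X (n + q) := by
  induction n with
  | zero => intro X h; exact (hT.ia h).mono (by omega)
  | succ n ih =>
    rintro X ⟨M, Z, f, g, hs, hM, hZ⟩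
    have := hs.idl1 (ih hZ) ((hT.ia hM).mono (by omega))
    exact this.mono (by omega)

lemma CT.cores (hT : ∀ i, 0 < i → EV R T T i) {n : ℕ} : ∀ {X : ModuleCat.{0} R},
    CT R T n X → CoresLE R (ModuleCat.of R T) (InAdd R (ModuleCat.of R T)) X n := by
  induction n with
  | zero => intro X h; exact CoresLE.of_equiv0 _ _ X X h (LinearEquiv.refl _ _)
  | succ n ih =>
    rintro X ⟨M, Z, f, g, hs, hM, hZ⟩
    exact CoresLE.comp _ _ X M Z n f g hM hs (hs.extend (hZ.ev_left hT 1 one_pos)) (ih hZ)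

lemma CT.of_cores {n : ℕ} : ∀ {X : ModuleCat.{0} R},
    CoresLE R (zeroMod R) (InAdd R (ModuleCat.of R T)) X n → CT R T n X := by
  induction n with
  | zero =>
    intro X h
    obtain ⟨P, hP, ⟨e⟩⟩ := CoresLE.zero_iff' _ _ h
    exact IA.equiv hP e.symm
  | succ n ih =>
    intro X h
    obtain ⟨P, Q, i, p, hP, hs, hK⟩ := CoresLE.dec _ _ _ h
    exact ⟨P, Q, i, p, hs, hP, ih hK⟩

lemma IA.of_subsingleton {X : Type} [AddCommGroup X] [Module R X] [Subsingleton X] : IA R T X :=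
  ⟨0, 0, 0, by ext x; exact Subsingleton.elim _ _⟩

lemma CT.domdim (hT : ∀ i, 0 < i → EV R T T i) {n : ℕ} {X : ModuleCat.{0} R}
    (h : CT R T n X) (N : ℕ) : domdimGE R (ModuleCat.of R T) X N := by
  obtain ⟨M, ι, d, h1, h2, h3, h4, h5, h6, h7, h8⟩ := h.cores hT
  refine Or.inr ⟨M, ι, d, fun j _ => ?_, h3, fun _ => h4, fun j _ => h5 j, h6, fun _ => h7,
    fun j _ => h8 j⟩
  by_cases hj : j ≤ n
  · exact h1 j hj
  · have := h2 j (by omega)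
    exact IA.of_subsingleton

lemma CT.fin [IsNoetherianRing R] [Module.Finite R T] {n : ℕ} {X : ModuleCat.{0} R}
    (h : CT R T n X) : Module.Finite R X := by
  cases n with
  | zero => exact IA.fin h
  | succ n =>
    obtain ⟨M, Z, f, g, hs, hM, hZ⟩ := h
    have := hM.fin
    exact Module.Finite.of_injective f hs.inj

end CTs
end Paper
end

noncomputable section
namespace Paper
open CategoryTheory CategoryTheory.Abelian

section Tilt
set_option linter.unusedSectionVars false
variable {R : Type} [Ring R] (A : Type) [Ring A] (T : Type) [AddCommGroup T] [Module R T]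
  [Module A T] [SMulCommClass R A T] [SMulCommClass A R T]
  {X Y Z : Type} [AddCommGroup X] [Module R X]
    [AddCommGroup Y] [Module R Y] [AddCommGroup Z] [Module R Z]

/-- precomposition -/
def pre (f : X →ₗ[R] Y) : (Y →ₗ[R] T) →ₗ[A] (X →ₗ[R] T) where
  toFun φ := φ ∘ₗ f
  map_add' _ _ := rfl
  map_smul' _ _ := rfl

/-- double dual evaluation -/
def dd : X →ₗ[R] ((X →ₗ[R] T) →ₗ[A] T) where
  toFun x :=
    { toFun := fun φ => φ x
      map_add' := fun _ _ => rfl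
      map_smul' := fun _ _ => rfl }
  map_add' x y := by ext φ; exact map_add φ x y
  map_smul' r x := by ext φ; exact map_smul φ r x

@[simp] lemma dd_apply (x : X) (φ : X →ₗ[R] T) : dd A T x φ = φ x := rfl

@[simp] lemma pre_apply (f : X →ₗ[R] Y) (φ : Y →ₗ[R] T) : pre A T f φ = φ ∘ₗ f := rfl

lemma SES.factor {f : X →ₗ[R] Y} {g : Y →ₗ[R] Z} (hs : SES f g) {W : Type} [AddCommGroup W]
    [Module R W] (φ : Y →ₗ[R] W) (hφ : φ ∘ₗ f = 0) : ∃ φ' : Z →ₗ[R] W, φ' ∘ₗ g = φ := by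
  have hk : LinearMap.ker g ≤ LinearMap.ker φ := by
    intro x hx
    obtain ⟨y, rfl⟩ := (hs.ex x).1 hx
    exact LinearMap.congr_fun hφ y
  refine ⟨(LinearMap.ker g).liftQ φ hk ∘ₗ
    (g.quotKerEquivOfSurjective hs.surj).symm.toLinearMap, ?_⟩
  ext x
  have : (g.quotKerEquivOfSurjective hs.surj).symm (g x) = Submodule.Quotient.mk x := by
    rw [LinearEquiv.symm_apply_eq]; rfl
  simp [this]

lemma SES.pre {f : X →ₗ[R] Y} {g : Y →ₗ[R] Z} (hs : SES f g)
    (he : ∀ φ : X →ₗ[R] T, ∃ ψ : Y →ₗ[R] T, ψ ∘ₗ f = φ) :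
    SES (Paper.pre A T g) (Paper.pre A T f) where
  inj := by
    intro φ ψ h
    ext z
    obtain ⟨y, rfl⟩ := hs.surj z
    exact LinearMap.congr_fun h y
  ex := by
    intro φ
    constructor
    · intro h
      exact hs.factor φ h
    · rintro ⟨ψ, rfl⟩
      ext x
      show ψ (g (f x)) = 0
      rw [hs.ex.apply_apply_eq_zero, map_zero]
  surj := he

lemma IA.dual {Q : Type} [AddCommGroup Q] [Module R Q] (h : IA R Q X) :
    IA A (Q →ₗ[R] T) (X →ₗ[R] T) := by
  obtain ⟨n, s, r, h⟩ := h
  refine ⟨n, LinearMap.pi fun j => Paper.pre A T (r ∘ₗ LinearMap.single R (fun _ => Q) j),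
    ∑ j, Paper.pre A T (LinearMap.proj j ∘ₗ s) ∘ₗ LinearMap.proj j, ?_⟩
  ext φ x
  have e := congrArg (fun y => φ (r y)) (LinearMap.sum_single_apply (φ := fun _ : Fin n => Q) (s x))
  have e2 : r (s x) = x := LinearMap.congr_fun h x
  simp only [map_sum, e2] at e
  rw [LinearMap.comp_apply, LinearMap.sum_apply, LinearMap.sum_apply]
  exact e

variable (R) in
/-- `A → End_R T` is bijective. -/
def Bal : Prop := ∀ φ : T →ₗ[R] T, ∃! a : A, ∀ t, φ t = a • t

variable {A T}

def Bal.equiv (h : Bal R A T) : A ≃ₗ[A] (T →ₗ[R] T) :=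
  LinearEquiv.ofBijective
    ({ toFun := fun a =>
        { toFun := fun t => a • t
          map_add' := fun x y => smul_add a x y
          map_smul' := fun r t => (smul_comm a r t) }
       map_add' := fun a b => by ext t; exact add_smul a b t
       map_smul' := fun a b => by ext t; exact mul_smul a b t } : A →ₗ[A] (T →ₗ[R] T))
    ⟨fun a b hab => by
      obtain ⟨c, hc, hu⟩ := h
        { toFun := fun t => a • t
          map_add' := fun x y => smul_add a x y
          map_smul' := fun r t => (smul_comm a r t) }
      rw [hu a (fun t => rfl), hu b (fun t => LinearMap.congr_fun hab t)],
     fun φ => by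
      obtain ⟨c, hc, hu⟩ := h φ
      exact ⟨c, by ext t; exact (hc t).symm⟩⟩

lemma dd_bij_add (hb : Bal R A T) (h : IA R T X) : Function.Bijective (dd (R := R) A T (X := X)) := by
  obtain ⟨n, s, r, h⟩ := h
  have e0 : ∀ x, r (s x) = x := fun x => LinearMap.congr_fun h x
  constructor
  · rw [injective_iff_map_eq_zero]
    intro x hx
    have : s x = 0 := by
      ext j
      exact LinearMap.congr_fun hx (LinearMap.proj j ∘ₗ s)
    rw [← e0 x, this, map_zero]
  · intro F
    refine ⟨r (fun j => F (LinearMap.proj j ∘ₗ s)), ?_⟩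
    ext φ
    have hc : ∀ j, ∃ a : A, ∀ t, φ (r (Pi.single j t)) = a • t := fun j =>
      (hb (φ ∘ₗ r ∘ₗ LinearMap.single R (fun _ => T) j)).exists
    choose a ha using hc
    have e1 : ∀ v : Fin n → T, φ (r v) = ∑ j, a j • v j := by
      intro v
      have e := congrArg (fun y => φ (r y)) (LinearMap.sum_single_apply (φ := fun _ : Fin n => T) v)
      simp only [map_sum, ha] at e
      exact e.symm
    have e2 : φ = ∑ j, a j • (LinearMap.proj j ∘ₗ s) := by
      ext x
      rw [LinearMap.sum_apply, ← e0 x, e1, e0]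
      rfl
    rw [dd_apply, e1]
    conv_rhs => rw [e2, map_sum]
    simp only [map_smul]

theorem tilt_a (hT : ∀ i, 0 < i → EV R T T i) (hb : Bal R A T) (n : ℕ) :
    ∀ X : ModuleCat.{0} R, CT R T n X → PDL A (X →ₗ[R] T) n ∧
      (∀ i, 0 < i → EV A (X →ₗ[R] T) T i) ∧ Function.Bijective (dd (R := R) A T (X := X)) := by
  have key : ∀ X : ModuleCat.{0} R, IA R T X → Module.Projective A (X →ₗ[R] T) := by
    intro X h
    have h1 : IA A A (X →ₗ[R] T) := by
      obtain ⟨n, s, r, h⟩ := IA.dual A T h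
      let E : (Fin n → A) ≃ₗ[A] (Fin n → (T →ₗ[R] T)) := LinearEquiv.piCongrRight fun _ => hb.equiv
      exact ⟨n, E.symm.toLinearMap ∘ₗ s, r ∘ₗ E.toLinearMap, by
        rw [← h]; ext x; simp⟩
    exact ((PDL.of_proj (R := A) (X := A) 0).ia h1).proj
  induction n with
  | zero =>
    intro X h
    have := key X h
    exact ⟨PDL.of_proj 0, fun i hi => PDL.of_proj 0 _ i hi, dd_bij_add hb h⟩
  | succ n ih =>
    rintro X ⟨M, Y, f, g, hs, hM, hY⟩
    obtain ⟨y1, y2, y3⟩ := ih Y hY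
    have m1 := key M hM
    have m3 := dd_bij_add hb hM
    have hext := hs.extend (hY.ev_left hT 1 one_pos)
    have hd := hs.pre A T hext
    refine ⟨hd.pdl3 y1 (PDL.of_proj _), ?_, ?_, ?_⟩
    · intro i hi
      obtain ⟨j, rfl⟩ : ∃ j, i = j + 1 := ⟨i - 1, by omega⟩
      cases j with
      | zero =>
        refine hd.ev_of_extend (EV.of_proj 0) fun φ => ?_
        obtain ⟨y, rfl⟩ := y3.2 φ
        obtain ⟨m, rfl⟩ := hs.surj y
        exact ⟨dd A T m, rfl⟩
      | succ j => exact hd.contra3 (y2 (j+1) (by omega)) (EV.of_proj _)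
    · rw [injective_iff_map_eq_zero]
      intro x hx
      have : dd (R := R) A T (f x) = 0 := by
        ext φ
        exact LinearMap.congr_fun hx (φ ∘ₗ f)
      have := (map_eq_zero_iff _ m3.1).1 this
      exact (map_eq_zero_iff _ hs.inj).1 this
    · intro F
      obtain ⟨m, hm⟩ := m3.2 (F ∘ₗ pre A T f)
      have h0 : dd (R := R) A T (g m) = 0 := by
        ext φ
        have := LinearMap.congr_fun hm (φ ∘ₗ g)
        have e : (φ ∘ₗ g) ∘ₗ f = 0 := by
          ext x
          show φ (g (f x)) = 0
          rw [hs.ex.apply_apply_eq_zero, map_zero]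
        simp only [LinearMap.comp_apply, pre_apply, e, map_zero] at this
        exact this
      have := (map_eq_zero_iff _ y3.1).1 h0
      obtain ⟨x, rfl⟩ := (hs.ex m).1 this
      refine ⟨x, ?_⟩
      ext ψ
      obtain ⟨φ, rfl⟩ := hext ψ
      exact LinearMap.congr_fun hm φ

theorem tilt_b [IsNoetherianRing R] (m : ℕ) :
    ∀ (X : ModuleCat.{0} R) [Module.Finite R X], (∀ i, 0 < i → EV R X T i) → PDL R X m →
      CT A T m (ModuleCat.of A (X →ₗ[R] T)) := by
  have key : ∀ (X : Type) [AddCommGroup X] [Module R X], IA R R X → IA A T (X →ₗ[R] T) := by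
    intro X _ _ h
    obtain ⟨n, s, r, h⟩ := IA.dual A T h
    let E : (Fin n → T) ≃ₗ[A] (Fin n → (R →ₗ[R] T)) :=
      LinearEquiv.piCongrRight fun _ => (LinearMap.ringLmapEquivSelf R A T).symm
    exact ⟨n, E.symm.toLinearMap ∘ₗ s, r ∘ₗ E.toLinearMap, by
        rw [← h]; ext x; simp⟩
  induction m with
  | zero =>
    intro X _ h1 h2
    have := h2.proj
    exact key X IA.of_fg_proj
  | succ m ih =>
    intro X _ h1 h2
    obtain ⟨d, p, hp⟩ := Module.Finite.exists_fin' R X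
    have hs := SES.of_surj p hp
    have hd := hs.pre A T (hs.extend (h1 1 one_pos))
    refine ⟨ModuleCat.of A ((Fin d → R) →ₗ[R] T), ModuleCat.of A (LinearMap.ker p →ₗ[R] T),
      _, _, hd, key _ (IA.pow d), ?_⟩
    refine ih (ModuleCat.of R (LinearMap.ker p)) (fun i hi => ?_) (hs.pdl1 (PDL.of_proj _) h2)
    obtain ⟨j, rfl⟩ : ∃ j, i = j + 1 := ⟨i - 1, by omega⟩
    exact hs.contra1 (EV.of_proj _) (h1 _ (by omega))

variable (R A T) in
structure TiltData : Prop where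
  ev : ∀ i, 0 < i → EV R T T i
  bal : Bal R A T
  ct : ∃ r, CT R T r (ModuleCat.of R R)
  pd : ∃ r, PDL R T r

theorem TiltData.main [IsNoetherianRing R] [IsNoetherianRing A] [Module.Finite R T]
    [Module.Finite A T] (h : TiltData R A T) :
    TiltData A R T ∧ ∀ m, PDL R T m → PDL A T m ∧ CT A T m (ModuleCat.of A A) := by
  obtain ⟨r, hr⟩ := h.ct
  obtain ⟨a1, a2, a3⟩ := tilt_a h.ev h.bal r _ hr
  let e : (R →ₗ[R] T) ≃ₗ[A] T := LinearMap.ringLmapEquivSelf R A T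
  have pdT : PDL A T r := a1.equiv e
  have evT : ∀ i, 0 < i → EV A T T i := fun i hi => (a2 i hi).equiv_left e
  have ctA : ∀ m, PDL R T m → CT A T m (ModuleCat.of A A) := fun m hm =>
    (tilt_b (A := A) m (ModuleCat.of R T) h.ev hm).equiv (h.bal.equiv).symm
  refine ⟨⟨evT, ?_, ?_, r, pdT⟩, fun m hm => ⟨?_, ctA m hm⟩⟩
  · intro φ
    have hR : ∀ (ψ : R →ₗ[R] T) (x : R), ψ x = x • ψ 1 := fun ψ x => by
      rw [← map_smul, smul_eq_mul, mul_one]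
    obtain ⟨x, hx⟩ := a3.2 (φ ∘ₗ e.toLinearMap)
    refine ⟨x, fun t => ?_, fun y hy => a3.1 ?_⟩
    · have := LinearMap.congr_fun hx (e.symm t)
      have h2 : e (e.symm t) = t := e.apply_symm_apply t
      have h3 : e.symm t 1 = t := h2
      simp only [LinearMap.comp_apply, LinearEquiv.coe_coe, h2] at this
      rw [← this]
      exact (hR (e.symm t) x).trans (by rw [h3])
    · rw [hx]
      ext ψ
      show ψ y = φ (e ψ)
      rw [hR, hy]; rfl
  · obtain ⟨m, hm⟩ := h.pd
    exact ⟨m, ctA m hm⟩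
  · exact L2 m (ModuleCat.of A T) r pdT (fun i hi => (ctA m hm).ev_right evT i hi)

end Tilt
end Paper
end

noncomputable section
namespace Paper
open CategoryTheory CategoryTheory.Abelian

section KDual
set_option linter.unusedSectionVars false

/-- the `k`-dual, as a module over opposite rings -/
def KD (k : Type) [Field k] (X : Type) [AddCommGroup X] [Module k X] : Type := X →ₗ[k] k

section inst
variable (k : Type) [Field k] (X : Type) [AddCommGroup X] [Module k X]

instance : AddCommGroup (KD k X) := inferInstanceAs (AddCommGroup (X →ₗ[k] k))
instance KD.kmodule : Module k (KD k X) := inferInstanceAs (Module k (X →ₗ[k] k))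
instance : FunLike (KD k X) X k := inferInstanceAs (FunLike (X →ₗ[k] k) X k)
instance : LinearMapClass (KD k X) k X k := inferInstanceAs (LinearMapClass (X →ₗ[k] k) k X k)
instance [Module.Finite k X] : Module.Finite k (KD k X) :=
  inferInstanceAs (Module.Finite k (Module.Dual k X))

variable {k X}
@[ext] lemma KD.ext {φ ψ : KD k X} (h : ∀ x, φ x = ψ x) : φ = ψ := LinearMap.ext h
@[simp] lemma KD.add_apply (φ ψ : KD k X) (x : X) : (φ + ψ) x = φ x + ψ x := rfl
@[simp] lemma KD.zero_apply (x : X) : (0 : KD k X) x = 0 := rfl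
@[simp] lemma KD.ksmul_apply (c : k) (φ : KD k X) (x : X) : (c • φ) x = c • φ x := rfl

lemma KD.sep {x y : X} (h : ∀ φ : KD k X, φ x = φ y) : x = y := by
  rw [← sub_eq_zero, ← Module.forall_dual_apply_eq_zero_iff k]
  intro φ
  rw [map_sub, sub_eq_zero]
  exact h φ

variable {B : Type} [Ring B] [Algebra k B] [Module B X] [IsScalarTower k B X]

instance KD.opmodule : Module Bᵐᵒᵖ (KD k X) where
  smul b φ := (φ : X →ₗ[k] k) ∘ₗ (DistribSMul.toLinearMap k X b.unop)
  one_smul φ := by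
    ext x
    show φ ((1 : Bᵐᵒᵖ).unop • x) = φ x
    rw [unop_one, one_smul]
  mul_smul b c φ := by
    ext x
    show φ ((b * c).unop • x) = φ (c.unop • b.unop • x)
    rw [unop_mul, mul_smul]
  smul_zero b := rfl
  smul_add b φ ψ := rfl
  add_smul b c φ := by
    ext x
    show φ ((b + c).unop • x) = φ (b.unop • x) + φ (c.unop • x)
    exact (congrArg φ (add_smul b.unop c.unop x)).trans (map_add φ _ _)
  zero_smul φ := by
    ext x
    show φ ((0 : Bᵐᵒᵖ).unop • x) = 0
    rw [unop_zero, zero_smul, map_zero]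

lemma KD.smul_apply (b : Bᵐᵒᵖ) (φ : KD k X) (x : X) : (b • φ) x = φ (b.unop • x) := rfl

instance KD.tower : IsScalarTower k Bᵐᵒᵖ (KD k X) := ⟨fun c b φ => by
  ext x
  show φ ((c • b).unop • x) = c • φ (b.unop • x)
  rw [unop_smul, smul_assoc, map_smul]⟩

instance KD.comm {A : Type} [Ring A] [Algebra k A] [Module A X] [IsScalarTower k A X]
    [SMulCommClass A B X] : SMulCommClass Aᵐᵒᵖ Bᵐᵒᵖ (KD k X) := ⟨fun a b φ => by
  ext x
  exact congrArg φ (smul_comm a.unop b.unop x).symm⟩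

end inst

variable {k : Type} [Field k] {B : Type} [Ring B] [Algebra k B]
  {X Y Z : Type} [AddCommGroup X] [Module k X] [Module B X] [IsScalarTower k B X]
  [AddCommGroup Y] [Module k Y] [Module B Y] [IsScalarTower k B Y]
  [AddCommGroup Z] [Module k Z] [Module B Z] [IsScalarTower k B Z]

variable (k) in
/-- transpose -/
def tr (f : X →ₗ[B] Y) : KD k Y →ₗ[Bᵐᵒᵖ] KD k X where
  toFun φ := (φ : Y →ₗ[k] k) ∘ₗ f.restrictScalars k
  map_add' _ _ := rfl
  map_smul' b φ := by
    ext x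
    exact congrArg φ (map_smul f b.unop x).symm

@[simp] lemma tr_apply (f : X →ₗ[B] Y) (φ : KD k Y) (x : X) : tr k f φ x = φ (f x) := rfl

lemma tr_comp (f : X →ₗ[B] Y) (g : Y →ₗ[B] Z) : tr k (g ∘ₗ f) = tr k f ∘ₗ tr k g := rfl
lemma tr_id : tr k (LinearMap.id : X →ₗ[B] X) = LinearMap.id := rfl

lemma tr_inj {f g : X →ₗ[B] Y} (h : tr k f = tr k g) : f = g := by
  ext x
  refine KD.sep (k := k) fun φ => ?_
  have := LinearMap.congr_fun h φ
  exact congrArg (fun ψ : KD k X => ψ x) this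

lemma tr_surj [Module.Finite k X] (F : KD k X →ₗ[Bᵐᵒᵖ] KD k Y) :
    ∃ f : Y →ₗ[B] X, tr k f = F := by
  have h : ∀ y : Y, ∃ x : X, ∀ φ : KD k X, φ x = F φ y := by
    intro y
    let G : Module.Dual k (Module.Dual k X) :=
      { toFun := fun φ => F φ y
        map_add' := fun φ ψ => by
          have : F (φ + ψ : KD k X) = F φ + F ψ := map_add F _ _
          exact congrArg (fun χ : KD k Y => χ y) this
        map_smul' := fun c φ => by
          have : F (c • φ : KD k X) = c • F φ := (F.restrictScalars k).map_smul c φ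
          exact congrArg (fun χ : KD k Y => χ y) this }
    refine ⟨(Module.evalEquiv k X).symm G, fun φ => ?_⟩
    have := (Module.evalEquiv k X).apply_symm_apply G
    exact LinearMap.congr_fun this φ
  choose f hf using h
  refine ⟨{ toFun := f, map_add' := fun a b => ?_, map_smul' := fun b y => ?_ }, ?_⟩
  · refine KD.sep (k := k) fun φ => ?_
    rw [map_add, hf, hf, hf, map_add]
  · refine KD.sep (k := k) fun φ => ?_
    rw [hf]
    have := congrArg (fun χ : KD k Y => χ y) (F.map_smul (op b) φ)
    refine this.symm.trans ?_
    exact (hf y _).symm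
  · ext φ y
    exact hf y φ

lemma SES.kd {f : X →ₗ[B] Y} {g : Y →ₗ[B] Z} (h : SES f g) : SES (tr k g) (tr k f) where
  inj := by
    intro φ ψ e
    ext z
    obtain ⟨y, rfl⟩ := h.surj z
    exact congrArg (fun χ : KD k Y => χ y) e
  ex := by
    have hk : SES (f.restrictScalars k) (g.restrictScalars k) := ⟨h.inj, h.ex, h.surj⟩
    intro φ
    constructor
    · intro e
      obtain ⟨ψ, hψ⟩ := hk.factor (φ : Y →ₗ[k] k) e
      exact ⟨ψ, hψ⟩
    · rintro ⟨ψ, rfl⟩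
      ext x
      show ψ (g (f x)) = 0
      rw [h.ex.apply_apply_eq_zero, map_zero]
  surj := by
    intro φ
    obtain ⟨r, hr⟩ := (f.restrictScalars k).exists_leftInverse_of_injective
      (LinearMap.ker_eq_bot.2 h.inj)
    refine ⟨(φ : X →ₗ[k] k) ∘ₗ r, ?_⟩
    ext x
    exact congrArg φ (LinearMap.congr_fun hr x)

lemma IA.kd (h : IA B Y X) : IA Bᵐᵒᵖ (KD k Y) (KD k X) := by
  obtain ⟨n, s, r, h⟩ := h
  refine ⟨n, LinearMap.pi fun j => tr k (r ∘ₗ LinearMap.single B (fun _ => Y) j),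
    ∑ j, tr k (LinearMap.proj j ∘ₗ s) ∘ₗ LinearMap.proj j, ?_⟩
  apply LinearMap.ext
  intro φ
  apply KD.ext
  intro x
  have e := congrArg (fun y => φ (r y)) (LinearMap.sum_single_apply (φ := fun _ : Fin n => Y) (s x))
  have e2 : r (s x) = x := LinearMap.congr_fun h x
  simp only [map_sum, e2] at e
  have e3 : ∀ (χ : Fin n → KD k X), (∑ j, χ j) x = ∑ j, χ j x := fun χ =>
    LinearMap.sum_apply (σ₁₂ := RingHom.id k) _ _ _
  rw [LinearMap.comp_apply, LinearMap.sum_apply, e3]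
  exact e

def kdEquiv (e : X ≃ₗ[B] Y) : KD k Y ≃ₗ[Bᵐᵒᵖ] KD k X :=
  LinearEquiv.ofLinearMap (tr k e.toLinearMap) (tr k e.symm.toLinearMap)
    (by rw [← tr_comp, ← tr_id]; congr 1; ext; simp)
    (by rw [← tr_comp, ← tr_id]; congr 1; ext; simp)

variable (k B) in
/-- the standard injective cogenerator -/
def CoB : Type := B →ₗ[k] k

instance : AddCommGroup (CoB k B) := inferInstanceAs (AddCommGroup (B →ₗ[k] k))
instance : Module k (CoB k B) := inferInstanceAs (Module k (B →ₗ[k] k))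
instance : FunLike (CoB k B) B k := inferInstanceAs (FunLike (B →ₗ[k] k) B k)
instance : LinearMapClass (CoB k B) k B k := inferInstanceAs (LinearMapClass (B →ₗ[k] k) k B k)
instance [Module.Finite k B] : Module.Finite k (CoB k B) :=
  inferInstanceAs (Module.Finite k (Module.Dual k B))

@[ext] lemma CoB.ext {φ ψ : CoB k B} (h : ∀ x, φ x = ψ x) : φ = ψ := LinearMap.ext h

instance : Module B (CoB k B) where
  smul b φ := (φ : B →ₗ[k] k) ∘ₗ LinearMap.mulRight k b
  one_smul φ := by
    ext x
    exact congrArg φ (mul_one x)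
  mul_smul b c φ := by
    ext x
    exact congrArg φ (mul_assoc x b c).symm
  smul_zero b := rfl
  smul_add b φ ψ := rfl
  add_smul b c φ := by
    ext x
    exact (congrArg φ (mul_add x b c)).trans (map_add φ _ _)
  zero_smul φ := by
    ext x
    exact (congrArg φ (mul_zero x)).trans (map_zero φ)

lemma CoB.smul_apply (b : B) (φ : CoB k B) (x : B) : (b • φ) x = φ (x * b) := rfl

instance : IsScalarTower k B (CoB k B) := ⟨fun c b φ => by
  ext x
  show φ (x * (c • b)) = c • φ (x * b)
  rw [mul_smul_comm, map_smul]⟩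

/-- coinduction -/
def coind (φ : KD k X) : X →ₗ[B] CoB k B where
  toFun x := (φ : X →ₗ[k] k) ∘ₗ (LinearMap.toSpanSingleton B X x).restrictScalars k
  map_add' x y := by
    ext b
    show φ (b • (x + y)) = φ (b • x) + φ (b • y)
    rw [smul_add, map_add]
  map_smul' c x := by
    ext b
    show φ (b • c • x) = φ ((b * c) • x)
    rw [mul_smul]

@[simp] lemma coind_apply (φ : KD k X) (x : X) (b : B) : coind φ x b = φ (b • x) := rfl

instance CoB.inj : Module.Injective B (CoB k B) := by
  refine ⟨fun M N _ _ _ _ f hf g => ?_⟩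
  let _ : Module k M := Module.compHom M (algebraMap k B)
  let _ : Module k N := Module.compHom N (algebraMap k B)
  have : IsScalarTower k B M := ⟨fun c b x => by
    show (c • b) • x = (algebraMap k B c) • (b • x)
    rw [Algebra.smul_def, mul_smul]⟩
  have : IsScalarTower k B N := ⟨fun c b x => by
    show (c • b) • x = (algebraMap k B c) • (b • x)
    rw [Algebra.smul_def, mul_smul]⟩
  let e : KD k M :=
    { toFun := fun m => g m 1
      map_add' := fun x y => by rw [map_add]; rfl
      map_smul' := fun c x => by
        have := (g.restrictScalars k).map_smul c x
        exact congrArg (fun χ : CoB k B => χ 1) this }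
  obtain ⟨ψ, hψ⟩ := (SES.of_inj f hf).kd (k := k) |>.surj e
  refine ⟨coind ψ, fun x => ?_⟩
  ext b
  show ψ (b • f x) = g x b
  rw [← map_smul]
  have h1 : ψ (f (b • x)) = e (b • x) := congrArg (fun χ : KD k M => χ (b • x)) hψ
  rw [h1]
  show g (b • x) 1 = g x b
  rw [map_smul, CoB.smul_apply, one_mul]

lemma exists_emb (k : Type) [Field k] (B : Type) [Ring B] [Algebra k B]
    (X : Type) [AddCommGroup X] [Module k X] [Module B X] [IsScalarTower k B X]
    [Module.Finite k X] : ∃ (d : ℕ) (i : X →ₗ[B] (Fin d → CoB k B)), Function.Injective i := by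
  let b := Module.finBasis k (KD k X)
  refine ⟨_, LinearMap.pi fun j => coind (b j), ?_⟩
  rw [injective_iff_map_eq_zero]
  intro x hx
  have h1 : ∀ j, b j x = 0 := fun j => by
    have := congrArg (fun χ : CoB k B => χ 1) (congrFun hx j)
    exact (congrArg (b j) (one_smul B x).symm).trans this
  refine KD.sep (k := k) fun φ => ?_
  rw [map_zero, ← b.sum_repr φ]
  have e3 : ∀ {n : ℕ} (χ : Fin n → KD k X), (∑ j, χ j) x = ∑ j, χ j x := fun χ =>
    LinearMap.sum_apply (σ₁₂ := RingHom.id k) _ _ _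
  rw [e3]
  refine Finset.sum_eq_zero fun j _ => ?_
  rw [KD.ksmul_apply, h1, smul_zero]

instance pi_inj (d : ℕ) : Module.Injective B (Fin d → CoB k B) :=
  IDL.inj ((IDL.of_inj 0).ia (IA.pow (Q := CoB k B) d))

def kdCoB [Module.Finite k B] : Bᵐᵒᵖ ≃ₗ[Bᵐᵒᵖ] KD k (CoB k B) :=
  LinearEquiv.ofBijective
    ({ toFun := fun b => (Module.evalEquiv k B b.unop : Module.Dual k (Module.Dual k B))
       map_add' := fun b c => map_add (Module.evalEquiv k B) b.unop c.unop
       map_smul' := fun _ _ => rfl } : Bᵐᵒᵖ →ₗ[Bᵐᵒᵖ] KD k (CoB k B))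
    ((Module.evalEquiv k B).bijective.comp MulOpposite.unop_bijective)

instance kd_proj [Module.Finite k B] (d : ℕ) :
    Module.Projective Bᵐᵒᵖ (KD k (Fin d → CoB k B)) := by
  have h : IA Bᵐᵒᵖ (KD k (CoB k B)) (KD k (Fin d → CoB k B)) := (IA.pow d).kd
  exact (((PDL.of_proj (R := Bᵐᵒᵖ) (X := Bᵐᵒᵖ) 0).equiv (kdCoB (k := k))).ia h).proj

/-- `CoB` of the opposite ring is the dual of the regular module. -/
def coBop : CoB k Bᵐᵒᵖ ≃ₗ[Bᵐᵒᵖ] KD k B :=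
  LinearEquiv.ofLinearMap
    ({ toFun := fun φ => (φ : Bᵐᵒᵖ →ₗ[k] k) ∘ₗ (opLinearEquiv k : B ≃ₗ[k] Bᵐᵒᵖ).toLinearMap
       map_add' := fun _ _ => rfl
       map_smul' := fun _ _ => rfl } : CoB k Bᵐᵒᵖ →ₗ[Bᵐᵒᵖ] KD k B)
    ({ toFun := fun φ => (φ : B →ₗ[k] k) ∘ₗ (opLinearEquiv k : B ≃ₗ[k] Bᵐᵒᵖ).symm.toLinearMap
       map_add' := fun _ _ => rfl
       map_smul' := fun _ _ => rfl } : KD k B →ₗ[Bᵐᵒᵖ] CoB k Bᵐᵒᵖ)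
    rfl rfl

instance kdB_inj : Module.Injective Bᵐᵒᵖ (KD k B) :=
  ((IDL.of_inj 0).equiv (coBop (k := k) (B := B))).inj

end KDual
end Paper
end

noncomputable section
namespace Paper
open CategoryTheory CategoryTheory.Abelian

section DualDims
set_option linter.unusedSectionVars false
variable {k : Type} [Field k] {B : Type} [Ring B] [Algebra k B] [Module.Finite k B]

lemma idl_to_pdl (n : ℕ) : ∀ (X : Type) [AddCommGroup X] [Module k X] [Module B X]
    [IsScalarTower k B X] [Module.Finite k X], IDL B X n → PDL Bᵐᵒᵖ (KD k X) n := by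
  induction n with
  | zero =>
    intro X _ _ _ _ _ h
    obtain ⟨d, i, hi⟩ := exists_emb k B X
    have hs := SES.of_inj i hi
    obtain ⟨r, hr⟩ := hs.extend (h _ 1 one_pos) LinearMap.id
    have : IA Bᵐᵒᵖ (KD k (Fin d → CoB k B)) (KD k X) :=
      IA.self.retract (tr k r) (tr k i) (by rw [← tr_comp, hr, tr_id])
    exact (PDL.of_proj 0).ia this
  | succ n ih =>
    intro X _ _ _ _ _ h
    obtain ⟨d, i, hi⟩ := exists_emb k B X
    have hs := SES.of_inj i hi
    exact hs.kd.pdl3 (ih _ (hs.idl3 (IDL.of_inj _) h)) (PDL.of_proj _)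

lemma pdl_to_idl (n : ℕ) : ∀ (X : Type) [AddCommGroup X] [Module k X] [Module B X]
    [IsScalarTower k B X] [Module.Finite k X], PDL Bᵐᵒᵖ (KD k X) n → IDL B X n := by
  induction n with
  | zero =>
    intro X _ _ _ _ _ h
    obtain ⟨d, i, hi⟩ := exists_emb k B X
    have hs := SES.of_inj i hi
    obtain ⟨s, hs'⟩ := (hs.kd (k := k)).lift (h _ 1 one_pos) LinearMap.id
    obtain ⟨r, rfl⟩ := tr_surj s
    have : IA B (Fin d → CoB k B) X :=
      IA.self.retract i r (tr_inj (k := k) (by rw [tr_comp, hs', tr_id]))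
    exact (IDL.of_inj 0).ia this
  | succ n ih =>
    intro X _ _ _ _ _ h
    obtain ⟨d, i, hi⟩ := exists_emb k B X
    have hs := SES.of_inj i hi
    exact hs.idl1 (ih _ ((hs.kd (k := k)).pdl1 (PDL.of_proj _) h)) (IDL.of_inj _)

lemma pdl_to_idl' [IsNoetherianRing B] (n : ℕ) : ∀ (X : Type) [AddCommGroup X] [Module k X]
    [Module B X]
    [IsScalarTower k B X] [Module.Finite B X], PDL B X n → IDL Bᵐᵒᵖ (KD k X) n := by
  induction n with
  | zero =>
    intro X _ _ _ _ _ h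
    have := h.proj
    have : IA Bᵐᵒᵖ (KD k B) (KD k X) := IA.of_fg_proj.kd
    exact (IDL.of_inj 0).ia this
  | succ n ih =>
    intro X _ _ _ _ _ h
    obtain ⟨d, p, hp⟩ := Module.Finite.exists_fin' B X
    have hs := SES.of_surj p hp
    have h2 : IDL Bᵐᵒᵖ (KD k (Fin d → B)) (n+1) :=
      (IDL.of_inj (n+1)).ia (IA.kd (Y := B) (IA.pow d))
    exact hs.kd.idl1 (ih _ (hs.pdl1 (PDL.of_proj _) h)) h2

lemma ext_dual {X : Type} [AddCommGroup X] [Module k X] [Module B X]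
    [IsScalarTower k B X] (i : ℕ) : ∀ (Y : Type) [AddCommGroup Y] [Module k Y]
    [Module B Y] [IsScalarTower k B Y] [Module.Finite k Y], EV B X Y (i+1) →
      EV Bᵐᵒᵖ (KD k Y) (KD k X) (i+1) := by
  induction i with
  | zero =>
    intro Y _ _ _ _ _ h
    obtain ⟨d, i, hi⟩ := exists_emb k B Y
    have hs := SES.of_inj i hi
    refine (hs.kd (k := k)).ev_of_extend (EV.of_proj 0) fun φ => ?_
    obtain ⟨f, rfl⟩ := tr_surj φ
    obtain ⟨g, rfl⟩ := hs.lift h f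
    exact ⟨tr k g, (tr_comp _ _).symm⟩
  | succ j ih =>
    intro Y _ _ _ _ _ h
    obtain ⟨d, i, hi⟩ := exists_emb k B Y
    have hs := SES.of_inj i hi
    exact (hs.kd (k := k)).contra3 (ih _ (hs.cov3 (EV.of_inj _) h)) (EV.of_proj _)

end DualDims

section Cogen
set_option linter.unusedSectionVars false
variable {k : Type} [Field k] {B : Type} [Ring B] [Algebra k B]
  {U : Type} [AddCommGroup U] [Module k U] [Module B U] [IsScalarTower k B U] [Module.Finite k U]

variable (k B U) in
def Sep : Prop := ∀ (C : Type) [AddCommGroup C] [Module k C] [Module B C] [IsScalarTower k B C]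
  [Module.Finite k C], (∀ i, 0 < i → EV B C U i) → ∀ c : C, c ≠ 0 → ∃ ψ : C →ₗ[B] U, ψ c ≠ 0

lemma cogen_step (hU : ∀ i, 0 < i → EV B U U i) (hsep : Sep k B U)
    (C : Type) [AddCommGroup C] [Module k C] [Module B C] [IsScalarTower k B C]
    [Module.Finite k C] (hC : ∀ i, 0 < i → EV B C U i) :
    ∃ (e : ℕ) (j : C →ₗ[B] (Fin e → U)), Function.Injective j ∧
      ∀ i, 0 < i → EV B ((Fin e → U) ⧸ LinearMap.range j) U i := by
  have : Module.Finite k (C →ₗ[B] U) := by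
    let F : (C →ₗ[B] U) →ₗ[k] (C →ₗ[k] U) :=
      { toFun := fun φ => φ.restrictScalars k
        map_add' := fun _ _ => rfl
        map_smul' := fun _ _ => rfl }
    exact Module.Finite.of_injective F (fun φ ψ h => by
      ext x; exact LinearMap.congr_fun h x)
  let b := Module.finBasis k (C →ₗ[B] U)
  have hsum : ∀ ψ : C →ₗ[B] U, ∀ c, ψ c = ∑ j, b.repr ψ j • b j c := by
    intro ψ c
    conv_lhs => rw [← b.sum_repr ψ]
    rw [LinearMap.sum_apply]
    rfl
  let j : C →ₗ[B] (Fin _ → U) := LinearMap.pi fun j => b j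
  have hj : Function.Injective j := by
    rw [injective_iff_map_eq_zero]
    intro c hc
    by_contra h
    obtain ⟨ψ, hψ⟩ := hsep C hC c h
    apply hψ
    rw [hsum]
    refine Finset.sum_eq_zero fun i _ => ?_
    have : b i c = 0 := congrFun hc i
    rw [this, smul_zero]
  refine ⟨_, j, hj, ?_⟩
  have hs := SES.of_inj j hj
  have hUe : ∀ i, 0 < i → EV B (Fin (Module.finrank k (C →ₗ[B] U)) → U) U i :=
    fun i hi => (hU i hi).ia_left (IA.pow _)
  intro i hi
  obtain ⟨l, rfl⟩ : ∃ l, i = l + 1 := ⟨i - 1, by omega⟩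
  cases l with
  | zero =>
    refine hs.ev_of_extend (hUe 1 one_pos) fun ψ => ?_
    refine ⟨∑ l, b.repr ψ l • (LinearMap.proj l : (Fin _ → U) →ₗ[B] U), ?_⟩
    ext c
    rw [LinearMap.comp_apply, LinearMap.sum_apply, hsum ψ c]
    rfl
  | succ l => exact hs.contra3 (hC _ (by omega)) (hUe _ (by omega))

lemma cogen_ct (hU : ∀ i, 0 < i → EV B U U i) (hsep : Sep k B U) (n : ℕ) :
    ∀ (C : Type) [AddCommGroup C] [Module k C] [Module B C] [IsScalarTower k B C]
    [Module.Finite k C], (∀ i, 0 < i → EV B C U i) →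
    (∀ (D : Type) [AddCommGroup D] [Module k D] [Module B D] [IsScalarTower k B D]
    [Module.Finite k D], (∀ i, 0 < i → EV B D U i) → ∀ i, n < i → EV B D C i) →
    CT B U n (ModuleCat.of B C) := by
  induction n with
  | zero =>
    intro C _ _ _ _ _ hC h
    obtain ⟨e, j, hj, hQ⟩ := cogen_step hU hsep C hC
    have hs := SES.of_inj j hj
    obtain ⟨r, hr⟩ := hs.extend (h _ hQ 1 one_pos) LinearMap.id
    exact (IA.pow (Q := U) e).retract j r hr
  | succ n ih =>
    intro C _ _ _ _ _ hC h
    obtain ⟨e, j, hj, hQ⟩ := cogen_step hU hsep C hC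
    have hs := SES.of_inj j hj
    refine ⟨ModuleCat.of B (Fin e → U), ModuleCat.of B _, j, _, hs, IA.pow e, ih _ hQ ?_⟩
    intro D _ _ _ _ _ hD i hi
    exact hs.cov3 ((hD i (by omega)).ia_right (IA.pow e)) (h D hD (i+1) (by omega))

end Cogen

section SepDual
set_option linter.unusedSectionVars false
variable {k : Type} [Field k] {A : Type} [Ring A] [Algebra k A]
  {T : Type} [AddCommGroup T] [Module k T] [Module A T] [IsScalarTower k A T] [Module.Finite k T]

lemma ct_ev_kd {C : Type} [AddCommGroup C] [Module Aᵐᵒᵖ C]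
    (hC : ∀ i, 0 < i → EV Aᵐᵒᵖ C (KD k T) i) (n : ℕ) : ∀ (X : Type) [AddCommGroup X] [Module k X]
    [Module A X] [IsScalarTower k A X], CT A T n (ModuleCat.of A X) →
      ∀ i, 0 < i → EV Aᵐᵒᵖ C (KD k X) i := by
  induction n with
  | zero =>
    intro X _ _ _ _ h i hi
    have h' : IA A T X := h
    exact (hC i hi).ia_right h'.kd
  | succ n ih =>
    intro X _ _ _ _ h i hi
    obtain ⟨M, Y, f, g, hs, hM, hY⟩ := h
    have hs' : SES (X := X) f g := hs
    exact (hs'.kd (k := k)).cov3 ((hC i hi).ia_right hM.kd) (ih Y hY (i+1) (by omega))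

lemma sep_kd {m : ℕ} (hA : CT A T m (ModuleCat.of A A)) : Sep k Aᵐᵒᵖ (KD k T) := by
  intro C _ _ _ _ _ hC c hc
  obtain ⟨d, i, hi⟩ := exists_emb k Aᵐᵒᵖ C
  have hic : i c ≠ 0 := fun h => hc ((map_eq_zero_iff i hi).1 h)
  obtain ⟨j, hj⟩ := Function.ne_iff.1 hic
  let φ : C →ₗ[Aᵐᵒᵖ] KD k A := coBop.toLinearMap ∘ₗ LinearMap.proj j ∘ₗ i
  have hφ : φ c ≠ 0 := fun h => hj ((map_eq_zero_iff (coBop (k := k)) coBop.injective).1 h)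
  have fin : ∀ (N : Type) [AddCommGroup N] [Module Aᵐᵒᵖ N], IA Aᵐᵒᵖ (KD k T) N →
      ∀ ψ : C →ₗ[Aᵐᵒᵖ] N, ψ c ≠ 0 → ∃ ψ : C →ₗ[Aᵐᵒᵖ] KD k T, ψ c ≠ 0 := by
    rintro N _ _ ⟨n, s, r, h⟩ ψ hψ
    have : s (ψ c) ≠ 0 := fun h' => hψ (by
      have := LinearMap.congr_fun h (ψ c)
      rw [LinearMap.comp_apply, h', map_zero] at this
      exact this.symm)
    obtain ⟨l, hl⟩ := Function.ne_iff.1 this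
    exact ⟨LinearMap.proj l ∘ₗ s ∘ₗ ψ, hl⟩
  cases m with
  | zero =>
    have h' : IA A T A := hA
    exact fin _ h'.kd φ hφ
  | succ m =>
    obtain ⟨M, Y, f, g, hs, hM, hY⟩ := hA
    have hs' : SES (X := A) f g := hs
    obtain ⟨ψ, hψ⟩ := (hs'.kd (k := k)).lift (ct_ev_kd hC m Y hY 1 one_pos) φ
    refine fin _ hM.kd ψ fun h0 => hφ ?_
    rw [← hψ, LinearMap.comp_apply, h0, map_zero]

end SepDual
end Paper
end

noncomputable section
namespace Paper
open CategoryTheory CategoryTheory.Abelian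

section Final
set_option linter.unusedSectionVars false

lemma idl_of_pdl {A : Type} [Ring A] [IsNoetherianRing A] {g : ℕ} (hg : IDL A A g) (m : ℕ) :
    ∀ (X : Type) [AddCommGroup X] [Module A X] [Module.Finite A X], PDL A X m → IDL A X g := by
  induction m with
  | zero =>
    intro X _ _ _ h
    have := h.proj
    exact hg.ia IA.of_fg_proj
  | succ m ih =>
    intro X _ _ _ h
    obtain ⟨d, f, hf⟩ := Module.Finite.exists_fin' A X
    have hs := SES.of_surj f hf
    have h1 : PDL A (LinearMap.ker f) m := hs.pdl1 (PDL.of_proj _) h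
    have h2 : IDL A (Fin d → A) g := hg.ia IA.of_fg_proj
    exact hs.idl3 h2 ((ih _ h1).mono (Nat.le_succ g))

variable (k : Type) [Field k] (R A T : Type) [Ring R] [Ring A] [Algebra k R] [Algebra k A]
  [Module.Finite k R] [Module.Finite k A] [AddCommGroup T] [Module k T] [Module R T] [Module A T]
  [IsScalarTower k R T] [IsScalarTower k A T] [Module.Finite k T]
  [SMulCommClass R A T] [SMulCommClass A R T]

variable {A R T} in
lemma Bal.kd (h : Bal A R T) : Bal Aᵐᵒᵖ Rᵐᵒᵖ (KD k T) := by
  intro φ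
  obtain ⟨f, rfl⟩ := tr_surj φ
  obtain ⟨r, hr, hu⟩ := h f
  refine ⟨op r, fun t => ?_, fun s hs => ?_⟩
  · ext x
    exact congrArg t (hr x)
  · have : s.unop = r := hu _ fun t => KD.sep (k := k) fun ψ => by
      have := congrArg (fun χ : KD k T => χ t) (hs ψ)
      exact this
    rw [← this]; rfl

theorem abstract_main (k : Type) [Field k] (R A T : Type) [Ring R] [Ring A] [Algebra k R]
    [Algebra k A] [Module.Finite k R] [Module.Finite k A] [AddCommGroup T] [Module k T]
    [Module R T] [Module A T] [IsScalarTower k R T] [IsScalarTower k A T] [Module.Finite k T]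
    [SMulCommClass R A T] [SMulCommClass A R T] (h : TiltData R A T) (g : ℕ) (hg1 : IDL A A g) (hg2 : IDL Aᵐᵒᵖ Aᵐᵒᵖ g) :
    (∀ n, PDL A T n ↔ PDL R T n) ∧ (∀ n, IDL A T n ↔ IDL R T n) ∧
    (∃ n, PDL A T n) ∧ (∃ n, IDL A T n) ∧ (∀ i, 0 < i → EV A T T i) ∧
    (∀ p q, PDL A T p → IDL A T q → IDL A A (p+q) ∧ IDL Aᵐᵒᵖ Aᵐᵒᵖ (p+q) ∧
      CT A T p (ModuleCat.of A A)) := by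
  have : Module.Finite k Rᵐᵒᵖ := Module.Finite.equiv (MulOpposite.opLinearEquiv k (M := R))
  have : Module.Finite k Aᵐᵒᵖ := Module.Finite.equiv (MulOpposite.opLinearEquiv k (M := A))
  have : IsNoetherianRing R := IsNoetherianRing.of_finite k R
  have : IsNoetherianRing A := IsNoetherianRing.of_finite k A
  have : IsNoetherianRing Rᵐᵒᵖ := IsNoetherianRing.of_finite k Rᵐᵒᵖ
  have : IsNoetherianRing Aᵐᵒᵖ := IsNoetherianRing.of_finite k Aᵐᵒᵖ
  have : Module.Finite R T := Module.Finite.of_restrictScalars_finite k R T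
  have : Module.Finite A T := Module.Finite.of_restrictScalars_finite k A T
  have : Module.Finite Rᵐᵒᵖ (KD k T) := Module.Finite.of_restrictScalars_finite k Rᵐᵒᵖ _
  have : Module.Finite Aᵐᵒᵖ (KD k T) := Module.Finite.of_restrictScalars_finite k Aᵐᵒᵖ _
  obtain ⟨h1, m1⟩ := h.main
  obtain ⟨-, m2⟩ := h1.main
  have hpd : ∀ n, PDL A T n ↔ PDL R T n := fun n => ⟨fun x => (m2 n x).1, fun x => (m1 n x).1⟩
  obtain ⟨p0, hp0⟩ := h.pd
  have hi : IDL A T g := idl_of_pdl hg1 p0 T (m1 _ hp0).1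
  have evU : ∀ i, 0 < i → EV Aᵐᵒᵖ (KD k T) (KD k T) i := by
    intro i hi
    obtain ⟨j, rfl⟩ : ∃ j, i = j + 1 := ⟨i - 1, by omega⟩
    exact ext_dual j T (h1.ev _ hi)
  have hU : TiltData Aᵐᵒᵖ Rᵐᵒᵖ (KD k T) :=
    { ev := evU
      bal := h1.bal.kd k
      ct := ⟨g, cogen_ct evU (sep_kd (m1 _ hp0).2) g Aᵐᵒᵖ
        (fun i hi => PDL.of_proj (R := Aᵐᵒᵖ) (X := Aᵐᵒᵖ) 0 _ i hi)
        (fun D _ _ _ _ _ _ i hi => hg2 D i hi)⟩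
      pd := ⟨g, idl_to_pdl g T hi⟩ }
  obtain ⟨hU1, n1⟩ := hU.main
  obtain ⟨-, n2⟩ := hU1.main
  refine ⟨hpd, fun n => ⟨fun x => ?_, fun x => ?_⟩, ⟨p0, (m1 _ hp0).1⟩, ⟨g, hi⟩, h1.ev, ?_⟩
  · exact pdl_to_idl n T (n1 n (idl_to_pdl n T x)).1
  · exact pdl_to_idl n T (n2 n (idl_to_pdl n T x)).1
  · intro p q hp hq
    have c1 := (m1 p ((hpd p).1 hp)).2
    refine ⟨CT.idl hq c1, ?_, c1⟩
    have c2 := (n2 q (n1 q (idl_to_pdl q T hq)).1).2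
    rw [add_comm]
    exact CT.idl (pdl_to_idl' p T hp) c2

end Final
end Paper
end
noncomputable section Statement13
open Paper

/-- Proposition 4.4: if `T` is a tilting right `Λ`-module (i.e. a
left `Λᵐᵒᵖ`-module) such that `A = End_Λ(T)` is Iwanaga–Gorenstein, then `(A, T)` is
a relative `n`-Auslander–Gorenstein pair for some `n ≤ pd_A T + id_A T`, and moreover
`pd_A T = pd T_Λ` and `id_A T = id T_Λ`. -/
theorem stmt13 (k : Type) [Field k] (Λ : Type) [Ring Λ] [Algebra k Λ]
    [FiniteDimensional k Λ]
    (T : ModuleCat.{0} Λᵐᵒᵖ) [Module.Finite Λᵐᵒᵖ T]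
    (htiltpd : ∃ r, pdLE Λᵐᵒᵖ T r)
    (htiltorth : SelfOrth Λᵐᵒᵖ T)
    (htiltcores : ∃ r, CoresLE Λᵐᵒᵖ (zeroMod Λᵐᵒᵖ) (InAdd Λᵐᵒᵖ T)
      (ModuleCat.of Λᵐᵒᵖ Λᵐᵒᵖ) r)
    (hIG : ∃ g, idLE (Module.End Λᵐᵒᵖ T)
        (ModuleCat.of (Module.End Λᵐᵒᵖ T) (Module.End Λᵐᵒᵖ T)) g ∧
      idLE (Module.End Λᵐᵒᵖ T)ᵐᵒᵖ
        (ModuleCat.of (Module.End Λᵐᵒᵖ T)ᵐᵒᵖ (Module.End Λᵐᵒᵖ T)ᵐᵒᵖ) g) :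
    (∃ n : ℕ, IsRelAGPair (Module.End Λᵐᵒᵖ T) (ModuleCat.of (Module.End Λᵐᵒᵖ T) T) n ∧
      (n : ℕ∞) ≤ pdDim (Module.End Λᵐᵒᵖ T) (ModuleCat.of (Module.End Λᵐᵒᵖ T) T) +
        idDim (Module.End Λᵐᵒᵖ T) (ModuleCat.of (Module.End Λᵐᵒᵖ T) T)) ∧
    pdDim (Module.End Λᵐᵒᵖ T) (ModuleCat.of (Module.End Λᵐᵒᵖ T) T) = pdDim Λᵐᵒᵖ T ∧
    idDim (Module.End Λᵐᵒᵖ T) (ModuleCat.of (Module.End Λᵐᵒᵖ T) T) = idDim Λᵐᵒᵖ T := by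
  obtain ⟨r0, hr0⟩ := htiltpd
  obtain ⟨r1, hr1⟩ := htiltcores
  obtain ⟨g, hg1, hg2⟩ := hIG
  have : Module.Finite k Λᵐᵒᵖ := Module.Finite.equiv (MulOpposite.opLinearEquiv k (M := Λ))
  have hTk : Module.Finite k T := Module.Finite.trans Λᵐᵒᵖ T
  have : IsScalarTower k (Module.End Λᵐᵒᵖ T) T := ⟨fun _ _ _ => rfl⟩
  have : Module.Finite k (Module.End Λᵐᵒᵖ T) := by
    let F : (T →ₗ[Λᵐᵒᵖ] T) →ₗ[k] (T →ₗ[k] T) :=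
      { toFun := fun φ => φ.restrictScalars k
        map_add' := fun _ _ => rfl
        map_smul' := fun _ _ => rfl }
    refine Module.Finite.of_injective F fun a b hab => ?_
    ext x
    exact LinearMap.congr_fun hab x
  have hd : TiltData Λᵐᵒᵖ (Module.End Λᵐᵒᵖ T) T :=
    { ev := (selfOrth_iff T).1 htiltorth
      bal := fun φ => ⟨φ, fun _ => rfl, fun ψ hψ => LinearMap.ext fun t => (hψ t).symm⟩
      ct := ⟨r1, CT.of_cores hr1⟩
      pd := ⟨r0, (pdLE_iff r0 T).1 hr0⟩ }
  obtain ⟨e1, e2, e3, e4, e5, e6⟩ := abstract_main k Λᵐᵒᵖ (Module.End Λᵐᵒᵖ T) T hd g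
    ((idLE_iff g _).1 hg1) ((idLE_iff g _).1 hg2)
  classical
  refine ⟨?_, ?_, ?_⟩
  · obtain ⟨c1, c2, c3⟩ := e6 _ _ (Nat.find_spec e3) (Nat.find_spec e4)
    refine ⟨Nat.find e3 + Nat.find e4, ⟨(idLE_iff _ _).2 c1, (idLE_iff _ _).2 c2,
      (selfOrth_iff _).2 e5, CT.domdim e5 c3 _⟩, ?_⟩
    rw [Nat.cast_add]
    refine add_le_add (le_sInf ?_) (le_sInf ?_)
    · rintro _ ⟨n, rfl, hn⟩
      exact Nat.cast_le.2 (Nat.find_min' e3 ((pdLE_iff n _).1 hn))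
    · rintro _ ⟨n, rfl, hn⟩
      exact Nat.cast_le.2 (Nat.find_min' e4 ((idLE_iff n _).1 hn))
  · have : ∀ n, pdLE (Module.End Λᵐᵒᵖ T) (ModuleCat.of (Module.End Λᵐᵒᵖ T) T) n ↔
        pdLE Λᵐᵒᵖ T n := fun n => ((pdLE_iff n _).trans (e1 n)).trans (pdLE_iff n T).symm
    simp only [pdDim, this]
  · have : ∀ n, idLE (Module.End Λᵐᵒᵖ T) (ModuleCat.of (Module.End Λᵐᵒᵖ T) T) n ↔
        idLE Λᵐᵒᵖ T n := fun n => ((idLE_iff n _).trans (e2 n)).trans (idLE_iff n T).symm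
    simp only [idDim, this]

end Statement13
end

section
/- Let (A, Q) be a relative n-Auslander–Gorenstein pair with Ext^{i>0}_A(Q, Q) = 0 and n ≥ m + l + 2, where m = id_A Q and l = pd_A Q, and let Λ = End_A(Q)^op. Then the functor Hom_Λ(−, Q) induces an exact duality between the full subcategory {X ∈ mod-Λ : Ext^i_Λ(X, Q) = 0 for 1 ≤ i ≤ m and Ext^j_Λ(Q, X) = 0 for 1 ≤ j ≤ n − m − 2} and the category of Gorenstein-projective left A-modules ⊥(_A A) = {N : Ext^{i>0}_A(N, A) = 0}. -/
universe u
open MulOpposite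

noncomputable section Statement15
open Paper

/-- Precomposition with an `E`-linear map `φ`, as an `A`-linear map of the
`Hom_Λ(−, Q)`-dual spaces (`E = End_A(Q)`, `Λ = E^op`). -/
noncomputable def lcompA (A : Type) [Ring A] (Q : ModuleCat.{0} A)
    {X Y : ModuleCat.{0} (Module.End A Q)}
    (φ : X →ₗ[Module.End A Q] Y) :
    (Y →ₗ[Module.End A Q] Q) →ₗ[A]
      (X →ₗ[Module.End A Q] Q) where
  toFun g := g ∘ₗ φ
  map_add' _ _ := rfl
  map_smul' _ _ := rfl


namespace PfH
open CategoryTheory CategoryTheory.Abelian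

section EVsec
variable (B : Type) [Ring B]

/-- Vanishing of Mathlib's `Ext^i`. -/
def EV (X Y : Type) [AddCommGroup X] [Module B X] [AddCommGroup Y] [Module B Y] (i : ℕ) : Prop :=
  Subsingleton (Ext (ModuleCat.of B X) (ModuleCat.of B Y) i)

variable {B}

/-- Short exact sequences. -/
structure SES {X Y Z : Type} [AddCommGroup X] [Module B X] [AddCommGroup Y] [Module B Y]
    [AddCommGroup Z] [Module B Z] (f : X →ₗ[B] Y) (g : Y →ₗ[B] Z) : Prop where
  inj : Function.Injective f
  exact : Function.Exact f g
  surj : Function.Surjective g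

variable {X Y Z T Q : Type} [AddCommGroup X] [Module B X] [AddCommGroup Y] [Module B Y]
    [AddCommGroup Z] [Module B Z] [AddCommGroup T] [Module B T] [AddCommGroup Q] [Module B Q]

/-- The associated short complex. -/
abbrev SES.sc {f : X →ₗ[B] Y} {g : Y →ₗ[B] Z} (h : SES f g) : ShortComplex (ModuleCat.{0} B) :=
  ShortComplex.mk (ModuleCat.ofHom f) (ModuleCat.ofHom g) (by
    ext x; exact h.exact.apply_apply_eq_zero x)

lemma SES.se {f : X →ₗ[B] Y} {g : Y →ₗ[B] Z} (h : SES f g) : h.sc.ShortExact :=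
  ModuleCat.shortComplex_shortExact _ h.exact h.inj h.surj

lemma EV_iff {i : ℕ} : EV B X Y i ↔ ∀ e : Ext (ModuleCat.of B X) (ModuleCat.of B Y) i, e = 0 := by
  constructor
  · intro h e; exact @Subsingleton.elim _ h _ _
  · intro h; exact ⟨fun a b => by rw [h a, h b]⟩

lemma EV.c1 {f : X →ₗ[B] Y} {g : Y →ₗ[B] Z} (h : SES f g) {i : ℕ}
    (h1 : EV B X T i) (h2 : EV B Y T (i+1)) : EV B Z T (i+1) := by
  rw [EV_iff] at *
  intro e
  obtain ⟨x, hx⟩ := Ext.contravariant_sequence_exact₃ h.se (ModuleCat.of B T) e (h2 _)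
    (n₀ := i) (by omega)
  rw [← hx]
  have : x = 0 := h1 x
  rw [this]; simp

lemma EV.c2 {f : X →ₗ[B] Y} {g : Y →ₗ[B] Z} (h : SES f g) {i : ℕ}
    (h1 : EV B Y T i) (h2 : EV B Z T (i+1)) : EV B X T i := by
  rw [EV_iff] at *
  intro e
  obtain ⟨x, hx⟩ := Ext.contravariant_sequence_exact₁ h.se (ModuleCat.of B T) e
    (n₁ := i+1) (by omega) (h2 _)
  rw [← hx]
  have : x = 0 := h1 x
  rw [this]; simp

lemma EV.c3 {f : X →ₗ[B] Y} {g : Y →ₗ[B] Z} (h : SES f g)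
    (h2 : EV B Z T 1) (u : X →ₗ[B] T) : ∃ v : Y →ₗ[B] T, v ∘ₗ f = u := by
  rw [EV_iff] at *
  obtain ⟨x, hx⟩ := Ext.contravariant_sequence_exact₁ h.se (ModuleCat.of B T)
    (Ext.mk₀ (ModuleCat.ofHom u)) (n₁ := 1) (by omega) (h2 _)
  obtain ⟨v, rfl⟩ := (Ext.mk₀_bijective _ _).2 x
  rw [Ext.mk₀_comp_mk₀] at hx
  have := (Ext.mk₀_bijective _ _).1 hx
  exact ⟨v.hom, by simpa [SES.sc] using congrArg ModuleCat.Hom.hom this⟩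

lemma EV.c4 {f : X →ₗ[B] Y} {g : Y →ₗ[B] Z} (h : SES f g)
    (h1 : ∀ u : X →ₗ[B] T, ∃ v : Y →ₗ[B] T, v ∘ₗ f = u) (h2 : EV B Y T 1) : EV B Z T 1 := by
  rw [EV_iff] at *
  intro e
  obtain ⟨x, hx⟩ := Ext.contravariant_sequence_exact₃ h.se (ModuleCat.of B T) e (h2 _)
    (n₀ := 0) (by omega)
  obtain ⟨u, rfl⟩ := (Ext.mk₀_bijective _ _).2 x
  obtain ⟨v, hv⟩ := h1 u.hom
  have : u = h.sc.f ≫ ModuleCat.ofHom v := by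
    ext x; exact (LinearMap.congr_fun hv x).symm
  rw [← hx, this, ← Ext.mk₀_comp_mk₀]
  exact h.se.extClass_comp_assoc _

lemma EV.v1 {f : X →ₗ[B] Y} {g : Y →ₗ[B] Z} (h : SES f g) {i : ℕ}
    (h1 : EV B T Z i) (h2 : EV B T Y (i+1)) : EV B T X (i+1) := by
  rw [EV_iff] at *
  intro e
  obtain ⟨x, hx⟩ := Ext.covariant_sequence_exact₁ (ModuleCat.of B T) h.se e (h2 _)
    (n₀ := i) (by omega)
  rw [← hx]
  have : x = 0 := h1 x
  rw [this]; simp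

lemma EV.v2 {f : X →ₗ[B] Y} {g : Y →ₗ[B] Z} (h : SES f g) {i : ℕ}
    (h1 : EV B T Y i) (h2 : EV B T X (i+1)) : EV B T Z i := by
  rw [EV_iff] at *
  intro e
  obtain ⟨x, hx⟩ := Ext.covariant_sequence_exact₃ (ModuleCat.of B T) h.se e
    (n₁ := i+1) (by omega) (h2 _)
  rw [← hx]
  have : x = 0 := h1 x
  rw [this]; simp

lemma EV.v3 {f : X →ₗ[B] Y} {g : Y →ₗ[B] Z} (h : SES f g)
    (h2 : EV B T X 1) (u : T →ₗ[B] Z) : ∃ v : T →ₗ[B] Y, g ∘ₗ v = u := by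
  rw [EV_iff] at *
  obtain ⟨x, hx⟩ := Ext.covariant_sequence_exact₃ (ModuleCat.of B T) h.se
    (Ext.mk₀ (ModuleCat.ofHom u)) (n₁ := 1) (by omega) (h2 _)
  obtain ⟨v, rfl⟩ := (Ext.mk₀_bijective _ _).2 x
  rw [Ext.mk₀_comp_mk₀] at hx
  have := (Ext.mk₀_bijective _ _).1 hx
  exact ⟨v.hom, by simpa [SES.sc] using congrArg ModuleCat.Hom.hom this⟩

lemma EV.v4 {f : X →ₗ[B] Y} {g : Y →ₗ[B] Z} (h : SES f g)
    (h1 : ∀ u : T →ₗ[B] Z, ∃ v : T →ₗ[B] Y, g ∘ₗ v = u) (h2 : EV B T Y 1) : EV B T X 1 := by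
  rw [EV_iff] at *
  intro e
  obtain ⟨x, hx⟩ := Ext.covariant_sequence_exact₁ (ModuleCat.of B T) h.se e (h2 _)
    (n₀ := 0) (by omega)
  obtain ⟨u, rfl⟩ := (Ext.mk₀_bijective _ _).2 x
  obtain ⟨v, hv⟩ := h1 u.hom
  have : u = ModuleCat.ofHom v ≫ h.sc.g := by
    ext x; exact (LinearMap.congr_fun hv x).symm
  rw [← hx, this, ← Ext.mk₀_comp_mk₀, Ext.comp_assoc _ _ _ (add_zero 0) (zero_add 1) (by omega),
    h.se.comp_extClass]
  simp

lemma EV.zero_iff : EV B X Y 0 ↔ ∀ f : X →ₗ[B] Y, f = 0 := by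
  rw [EV_iff]
  constructor
  · intro h f
    have := h (Ext.mk₀ (ModuleCat.ofHom f))
    rw [Ext.mk₀_eq_zero_iff] at this
    simpa using congrArg ModuleCat.Hom.hom this
  · intro h e
    obtain ⟨u, rfl⟩ := (Ext.mk₀_bijective _ _).2 e
    rw [Ext.mk₀_eq_zero_iff]
    ext x; exact LinearMap.congr_fun (h u.hom) x

lemma EV.proj [Module.Projective B X] (i : ℕ) : EV B X Y (i+1) :=
  Ext.subsingleton_of_projective _ _ _

lemma EV.injv [Module.Injective B Y] (i : ℕ) : EV B X Y (i+1) := by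
  have := Module.injective_object_of_injective_module B Y
  rw [EV_iff]; intro e; exact Ext.eq_zero_of_injective e

/-- `M` is in `add Q`, via a decomposition of the identity. -/
def AddC (B : Type) [Ring B] (Q M : Type) [AddCommGroup Q] [Module B Q] [AddCommGroup M]
    [Module B M] : Prop :=
  ∃ (n : ℕ) (a : Fin n → (M →ₗ[B] Q)) (b : Fin n → (Q →ₗ[B] M)),
    ∀ x, ∑ i, b i (a i x) = x

lemma AddC.pi (n : ℕ) : AddC B Q (Fin n → Q) :=
  ⟨n, fun i => LinearMap.proj i, fun i => LinearMap.single B (fun _ => Q) i, fun x => by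
    ext j; simp [Finset.sum_apply, Pi.single_apply]⟩

lemma AddC.ofEquiv (e : X ≃ₗ[B] Y) : AddC B X Y :=
  ⟨1, fun _ => e.symm.toLinearMap, fun _ => e.toLinearMap, fun x => by simp⟩

lemma AddC.trans (h : AddC B X Y) (h' : AddC B Y Z) : AddC B X Z := by
  obtain ⟨n, a, b, hab⟩ := h
  obtain ⟨n', a', b', hab'⟩ := h'
  refine ⟨n' * n, fun i => a (finProdFinEquiv.symm i).2 ∘ₗ a' (finProdFinEquiv.symm i).1,
    fun i => b' (finProdFinEquiv.symm i).1 ∘ₗ b (finProdFinEquiv.symm i).2, fun x => ?_⟩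
  rw [← Equiv.sum_comp finProdFinEquiv, Fintype.sum_prod_type]
  simp [← map_sum, hab, hab']

lemma AddC.id_eq {n : ℕ} {a : Fin n → (Y →ₗ[B] X)} {b : Fin n → (X →ₗ[B] Y)}
    (h : ∀ x, ∑ i, b i (a i x) = x) :
    𝟙 (ModuleCat.of B Y) = ∑ i, ModuleCat.ofHom (a i) ≫ ModuleCat.ofHom (b i) := by
  ext x
  rw [ModuleCat.hom_sum]
  simp [h]

lemma AddC.left (h : AddC B X Y) {i : ℕ} (h1 : EV B X T i) : EV B Y T i := by
  obtain ⟨n, a, b, hab⟩ := h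
  rw [EV_iff] at *
  intro e
  rw [← Ext.mk₀_id_comp e, AddC.id_eq hab, Ext.mk₀_sum, Ext.sum_comp]
  refine Finset.sum_eq_zero fun j _ => ?_
  rw [← Ext.mk₀_comp_mk₀, Ext.comp_assoc _ _ _ (add_zero 0) (zero_add i) (by omega), h1 (Ext.comp _ e _), Ext.comp_zero]

lemma AddC.right (h : AddC B X Y) {i : ℕ} (h1 : EV B T X i) : EV B T Y i := by
  obtain ⟨n, a, b, hab⟩ := h
  rw [EV_iff] at *
  intro e
  rw [← Ext.comp_mk₀_id e, AddC.id_eq hab, Ext.mk₀_sum, Ext.comp_sum]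
  refine Finset.sum_eq_zero fun j _ => ?_
  rw [← Ext.mk₀_comp_mk₀, ← Ext.comp_assoc _ _ _ (add_zero i) (add_zero 0) (by omega), h1 (Ext.comp e _ _), Ext.zero_comp]

lemma AddC.of_subsingleton [Subsingleton Y] : AddC B X Y :=
  ⟨0, fun i => i.elim0, fun i => i.elim0, fun _ => Subsingleton.elim _ _⟩

lemma EV.sub_left [Subsingleton X] (i : ℕ) : EV B X Y i := by
  rw [EV_iff]; intro e
  rw [← Ext.mk₀_id_comp e]
  have : 𝟙 (ModuleCat.of B X) = 0 := by
    ext x; exact Subsingleton.elim (α := X) _ _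
  rw [this]; simp

lemma EV.sub_right [Subsingleton Y] (i : ℕ) : EV B X Y i := by
  rw [EV_iff]; intro e
  rw [← Ext.comp_mk₀_id e]
  have : 𝟙 (ModuleCat.of B Y) = 0 := by
    ext x; exact Subsingleton.elim (α := Y) _ _
  rw [this]; simp

lemma AddC.proj (h : AddC B X Y) [Module.Projective B X] : Module.Projective B Y := by
  obtain ⟨n, a, b, hab⟩ := h
  refine Module.Projective.of_lifting_property'' fun f hf => ?_
  choose c hc using fun i => Module.projective_lifting_property f (b i) hf
  refine ⟨∑ i, c i ∘ₗ a i, ?_⟩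
  ext x
  have : ∀ i y, f (c i y) = b i y := fun i y => LinearMap.congr_fun (hc i) y
  simp [this, hab]

end EVsec
end PfH

namespace PfH
open CategoryTheory CategoryTheory.Abelian

section Bridge
variable {B : Type} [Ring B]
variable {X Y Z T Q : Type} [AddCommGroup X] [Module B X] [AddCommGroup Y] [Module B Y]
    [AddCommGroup Z] [Module B Z] [AddCommGroup T] [Module B T] [AddCommGroup Q] [Module B Q]

lemma SES.ofSurj (g : Y →ₗ[B] Z) (hg : Function.Surjective g) : SES (LinearMap.ker g).subtype g :=
  ⟨Subtype.val_injective, LinearMap.exact_subtype_ker_map g, hg⟩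

lemma SES.ofInj (f : X →ₗ[B] Y) (hf : Function.Injective f) : SES f (LinearMap.range f).mkQ :=
  ⟨hf, LinearMap.exact_map_mkQ_range f, Submodule.mkQ_surjective _⟩

lemma SES.toRange {f : X →ₗ[B] Y} {g : Y →ₗ[B] Z} (hf : Function.Injective f)
    (h : Function.Exact f g) : SES f g.rangeRestrict :=
  ⟨hf, fun y => by
    rw [← h y]
    exact Subtype.ext_iff, LinearMap.surjective_rangeRestrict g⟩

/-- Factorisation through a surjection. -/
lemma factor_surj {g : Y →ₗ[B] Z} (hg : Function.Surjective g) (u : Y →ₗ[B] T)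
    (h : ∀ y, g y = 0 → u y = 0) : ∃ v : Z →ₗ[B] T, ∀ y, v (g y) = u y := by
  refine ⟨(LinearMap.ker g).liftQ u (fun y hy => h y hy) ∘ₗ
    (g.quotKerEquivOfSurjective hg).symm.toLinearMap, fun y => ?_⟩
  have : (g.quotKerEquivOfSurjective hg).symm (g y) = Submodule.Quotient.mk y := by
    rw [LinearEquiv.symm_apply_eq]; rfl
  rw [LinearMap.comp_apply, LinearEquiv.coe_coe, this]
  rfl

/-- The shifted projective resolution of the first syzygy. -/
def shiftRes {X : ModuleCat.{0} B} (R : ProjRes B X) :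
    ProjRes B (ModuleCat.of B (LinearMap.ker R.aug)) where
  P j := R.P (j+1)
  d j := R.d (j+1)
  aug := (R.d 0).codRestrict (LinearMap.ker R.aug) (fun x => R.exact0.apply_apply_eq_zero x)
  proj j := R.proj (j+1)
  augSurj := by
    rintro ⟨y, hy⟩
    obtain ⟨x, rfl⟩ := (R.exact0 y).1 hy
    exact ⟨x, rfl⟩
  exact0 := fun y => by
    rw [← R.exact 0 y]
    exact Subtype.ext_iff
  exact j := R.exact (j+1)

lemma bridge_aux {Y : ModuleCat.{0} B} (i : ℕ) : ∀ (X : ModuleCat.{0} B) (R : ProjRes B X),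
    (∀ f : R.P (i+1) →ₗ[B] Y, f ∘ₗ R.d (i+1) = 0 → ∃ g : R.P i →ₗ[B] Y, f = g ∘ₗ R.d i) ↔
      EV B X Y (i+1) := by
  induction i with
  | zero =>
    intro X R
    have := R.proj 0
    have hs := SES.ofSurj R.aug R.augSurj
    constructor
    · intro h
      refine EV.c4 hs (fun u => ?_) (EV.proj 0)
      obtain ⟨g, hg⟩ := h (u ∘ₗ (shiftRes R).aug) (by
        ext x
        have : (shiftRes R).aug (R.d 1 x) = 0 := (shiftRes R).exact0.apply_apply_eq_zero x
        exact (congrArg u this).trans (map_zero u))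
      refine ⟨g, ?_⟩
      ext x
      obtain ⟨z, rfl⟩ := (shiftRes R).augSurj x
      exact (LinearMap.congr_fun hg z).symm
    · intro h f hf
      obtain ⟨v, hv⟩ := factor_surj (shiftRes R).augSurj f (fun y hy => by
        obtain ⟨x, rfl⟩ := ((shiftRes R).exact0 y).1 hy
        exact LinearMap.congr_fun hf x)
      obtain ⟨w, hw⟩ := EV.c3 hs h v
      refine ⟨w, ?_⟩
      ext x
      have h1 := hv x
      rw [← hw] at h1
      exact h1.symm
  | succ i ih =>
    intro X R
    have := R.proj 0
    have hs := SES.ofSurj R.aug R.augSurj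
    refine (ih _ (shiftRes R)).trans ?_
    constructor
    · intro h; exact EV.c1 hs h (EV.proj _)
    · intro h; exact EV.c2 hs (EV.proj _) h

/-- Iterated syzygies with respect to the canonical free covers. -/
def syz (X : ModuleCat.{0} B) : ℕ → ModuleCat.{0} B
  | 0 => X
  | (j+1) => ModuleCat.of B
      (LinearMap.ker (Finsupp.linearCombination B (id : syz X j → syz X j)))

/-- The canonical free resolution. -/
def freeRes (X : ModuleCat.{0} B) : ProjRes B X where
  P j := ModuleCat.of B (syz X j →₀ B)
  d j := (LinearMap.ker (Finsupp.linearCombination B (id : syz X j → syz X j))).subtype ∘ₗ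
    (Finsupp.linearCombination B (id : syz X (j+1) → syz X (j+1)))
  aug := Finsupp.linearCombination B (id : X → X)
  proj j := inferInstanceAs (Module.Projective B (syz X j →₀ B))
  augSurj := Finsupp.linearCombination_id_surjective B X
  exact0 := fun y => by
    constructor
    · intro h
      obtain ⟨x, hx⟩ := Finsupp.linearCombination_id_surjective B (syz X 1) ⟨y, h⟩
      exact ⟨x, congrArg Subtype.val hx⟩
    · rintro ⟨x, rfl⟩
      exact ((Finsupp.linearCombination B (id : syz X 1 → syz X 1)) x).2
  exact j := fun y => by
    constructor
    · intro h
      have h' : Finsupp.linearCombination B (id : syz X (j+1) → syz X (j+1)) y = 0 := by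
        apply Subtype.val_injective (p := fun z =>
          z ∈ LinearMap.ker (Finsupp.linearCombination B (id : syz X j → syz X j)))
        exact h
      let y' : syz X (j+2) := ⟨y, h'⟩
      obtain ⟨x, hx⟩ := Finsupp.linearCombination_id_surjective B (syz X (j+2)) y'
      exact ⟨x, congrArg Subtype.val hx⟩
    · rintro ⟨x, rfl⟩
      have := ((Finsupp.linearCombination B (id : syz X (j+2) → syz X (j+2))) x).2
      have h2 : Finsupp.linearCombination B (id : syz X (j+1) → syz X (j+1)) _ = 0 := this
      exact congrArg (Subtype.val (p := fun z =>
          z ∈ LinearMap.ker (Finsupp.linearCombination B (id : syz X j → syz X j)))) h2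

lemma extVanish_iff (X Y : ModuleCat.{0} B) (i : ℕ) :
    ExtVanish B X Y (i+1) ↔ EV B X Y (i+1) := by
  constructor
  · intro h
    exact (bridge_aux i X (freeRes X)).1 (h (freeRes X))
  · intro h R
    exact (bridge_aux i X R).2 h

lemma extVanish_iff' (X Y : ModuleCat.{0} B) {i : ℕ} (hi : 1 ≤ i) :
    ExtVanish B X Y i ↔ EV B X Y i := by
  obtain ⟨j, rfl⟩ : ∃ j, i = j + 1 := ⟨i - 1, by omega⟩
  exact extVanish_iff X Y j

lemma inj_aux (m : ℕ) : ∀ (X : ModuleCat.{0} B) (M : ℕ → ModuleCat.{0} B) (ι : X →ₗ[B] M 0)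
    (d : ∀ j, M j →ₗ[B] M (j+1)),
    (∀ j, j < m → Module.Injective B (M j)) → (∀ j, m ≤ j → Subsingleton (M j)) →
    Function.Injective ι → Function.Exact ι (d 0) →
    (∀ j, Function.Exact (d j) (d (j+1))) → ∀ i, m ≤ i → EV B T X i := by
  induction m with
  | zero =>
    intro X M ι d _ h2 h3 _ _ i _
    have := h2 0 le_rfl
    have : Subsingleton X := h3.subsingleton
    exact EV.sub_right i
  | succ m ih =>
    intro X M ι d h1 h2 h3 h4 h5 i hi
    obtain ⟨i, rfl⟩ : ∃ j, i = j + 1 := ⟨i - 1, by omega⟩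
    have hs := SES.toRange h3 h4
    have := h1 0 (by omega)
    refine EV.v1 hs (ih (ModuleCat.of B (LinearMap.range (d 0))) (fun j => M (j+1))
      (LinearMap.range (d 0)).subtype (fun j => d (j+1)) (fun j hj => h1 _ (by omega))
      (fun j hj => h2 _ (by omega)) Subtype.val_injective ?_ (fun j => h5 (j+1)) i (by omega))
      (EV.injv i)
    intro y
    rw [h5 0 y]
    simp

lemma idLE_EV {X : ModuleCat.{0} B} {m : ℕ} (h : idLE B X m) {i : ℕ} (hi : m < i) :
    EV B T X i := by
  obtain ⟨M, ι, d, h1, h2, h3, h4, h5, -⟩ := h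
  exact inj_aux (m+1) X M ι d (fun j hj => h1 j (by omega)) (fun j hj => h2 j (by omega))
    h3 h4 h5 i hi

lemma proj_aux (m : ℕ) : ∀ (X : ModuleCat.{0} B) (P : ℕ → ModuleCat.{0} B) (aug : P 0 →ₗ[B] X)
    (d : ∀ j, P (j+1) →ₗ[B] P j),
    (∀ j, j < m → Module.Projective B (P j)) → (∀ j, m ≤ j → Subsingleton (P j)) →
    Function.Surjective aug → Function.Exact (d 0) aug →
    (∀ j, Function.Exact (d (j+1)) (d j)) → ∀ i, m ≤ i → EV B X T i := by
  induction m with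
  | zero =>
    intro X P aug d _ h2 h3 _ _ i _
    have := h2 0 le_rfl
    have : Subsingleton X := h3.subsingleton
    exact EV.sub_left i
  | succ m ih =>
    intro X P aug d h1 h2 h3 h4 h5 i hi
    obtain ⟨i, rfl⟩ : ∃ j, i = j + 1 := ⟨i - 1, by omega⟩
    have hs := SES.ofSurj aug h3
    have := h1 0 (by omega)
    refine EV.c1 hs (ih (ModuleCat.of B (LinearMap.ker aug)) (fun j => P (j+1))
      ((d 0).codRestrict _ (fun x => h4.apply_apply_eq_zero x))
      (fun j => d (j+1)) (fun j hj => h1 _ (by omega))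
      (fun j hj => h2 _ (by omega)) ?_ ?_ (fun j => h5 (j+1)) i (by omega))
      (EV.proj i)
    · rintro ⟨y, hy⟩
      obtain ⟨x, rfl⟩ := (h4 y).1 hy
      exact ⟨x, rfl⟩
    · intro y
      rw [← h5 0 y]
      exact Subtype.ext_iff

lemma pdLE_EV {X : ModuleCat.{0} B} {m : ℕ} (h : pdLE B X m) {i : ℕ} (hi : m < i) :
    EV B X T i := by
  obtain ⟨M, d, ι, h1, h2, h3, h4, h5, -⟩ := h
  exact proj_aux (m+1) X M ι d (fun j hj => h1 j (by omega)) (fun j hj => h2 j (by omega))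
    h3 h4 h5 i hi

lemma InAdd.addC {Q X : ModuleCat.{0} B} (h : InAdd B Q X) : AddC B Q X := by
  obtain ⟨n, s, r, h⟩ := h
  refine ⟨n, fun i => LinearMap.proj i ∘ₗ s, fun i => r ∘ₗ LinearMap.single B (fun _ => Q) i,
    fun x => ?_⟩
  have h2 := (AddC.pi (B := B) (Q := Q) n)
  have : ∑ i, Pi.single (M := fun _ => (Q : Type)) i (s x i) = s x := Finset.univ_sum_single _
  have h3 := LinearMap.congr_fun h x
  simp only [LinearMap.comp_apply, LinearMap.proj_apply, LinearMap.single_apply]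
  rw [← map_sum, this]
  exact h3

/-- Inductive form of the relative dominant dimension. -/
def Cop (B : Type) [Ring B] (Q : Type) [AddCommGroup Q] [Module B Q] :
    ℕ → ModuleCat.{0} B → Prop
  | 0, _ => True
  | (n+1), L => ∃ (M L1 : ModuleCat.{0} B) (ι : L →ₗ[B] M) (p : M →ₗ[B] L1),
      AddC B Q M ∧ SES ι p ∧ (∀ f : L →ₗ[B] Q, ∃ h : M →ₗ[B] Q, h ∘ₗ ι = f) ∧ Cop B Q n L1

lemma Cop.mono {n m : ℕ} (h : m ≤ n) : ∀ {L : ModuleCat.{0} B}, Cop B Q n L → Cop B Q m L := by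
  induction m generalizing n with
  | zero => intro L _; trivial
  | succ m ih =>
    obtain ⟨n, rfl⟩ : ∃ j, n = j + 1 := ⟨n - 1, by omega⟩
    rintro L ⟨M, L1, ι, p, h1, h2, h3, h4⟩
    exact ⟨M, L1, ι, p, h1, h2, h3, ih (by omega) h4⟩

lemma domdim_cop {Q : ModuleCat.{0} B} (n : ℕ) : ∀ X : ModuleCat.{0} B,
    domdimGE B Q X n → Cop B Q n X := by
  induction n with
  | zero => intro X _; trivial
  | succ n ih =>
    intro X h
    rcases h with h | h
    · omega
    obtain ⟨M, ι, d, h1, h2, h3, h4, h5, h6, h7⟩ := h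
    refine ⟨M 0, ModuleCat.of B (M 0 ⧸ LinearMap.range ι), ι, (LinearMap.range ι).mkQ,
      InAdd.addC (h1 0 (by omega)), SES.ofInj ι h2, h5, ih _ ?_⟩
    by_cases hn : n = 0
    · exact Or.inl hn
    right
    have e0 := h3 (by omega)
    have hle : LinearMap.range ι ≤ LinearMap.ker (d 0) := by
      rintro _ ⟨x, rfl⟩; exact e0.apply_apply_eq_zero x
    refine ⟨fun j => M (j+1), (LinearMap.range ι).liftQ (d 0) hle, fun j => d (j+1),
      fun j hj => h1 _ (by omega), ?_, ?_, fun j hj => h4 (j+1) (by omega), ?_, ?_,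
      fun j hj => h7 (j+1) (by omega)⟩
    · rw [← LinearMap.ker_eq_bot, Submodule.ker_liftQ_eq_bot']
      ext x
      rw [LinearMap.mem_ker, e0 x]; rfl
    · intro hn' y
      rw [h4 0 (by omega) y]
      constructor
      · rintro ⟨x, rfl⟩; exact ⟨Submodule.Quotient.mk x, rfl⟩
      · rintro ⟨x, rfl⟩
        obtain ⟨x, rfl⟩ := Submodule.mkQ_surjective _ x
        exact ⟨x, rfl⟩
    · intro f
      obtain ⟨h, hh⟩ := h6 (by omega) (f ∘ₗ (LinearMap.range ι).mkQ) (by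
        ext x
        have : (LinearMap.range ι).mkQ (ι x) = 0 :=
          (Submodule.Quotient.mk_eq_zero _).2 ⟨x, rfl⟩
        exact (congrArg f this).trans (map_zero f))
      refine ⟨h, ?_⟩
      ext x
      exact LinearMap.congr_fun hh x
    · intro hn' f hf
      exact h7 0 (by omega) f (by
        ext x
        exact LinearMap.congr_fun hf (Submodule.Quotient.mk x))

end Bridge
end PfH

namespace PfH
set_option linter.unusedSectionVars false

section Dual
variable (A E Q : Type) [Ring A] [Ring E] [AddCommGroup Q] [Module A Q] [Module E Q]
  [SMulCommClass A E Q] [SMulCommClass E A Q]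
variable {L M N L1 : Type} [AddCommGroup L] [Module A L] [AddCommGroup M] [Module A M]
  [AddCommGroup N] [Module A N] [AddCommGroup L1] [Module A L1]

/-- Dual of a linear map. -/
def dm (f : L →ₗ[A] M) : (M →ₗ[A] Q) →ₗ[E] (L →ₗ[A] Q) where
  toFun g := g ∘ₗ f
  map_add' _ _ := rfl
  map_smul' _ _ := rfl

/-- Evaluation into the double dual. -/
def ev (L : Type) [AddCommGroup L] [Module A L] : L →ₗ[A] ((L →ₗ[A] Q) →ₗ[E] Q) where
  toFun x := { toFun := fun f => f x, map_add' := fun _ _ => rfl, map_smul' := fun _ _ => rfl }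
  map_add' x y := by ext f; exact map_add f x y
  map_smul' a x := by ext f; exact map_smul f a x

/-- Reflexive modules. -/
def Refl (L : Type) [AddCommGroup L] [Module A L] : Prop := Function.Bijective (ev A E Q L)

/-- The comparison hypothesis: `E` acts as the full endomorphism ring. -/
def FullE : Prop := (∀ f : Q →ₗ[A] Q, ∃ e : E, ∀ q, f q = e • q) ∧
  (∀ e : E, (∀ q : Q, e • q = 0) → e = 0)

variable {A E Q}

@[simp] lemma dm_apply (f : L →ₗ[A] M) (g : M →ₗ[A] Q) (x : L) : dm A E Q f g x = g (f x) := rfl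
@[simp] lemma ev_apply (x : L) (g : L →ₗ[A] Q) : ev A E Q L x g = g x := rfl

lemma dm_inj {p : M →ₗ[A] L1} (hp : Function.Surjective p) : Function.Injective (dm A E Q p) := by
  intro f g h
  ext y
  obtain ⟨x, rfl⟩ := hp y
  exact LinearMap.congr_fun h x

lemma dm_exact {f : L →ₗ[A] M} {p : M →ₗ[A] L1} (h : Function.Exact f p)
    (hp : Function.Surjective p) : Function.Exact (dm A E Q p) (dm A E Q f) := by
  intro u
  constructor
  · intro hu
    obtain ⟨v, hv⟩ := factor_surj hp u (fun y hy => by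
      obtain ⟨x, rfl⟩ := (h y).1 hy
      exact LinearMap.congr_fun hu x)
    exact ⟨v, by ext y; exact hv y⟩
  · rintro ⟨v, rfl⟩
    ext x
    simp [h.apply_apply_eq_zero x]

lemma SES.dual {f : L →ₗ[A] M} {p : M →ₗ[A] L1} (h : SES f p)
    (he : ∀ u : L →ₗ[A] Q, ∃ v : M →ₗ[A] Q, v ∘ₗ f = u) :
    SES (dm A E Q p) (dm A E Q f) :=
  ⟨dm_inj h.surj, dm_exact h.exact h.surj, he⟩

lemma AddC.dual (h : AddC A L M) : AddC E (L →ₗ[A] Q) (M →ₗ[A] Q) := by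
  obtain ⟨n, a, b, hab⟩ := h
  refine ⟨n, fun i => dm A E Q (b i), fun i => dm A E Q (a i), fun f => ?_⟩
  ext x
  simp [LinearMap.sum_apply, ← map_sum, hab]

lemma Refl.add (hL : Refl A E Q L) (h : AddC A L M) : Refl A E Q M := by
  obtain ⟨n, a, b, hab⟩ := h
  constructor
  · rw [injective_iff_map_eq_zero]
    intro x hx
    rw [← hab x]
    refine Finset.sum_eq_zero fun i _ => ?_
    have : a i x = 0 := by
      apply hL.1
      rw [map_zero]
      ext f
      exact LinearMap.congr_fun hx (f ∘ₗ a i)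
    rw [this, map_zero]
  · intro φ
    choose y hy using fun i => hL.2 (dm E A Q (dm A E Q (a i)) φ)
    refine ⟨∑ i, b i (y i), ?_⟩
    ext f
    rw [map_sum, LinearMap.sum_apply]
    have : ∀ i, ev A E Q M (b i (y i)) f = φ (f ∘ₗ b i ∘ₗ a i) := fun i => by
      have := LinearMap.congr_fun (hy i) (f ∘ₗ b i)
      exact this
    simp only [this]
    rw [← map_sum]
    congr 1
    ext x
    simp [LinearMap.sum_apply, ← map_sum, hab]

lemma Refl.base (h : FullE A E Q) : Refl A E Q Q := by
  constructor
  · intro x y hxy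
    exact LinearMap.congr_fun hxy LinearMap.id
  · intro φ
    refine ⟨φ LinearMap.id, ?_⟩
    ext f
    obtain ⟨e, he⟩ := h.1 f
    have : f = e • LinearMap.id := by ext q; simp [he]
    rw [this, map_smul φ]; rfl

variable (A E Q) in
/-- `Hom_E(E,Q) ≅ Q`. -/
def homSelf : (E →ₗ[E] Q) ≃ₗ[A] Q where
  toFun f := f 1
  map_add' _ _ := rfl
  map_smul' _ _ := rfl
  invFun q := LinearMap.toSpanSingleton E Q q
  left_inv f := by ext; simp
  right_inv q := by simp

lemma Refl.ring (h : FullE A E Q) : Refl E A Q E := by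
  constructor
  · rw [injective_iff_map_eq_zero]
    intro x hx
    apply h.2
    intro q
    exact LinearMap.congr_fun hx (LinearMap.toSpanSingleton E Q q)
  · intro φ
    obtain ⟨e, he⟩ := h.1 (φ ∘ₗ (homSelf A E Q).symm.toLinearMap)
    refine ⟨e, ?_⟩
    ext f
    have := he (f 1)
    have h2 : (homSelf A E Q).symm (f 1) = f := (homSelf A E Q).symm_apply_apply f
    simp only [LinearMap.comp_apply, LinearEquiv.coe_coe, h2] at this
    rw [this]
    simp [← map_smul]

/-- `Hom_A(Q,Q) ≅ E`. -/
lemma endEquiv (h : FullE A E Q) : Nonempty (E ≃ₗ[E] (Q →ₗ[A] Q)) := by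
  refine ⟨LinearEquiv.ofBijective (LinearMap.toSpanSingleton E (Q →ₗ[A] Q) LinearMap.id) ⟨?_, ?_⟩⟩
  · rw [injective_iff_map_eq_zero]
    intro e he
    exact h.2 e fun q => LinearMap.congr_fun he q
  · intro f
    obtain ⟨e, he⟩ := h.1 f
    exact ⟨e, by ext q; simp [he]⟩

lemma AddC.dualProj (hE : FullE A E Q) (h : AddC A Q M) : Module.Projective E (M →ₗ[A] Q) := by
  obtain ⟨e⟩ := endEquiv hE
  exact AddC.proj ((AddC.ofEquiv e).trans (AddC.dual h))

/-- Duals of free modules are in `add Q`. -/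
lemma addC_dual_free {P : Type} [AddCommGroup P] [Module E P] (h : AddC E E P) :
    AddC A Q (P →ₗ[E] Q) :=
  (AddC.ofEquiv (homSelf A E Q).symm).trans (AddC.dual h)

lemma snake {f : L →ₗ[A] M} {p : M →ₗ[A] L1} (h : SES f p)
    (he : ∀ u : L →ₗ[A] Q, ∃ v : M →ₗ[A] Q, v ∘ₗ f = u) (hM : Refl A E Q M)
    (h1 : Function.Injective (ev A E Q L1)) : Refl A E Q L := by
  constructor
  · rw [injective_iff_map_eq_zero]
    intro x hx
    apply h.inj
    apply hM.1
    rw [map_zero, map_zero]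
    ext g
    exact LinearMap.congr_fun hx (g ∘ₗ f)
  · intro φ
    obtain ⟨y, hy⟩ := hM.2 (dm E A Q (dm A E Q f) φ)
    have hp : p y = 0 := by
      apply h1
      rw [map_zero]
      ext g
      have := LinearMap.congr_fun hy (g ∘ₗ p)
      refine this.trans ?_
      have h0 : dm A E Q f (g ∘ₗ p) = 0 := by
        ext x; simp [h.exact.apply_apply_eq_zero x]
      rw [dm_apply, h0, map_zero]; rfl
    obtain ⟨x, rfl⟩ := (h.exact y).1 hp
    refine ⟨x, ?_⟩
    ext u
    obtain ⟨v, rfl⟩ := he u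
    exact LinearMap.congr_fun hy v

lemma tl_of_inj {f : L →ₗ[A] M} (hf : Function.Injective f) (hM : Function.Injective (ev A E Q M)) :
    Function.Injective (ev A E Q L) := by
  rw [injective_iff_map_eq_zero]
  intro x hx
  apply hf
  apply hM
  rw [map_zero, map_zero]
  ext g
  exact LinearMap.congr_fun hx (g ∘ₗ f)

lemma Cop.refl (hE : FullE A E Q) {n : ℕ} (hn : 2 ≤ n) {L : ModuleCat.{0} A} (h : Cop A Q n L) :
    Refl A E Q L := by
  obtain ⟨M, L1, ι, p, h1, h2, h3, M', L2, ι', p', h1', h2', -⟩ := h.mono hn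
  exact snake h2 h3 ((Refl.base hE).add h1) (tl_of_inj h2'.inj ((Refl.base hE).add h1').1)

lemma dm_full (hM : Refl A E Q M) (u : (M →ₗ[A] Q) →ₗ[E] (N →ₗ[A] Q)) :
    ∃ v : N →ₗ[A] M, dm A E Q v = u := by
  let e := LinearEquiv.ofBijective (ev A E Q M) hM
  refine ⟨e.symm.toLinearMap ∘ₗ dm E A Q u ∘ₗ ev A E Q N, ?_⟩
  ext f x
  have : ev A E Q M (e.symm (dm E A Q u (ev A E Q N x))) = dm E A Q u (ev A E Q N x) :=
    e.apply_symm_apply _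
  exact LinearMap.congr_fun this f

lemma dm_faith (hM : Function.Injective (ev A E Q M)) {v w : N →ₗ[A] M}
    (h : dm A E Q v = dm A E Q w) : v = w := by
  ext x
  apply hM
  ext f
  exact LinearMap.congr_fun (LinearMap.congr_fun h f) x

lemma G1 (hE : FullE A E Q) (hN : ∀ i, EV A N Q (i+1)) (j : ℕ) : ∀ L : ModuleCat.{0} A,
    Cop A Q (j+3) L → (EV E (L →ₗ[A] Q) (N →ₗ[A] Q) (j+1) ↔ EV A N L (j+1)) := by
  induction j with
  | zero =>
    rintro L ⟨M, L1, ι, p, h1, h2, h3, h4⟩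
    have hr1 : Refl A E Q L1 := Cop.refl (n := 2) hE le_rfl h4
    have hrM : Refl A E Q M := (Refl.base hE).add h1
    have hs := h2.dual (E := E) h3
    have hpr := h1.dualProj hE
    constructor
    · intro h
      refine EV.v4 h2 (fun u => ?_) (AddC.right h1 (hN 0))
      obtain ⟨w, hw⟩ := EV.c3 hs h (dm A E Q u)
      obtain ⟨v, rfl⟩ := dm_full hrM w
      exact ⟨v, dm_faith hr1.1 (E := E) hw⟩
    · intro h
      refine EV.c4 hs (fun u => ?_) (EV.proj 0)
      obtain ⟨v, rfl⟩ := dm_full hr1 u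
      obtain ⟨w, rfl⟩ := EV.v3 h2 h v
      exact ⟨dm A E Q w, rfl⟩
  | succ j ih =>
    rintro L ⟨M, L1, ι, p, h1, h2, h3, h4⟩
    have hs := h2.dual (E := E) h3
    have hpr := h1.dualProj hE
    constructor
    · intro h
      exact EV.v1 h2 ((ih L1 h4).1 (EV.c2 hs (EV.proj j) h)) (AddC.right h1 (hN (j+1)))
    · intro h
      exact EV.c1 hs ((ih L1 h4).2 (EV.v2 h2 (AddC.right h1 (hN j)) h)) (EV.proj _)

end Dual
end PfH

namespace PfH
set_option linter.unusedSectionVars false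

section GTwo
variable {A E Q : Type} [Ring A] [Ring E] [AddCommGroup Q] [Module A Q] [Module E Q]
  [SMulCommClass A E Q] [SMulCommClass E A Q]

/-- Finitely generated free covers over a noetherian ring. -/
lemma exists_cover (B : Type) [Ring B] [IsNoetherianRing B] (X : Type) [AddCommGroup X] [Module B X]
    [Module.Finite B X] : ∃ (r : ℕ) (g : (Fin r → B) →ₗ[B] X),
      SES (LinearMap.ker g).subtype g ∧ Module.Finite B (LinearMap.ker g) := by
  obtain ⟨r, g, hg⟩ := Module.Finite.exists_fin' B X
  exact ⟨r, g, SES.ofSurj g hg, inferInstance⟩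

lemma tors_bound {T : Type} [AddCommGroup T] [Module A T] {l n : ℕ}
    (hQT : ∀ i, l < i → EV A Q T i)
    (hT : ∀ (C : Type) [AddCommGroup C] [Module A C] (i : ℕ), n < i → EV A C T i)
    {C D : Type} [AddCommGroup C] [Module A C] [AddCommGroup D] [Module A D]
    (hD : AddC A Q D) (f : C →ₗ[A] D) (hf : Function.Injective f) {i : ℕ} (h1 : l < i)
    (h2 : n < i + 1) : EV A C T i :=
  EV.c2 (SES.ofInj f hf) (AddC.left hD (hQT i h1)) (hT _ _ h2)

/-- Submodule form of the vanishing statement. -/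
def PA' (A E Q T : Type) [Ring A] [Ring E] [AddCommGroup Q] [Module A Q] [Module E Q]
    [SMulCommClass A E Q] [SMulCommClass E A Q] [AddCommGroup T] [Module A T] (l n m : ℕ) : Prop :=
  ∀ (X X1 : Type) [AddCommGroup X] [Module E X] [AddCommGroup X1] [Module E X1]
    [Module.Finite E X1] (r : ℕ) (ι : X1 →ₗ[E] (Fin r → E)) (g : (Fin r → E) →ₗ[E] X), SES ι g →
    (∀ i, 1 ≤ i → i ≤ m → EV E X Q i) → ∀ i, l < i → n < i + m + 1 →
    EV A (LinearMap.range (dm E A Q ι)) T i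

/-- Statement `A(m)`. -/
def PA (A E Q T : Type) [Ring A] [Ring E] [AddCommGroup Q] [Module A Q] [Module E Q]
    [SMulCommClass A E Q] [SMulCommClass E A Q] [AddCommGroup T] [Module A T] (l n m : ℕ) : Prop :=
  ∀ (X : Type) [AddCommGroup X] [Module E X] [Module.Finite E X],
    (∀ i, 1 ≤ i → i ≤ m → EV E X Q i) → ∀ i, l < i → n < i + m + 2 →
    EV A (X →ₗ[E] Q) T i

lemma PA_of [IsNoetherianRing E] {T : Type} [AddCommGroup T] [Module A T] {l n m : ℕ}
    (hQT : ∀ i, l < i → EV A Q T i) (h : PA' A E Q T l n m) : PA A E Q T l n m := by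
  intro X _ _ _ hX i hi hi2
  obtain ⟨r, g, hs, hf⟩ := exists_cover E X
  exact EV.c2 (SES.toRange (dm_inj (E := A) (Q := Q) hs.surj) (dm_exact hs.exact hs.surj))
    (AddC.left (addC_dual_free (AddC.pi r)) (hQT i hi))
    (h X _ r _ g hs hX (i+1) (by omega) (by omega))

lemma PA'_all [IsNoetherianRing E] {T : Type} [AddCommGroup T] [Module A T] {l n : ℕ}
    (hQT : ∀ i, l < i → EV A Q T i)
    (hT : ∀ (C : Type) [AddCommGroup C] [Module A C] (i : ℕ), n < i → EV A C T i) (m : ℕ) :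
    PA' A E Q T l n m := by
  induction m with
  | zero =>
    intro X X1 _ _ _ _ _ r ι g hs hX i hi hi2
    obtain ⟨s, q, hs1, -⟩ := exists_cover E X1
    exact tors_bound hQT hT (addC_dual_free (A := A) (Q := Q) (AddC.pi (B := E) s))
      (dm E A Q q ∘ₗ (LinearMap.range (dm E A Q ι)).subtype)
      ((dm_inj (E := A) (Q := Q) hs1.surj).comp Subtype.val_injective) hi hi2
  | succ m ih =>
    intro X X1 _ _ _ _ _ r ι g hs hX i hi hi2
    have hsur : LinearMap.range (dm E A Q ι) = ⊤ :=
      LinearMap.range_eq_top.2 (fun u => EV.c3 hs (hX 1 le_rfl (by omega)) u)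
    refine AddC.left (AddC.ofEquiv (LinearEquiv.ofTop _ hsur).symm)
      (PA_of hQT ih X1 (fun i h1 h2 => ?_) i hi (by omega))
    obtain ⟨i, rfl⟩ : ∃ j, i = j + 1 := ⟨i - 1, by omega⟩
    exact EV.c2 hs (EV.proj i) (hX _ (by omega) (by omega))

lemma refl_surj (hE : FullE A E Q) {X X1 : Type} [AddCommGroup X] [Module E X] [AddCommGroup X1]
    [Module E X1] {r : ℕ} {ι : X1 →ₗ[E] (Fin r → E)} {g : (Fin r → E) →ₗ[E] X} (hs : SES ι g)
    (hC : EV A (LinearMap.range (dm E A Q ι)) Q 1) : Function.Surjective (ev E A Q X) := by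
  intro φ
  obtain ⟨v, hv⟩ := EV.c3
    (SES.toRange (dm_inj (E := A) (Q := Q) hs.surj) (dm_exact hs.exact hs.surj)) hC φ
  obtain ⟨p, rfl⟩ := ((Refl.ring hE).add (AddC.pi r)).2 v
  exact ⟨g p, hv⟩

lemma refl_X [IsNoetherianRing E] (hE : FullE A E Q) {m : ℕ} (hQQ : ∀ i, 0 < i → EV A Q Q i)
    (hid : ∀ (C : Type) [AddCommGroup C] [Module A C] (i : ℕ), m < i → EV A C Q i)
    (X : Type) [AddCommGroup X] [Module E X] [Module.Finite E X]
    (hX : ∀ i, 1 ≤ i → i ≤ m → EV E X Q i) : Refl E A Q X := by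
  obtain ⟨r, g, hs, hf⟩ := exists_cover E X
  obtain ⟨s, q, hs1, hf1⟩ := exists_cover E (LinearMap.ker g)
  refine ⟨?_, refl_surj hE hs (PA'_all hQQ hid m X _ r _ g hs hX 1 (by omega) (by omega))⟩
  have hsX1 : Function.Surjective (ev E A Q (LinearMap.ker g)) := by
    refine refl_surj hE hs1 (PA'_all hQQ hid (m-1) _ _ s _ q hs1 (fun i h1 h2 => ?_) 1
      (by omega) (by omega))
    obtain ⟨i, rfl⟩ : ∃ j, i = j + 1 := ⟨i - 1, by omega⟩
    exact EV.c2 hs (EV.proj i) (hX _ (by omega) (by omega))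
  have hext : ∀ ψ : LinearMap.range (dm E A Q (LinearMap.ker g).subtype) →ₗ[A] Q,
      ∃ θ : (LinearMap.ker g →ₗ[E] Q) →ₗ[A] Q, θ ∘ₗ (Submodule.subtype _) = ψ := by
    intro ψ
    refine EV.c3 (SES.ofInj _ Subtype.val_injective) ?_ ψ
    rcases Nat.eq_zero_or_pos m with rfl | hm
    · exact hid _ 1 (by omega)
    · have : Subsingleton ((LinearMap.ker g →ₗ[E] Q) ⧸ LinearMap.range
          (LinearMap.range (dm E A Q (LinearMap.ker g).subtype)).subtype) := by
        rw [Submodule.Quotient.subsingleton_iff, Submodule.range_subtype]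
        exact LinearMap.range_eq_top.2 (fun u => EV.c3 hs (hX 1 le_rfl hm) u)
      exact EV.sub_left 1
  rw [injective_iff_map_eq_zero]
  intro x hx
  obtain ⟨p, rfl⟩ := hs.surj x
  obtain ⟨ψ, hψ⟩ := factor_surj
    (LinearMap.surjective_rangeRestrict (dm E A Q (LinearMap.ker g).subtype))
    (ev E A Q _ p) (fun y hy => by
      have hy' : dm E A Q (LinearMap.ker g).subtype y = 0 := congrArg Subtype.val hy
      obtain ⟨z, rfl⟩ := (dm_exact (E := A) (Q := Q) hs.exact hs.surj y).1 hy'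
      exact LinearMap.congr_fun hx z)
  obtain ⟨θ, hθ⟩ := hext ψ
  obtain ⟨x1, rfl⟩ := hsX1 θ
  have : p = (LinearMap.ker g).subtype x1 := by
    apply ((Refl.ring hE).add (AddC.pi r)).1
    ext f
    rw [← hψ f, ← hθ]
    rfl
  rw [this]
  exact x1.2

end GTwo
end PfH

namespace PfH
set_option linter.unusedSectionVars false

section Fin
variable {A E Q : Type} [Ring A] [Ring E] [AddCommGroup Q] [Module A Q] [Module E Q]
  [SMulCommClass A E Q] [SMulCommClass E A Q]

lemma AddC.noeth {M : Type} [AddCommGroup M] [Module E M] [IsNoetherian E Q] (h : AddC E Q M) :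
    IsNoetherian E M := by
  obtain ⟨n, a, b, hab⟩ := h
  refine isNoetherian_of_injective (LinearMap.pi a) ?_
  intro x y hxy
  rw [← hab x, ← hab y]
  refine Finset.sum_congr rfl fun i _ => ?_
  rw [show a i x = a i y from congrFun hxy i]

variable (A E Q) in
lemma dual_noeth [IsNoetherian E Q] (N : Type) [AddCommGroup N] [Module A N] [Module.Finite A N] :
    IsNoetherian E (N →ₗ[A] Q) := by
  obtain ⟨r, g, hg⟩ := Module.Finite.exists_fin' A N
  have : IsNoetherian E ((Fin r → A) →ₗ[A] Q) :=
    AddC.noeth (addC_dual_free (A := E) (E := A) (Q := Q) (AddC.pi (B := A) (Q := A) r))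
  exact isNoetherian_of_injective (dm A E Q g) (dm_inj hg)

end Fin

section GP
variable (A : Type) [Ring A]

/-- Gorenstein projectives. -/
def GP (N : Type) [AddCommGroup N] [Module A N] : Prop := ∀ i, EV A N A (i+1)

lemma fullOp : FullE Aᵐᵒᵖ A A := by
  constructor
  · intro f
    refine ⟨f 1, fun q => ?_⟩
    have := map_smul f (MulOpposite.op q) 1
    simpa using this
  · intro e h
    simpa using h 1

/-- `A_A ≅ A^op`. -/
def opEquiv : Aᵐᵒᵖ ≃ₗ[Aᵐᵒᵖ] A where
  toFun := MulOpposite.unop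
  invFun := MulOpposite.op
  map_add' _ _ := rfl
  map_smul' _ _ := rfl
  left_inv _ := rfl
  right_inv _ := rfl

variable {A}

lemma gp_refl [IsNoetherianRing A] {n : ℕ}
    (hop : ∀ (C : Type) [AddCommGroup C] [Module Aᵐᵒᵖ C] (i : ℕ), n < i → EV Aᵐᵒᵖ C A i)
    (N : Type) [AddCommGroup N] [Module A N] [Module.Finite A N] (hN : GP A N) :
    Refl A Aᵐᵒᵖ A N := by
  have : Module.Projective Aᵐᵒᵖ A := AddC.proj (AddC.ofEquiv (opEquiv A))
  refine refl_X (A := Aᵐᵒᵖ) (E := A) (Q := A) (fullOp A) (m := n) (fun i hi => ?_) hop N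
    (fun i h1 _ => ?_)
  · obtain ⟨i, rfl⟩ : ∃ j, i = j + 1 := ⟨i - 1, by omega⟩
    exact EV.proj i
  · obtain ⟨i, rfl⟩ : ∃ j, i = j + 1 := ⟨i - 1, by omega⟩
    exact hN i

lemma gp_approx [IsNoetherianRing A] [IsNoetherian Aᵐᵒᵖ A] {n : ℕ}
    (hop : ∀ (C : Type) [AddCommGroup C] [Module Aᵐᵒᵖ C] (i : ℕ), n < i → EV Aᵐᵒᵖ C A i)
    (N : Type) [AddCommGroup N] [Module A N] [Module.Finite A N] (hN : GP A N) :
    ∃ (r : ℕ) (f : N →ₗ[A] (Fin r → A)), Function.Injective f ∧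
      GP A ((Fin r → A) ⧸ LinearMap.range f) := by
  have := dual_noeth A Aᵐᵒᵖ A N
  have hr := gp_refl hop N hN
  obtain ⟨r, π, hπ⟩ := Module.Finite.exists_fin' Aᵐᵒᵖ (N →ₗ[A] A)
  let f : N →ₗ[A] (Fin r → A) := LinearMap.pi fun i => π (fun j => if i = j then 1 else 0)
  have hext : ∀ u : N →ₗ[A] A, ∃ v : (Fin r → A) →ₗ[A] A, v ∘ₗ f = u := by
    intro u
    obtain ⟨c, rfl⟩ := hπ u
    refine ⟨∑ i, c i • (LinearMap.proj i : (Fin r → A) →ₗ[A] A), ?_⟩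
    ext x
    rw [LinearMap.pi_apply_eq_sum_univ π c]
    simp [LinearMap.sum_apply, f]
  have hf : Function.Injective f := by
    rw [injective_iff_map_eq_zero]
    intro x hx
    apply hr.1
    rw [map_zero]
    ext u
    obtain ⟨v, rfl⟩ := hext u
    simp [hx]
  refine ⟨r, f, hf, fun i => ?_⟩
  rcases i with _ | i
  · exact EV.c4 (SES.ofInj f hf) hext (EV.proj 0)
  · exact EV.c1 (SES.ofInj f hf) (hN i) (EV.proj _)

lemma gp_pd [IsNoetherianRing A] {N : Type} [AddCommGroup N] [Module A N] (hN : GP A N) (l : ℕ) :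
    ∀ (R : Type) [AddCommGroup R] [Module A R] [Module.Finite A R],
    (∀ (T : Type) [AddCommGroup T] [Module A T] (i : ℕ), l < i → EV A R T i) →
    ∀ i, EV A N R (i+1) := by
  induction l with
  | zero =>
    intro R _ _ _ h i
    obtain ⟨r, g, hs, hf⟩ := exists_cover A R
    obtain ⟨s, hs'⟩ := EV.v3 hs (h _ 1 (by omega)) LinearMap.id
    have h1 : AddC A (Fin r → A) R := ⟨1, fun _ => s, fun _ => g, fun x => by
      simpa using LinearMap.congr_fun hs' x⟩
    exact AddC.right ((AddC.pi r).trans h1) (hN i)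
  | succ l ih =>
    intro R _ _ _ h i
    obtain ⟨r, g, hs, hf⟩ := exists_cover A R
    refine EV.v2 hs (AddC.right (AddC.pi r) (hN i)) (ih _ (fun T _ _ i hi => ?_) (i+1))
    obtain ⟨i, rfl⟩ : ∃ j, i = j + 1 := ⟨i - 1, by omega⟩
    exact EV.c2 hs (EV.proj i) (h T _ (by omega))

end GP
end PfH

namespace PfH
set_option linter.unusedSectionVars false

/-- The collected hypotheses. -/
structure Setup (A E Q : Type) [Ring A] [Ring E] [AddCommGroup Q] [Module A Q] [Module E Q]
    [SMulCommClass A E Q] [SMulCommClass E A Q] (n m l : ℕ) : Prop where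
  nA : IsNoetherianRing A
  nE : IsNoetherianRing E
  nAo : IsNoetherian Aᵐᵒᵖ A
  nAQ : IsNoetherian A Q
  nEQ : IsNoetherian E Q
  full : FullE A E Q
  hQQ : ∀ i, 0 < i → EV A Q Q i
  hid : ∀ (C : Type) [AddCommGroup C] [Module A C] (i : ℕ), m < i → EV A C Q i
  hpd : ∀ (T : Type) [AddCommGroup T] [Module A T] (i : ℕ), l < i → EV A Q T i
  hA : ∀ (C : Type) [AddCommGroup C] [Module A C] (i : ℕ), n < i → EV A C A i
  hop : ∀ (C : Type) [AddCommGroup C] [Module Aᵐᵒᵖ C] (i : ℕ), n < i → EV Aᵐᵒᵖ C A i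
  cop : Cop A Q n (ModuleCat.of A A)
  hn : m + l + 2 ≤ n

/-- The full subcategory of `E`-modules. -/
structure InC (E Q : Type) [Ring E] [AddCommGroup Q] [Module E Q] (n m : ℕ) (X : Type)
    [AddCommGroup X] [Module E X] : Prop where
  fin : Module.Finite E X
  h1 : ∀ i, 1 ≤ i → i ≤ m → EV E X Q i
  h2 : ∀ j, 1 ≤ j → j ≤ n - m - 2 → EV E Q X j

section Main
variable {A E Q : Type} [Ring A] [Ring E] [AddCommGroup Q] [Module A Q] [Module E Q]
  [SMulCommClass A E Q] [SMulCommClass E A Q] {n m l : ℕ}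
variable {X Y Z N : Type} [AddCommGroup X] [Module E X] [AddCommGroup Y] [Module E Y]
  [AddCommGroup Z] [Module E Z] [AddCommGroup N] [Module A N]

lemma Setup.refl (S : Setup A E Q n m l) (hX : InC E Q n m X) : Refl E A Q X := by
  have := S.nE
  have := hX.fin
  exact refl_X S.full S.hQQ S.hid X hX.h1

lemma Setup.part1 (S : Setup A E Q n m l) (hX : InC E Q n m X) :
    Module.Finite A (X →ₗ[E] Q) ∧ GP A (X →ₗ[E] Q) := by
  have := S.nE
  have := hX.fin
  have := S.nAQ
  have := S.hn
  have hno := dual_noeth E A Q X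
  refine ⟨inferInstance, fun j => ?_⟩
  by_cases hj : n - m - 1 ≤ j + 1
  · exact PA_of (S.hpd A) (PA'_all (S.hpd A) S.hA m) X hX.h1 (j+1) (by omega) (by omega)
  · have hN : ∀ i, EV A (X →ₗ[E] Q) Q (i+1) := fun i =>
      PA_of S.hQQ (PA'_all S.hQQ S.hid m) X hX.h1 (i+1) (by omega) (by omega)
    refine (G1 S.full hN j (ModuleCat.of A A) (S.cop.mono (by omega))).1 ?_
    exact AddC.left (AddC.ofEquiv (homSelf E A Q).symm)
      (AddC.right (AddC.ofEquiv (LinearEquiv.ofBijective _ (S.refl hX)))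
        (hX.h2 (j+1) (by omega) (by omega)))

lemma Setup.part2 (S : Setup A E Q n m l) (hY : InC E Q n m Y) :
    Function.Bijective (fun φ : X →ₗ[E] Y => dm E A Q φ) :=
  ⟨fun _ _ h => dm_faith (S.refl hY).1 h, fun u => dm_full (S.refl hY) u⟩

lemma Setup.reflA (S : Setup A E Q n m l) : Refl A E Q A := by
  have := S.hn
  exact Cop.refl (n := n) S.full (by omega) S.cop

lemma Setup.EVAA (S : Setup A E Q n m l) (i : ℕ) (hi : i + 3 ≤ n) :
    EV E (A →ₗ[A] Q) (A →ₗ[A] Q) (i+1) :=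
  (G1 S.full (fun i => EV.proj i) i (ModuleCat.of A A) (S.cop.mono hi)).2 (EV.proj i)

lemma Setup.gpQ (S : Setup A E Q n m l) (hN : GP A N) (i : ℕ) : EV A N Q (i+1) := by
  have := S.nA
  have := S.nAQ
  exact gp_pd hN l Q S.hpd i

lemma Setup.gpApp (S : Setup A E Q n m l) [Module.Finite A N] (hN : GP A N) :
    ∃ (r : ℕ) (f : N →ₗ[A] (Fin r → A)), Function.Injective f ∧
      GP A ((Fin r → A) ⧸ LinearMap.range f) := by
  have := S.nA
  have := S.nAo
  exact gp_approx S.hop N hN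

lemma Setup.gpRefl (S : Setup A E Q n m l) [Module.Finite A N] (hN : GP A N) :
    Refl A E Q N := by
  obtain ⟨r, f, hf, h1⟩ := S.gpApp hN
  obtain ⟨r', f', hf', h1'⟩ := S.gpApp h1
  exact snake (SES.ofInj f hf) (fun u => EV.c3 (SES.ofInj f hf) (S.gpQ h1 0) u)
    (S.reflA.add (AddC.pi r)) (tl_of_inj hf' (S.reflA.add (AddC.pi r')).1)

lemma Setup.gpDual (S : Setup A E Q n m l) (i : ℕ) (hi : i + 3 ≤ n) :
    ∀ (N : Type) [AddCommGroup N] [Module A N] [Module.Finite A N], GP A N →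
    EV E (N →ₗ[A] Q) (A →ₗ[A] Q) (i+1) := by
  induction i with
  | zero =>
    intro N _ _ _ hN
    obtain ⟨r, f, hf, h1⟩ := S.gpApp hN
    have hs := SES.ofInj f hf
    have hd := hs.dual (E := E) (fun u => EV.c3 hs (S.gpQ h1 0) u)
    refine EV.c4 hd (fun u => ?_) (AddC.left (AddC.dual (AddC.pi r)) (S.EVAA 0 hi))
    obtain ⟨v, rfl⟩ := dm_full (S.gpRefl h1) u
    obtain ⟨w, rfl⟩ := Module.projective_lifting_property _ v hs.surj
    exact ⟨dm A E Q w, rfl⟩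
  | succ i ih =>
    intro N _ _ _ hN
    obtain ⟨r, f, hf, h1⟩ := S.gpApp hN
    have hs := SES.ofInj f hf
    have hd := hs.dual (E := E) (fun u => EV.c3 hs (S.gpQ h1 0) u)
    exact EV.c1 hd (ih (by omega) _ h1) (AddC.left (AddC.dual (AddC.pi r)) (S.EVAA (i+1) hi))

lemma Setup.part3 (S : Setup A E Q n m l) [Module.Finite A N] (hN : GP A N) :
    InC E Q n m (N →ₗ[A] Q) := by
  have := S.nEQ
  have := S.hn
  have := dual_noeth A E Q N
  refine ⟨inferInstance, fun i h1 h2 => ?_, fun j h1 h2 => ?_⟩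
  · obtain ⟨i, rfl⟩ : ∃ j, i = j + 1 := ⟨i - 1, by omega⟩
    by_cases hi : i + 3 ≤ n
    · exact AddC.right (AddC.ofEquiv (homSelf E A Q)) (S.gpDual i hi N hN)
    · omega
  · obtain ⟨j, rfl⟩ : ∃ i, j = i + 1 := ⟨j - 1, by omega⟩
    exact AddC.left (AddC.ofEquiv (homSelf E A Q))
      ((G1 S.full (S.gpQ hN) j (ModuleCat.of A A) (S.cop.mono (by omega))).2 (hN j))

lemma cop_vanish {C : Type} [AddCommGroup C] [Module A C] (hC : ∀ i, EV A C Q i) (n : ℕ) :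
    ∀ L : ModuleCat.{0} A, Cop A Q n L → ∀ i, i < n → EV A C L i := by
  induction n with
  | zero => intro L _ i hi; omega
  | succ n ih =>
    rintro L ⟨M, L1, ι, p, h1, h2, h3, h4⟩ i hi
    rcases i with _ | i
    · rw [EV.zero_iff]
      intro f
      have h0 := EV.zero_iff.1 (AddC.right h1 (hC 0)) (ι ∘ₗ f)
      ext x
      apply h2.inj
      have := LinearMap.congr_fun h0 x
      simpa using this
    · exact EV.v1 h2 (ih L1 h4 i (by omega)) (AddC.right h1 (hC _))

lemma Setup.part4 (S : Setup A E Q n m l) (hX : InC E Q n m X) (hY : InC E Q n m Y)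
    (hZ : InC E Q n m Z) {f : X →ₗ[E] Y} {g : Y →ₗ[E] Z} (hs : SES f g)
    (hl : n = m + 2 → ∀ h : Q →ₗ[E] Z, ∃ h' : Q →ₗ[E] Y, g ∘ₗ h' = h) :
    Function.Surjective (dm E A Q f) := by
  have hn := S.hn
  rcases Nat.eq_zero_or_pos m with rfl | hm
  swap
  · intro u
    exact EV.c3 hs (hZ.h1 1 le_rfl hm) u
  have := S.nA
  obtain ⟨fX, gX⟩ := S.part1 hX
  obtain ⟨fY, gY⟩ := S.part1 hY
  obtain ⟨fZ, gZ⟩ := S.part1 hZ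
  rw [← LinearMap.range_eq_top, ← Submodule.Quotient.subsingleton_iff]
  have hC0 : EV A ((X →ₗ[E] Q) ⧸ LinearMap.range (dm E A Q f)) Q 0 := by
    rw [EV.zero_iff]
    intro h
    obtain ⟨x, hx⟩ := (S.refl hX).2 (h ∘ₗ (LinearMap.range (dm E A Q f)).mkQ)
    have hx0 : x = 0 := by
      apply hs.inj
      apply (S.refl hY).1
      rw [map_zero, map_zero]
      ext y
      have h1 := LinearMap.congr_fun hx (dm E A Q f y)
      have h2 : (LinearMap.range (dm E A Q f)).mkQ (dm E A Q f y) = 0 :=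
        (Submodule.Quotient.mk_eq_zero _).2 ⟨y, rfl⟩
      rw [LinearMap.comp_apply, h2, map_zero] at h1
      exact h1
    subst hx0
    rw [map_zero] at hx
    apply LinearMap.ext
    intro c
    obtain ⟨c, rfl⟩ := Submodule.mkQ_surjective _ c
    exact (LinearMap.congr_fun hx c).symm
  have hCQ : ∀ i, EV A ((X →ₗ[E] Q) ⧸ LinearMap.range (dm E A Q f)) Q i := by
    intro i
    rcases i with _ | i
    · exact hC0
    · exact S.hid _ _ (by omega)
  have hlow := cop_vanish hCQ n (ModuleCat.of A A) S.cop
  have s1 : SES (dm E A Q g) (dm E A Q f).rangeRestrict :=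
    SES.toRange (dm_inj hs.surj) (dm_exact hs.exact hs.surj)
  have s2 : SES (LinearMap.range (dm E A Q f)).subtype (LinearMap.range (dm E A Q f)).mkQ :=
    ⟨Subtype.val_injective, LinearMap.exact_subtype_mkQ _, Submodule.mkQ_surjective _⟩
  have hGP : GP A ((X →ₗ[E] Q) ⧸ LinearMap.range (dm E A Q f)) := by
    intro i
    by_cases hi : i + 1 < n
    · exact hlow _ hi
    rcases i with _ | _ | i
    · omega
    · refine EV.c1 s2 ?_ (gX _)
      let e := LinearEquiv.ofBijective _ S.reflA
      refine AddC.right (AddC.ofEquiv e.symm) (EV.c4 s1 (fun u => ?_)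
        (AddC.right (AddC.ofEquiv e) (gY 0)))
      obtain ⟨v, rfl⟩ := dm_full (S.refl hZ) u
      obtain ⟨w, hw⟩ := hl (by omega) (v ∘ₗ (homSelf E A Q).symm.toLinearMap)
      refine ⟨dm E A Q (w ∘ₗ (homSelf E A Q).toLinearMap), ?_⟩
      ext y q
      have h1 := LinearMap.congr_fun hw ((homSelf E A Q) q)
      have h2 : (homSelf E A Q).symm ((homSelf E A Q) q) = q := LinearEquiv.symm_apply_apply _ _
      simp only [LinearMap.comp_apply, LinearEquiv.coe_coe, h2] at h1
      exact congrArg y h1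
    · exact EV.c1 s2 (EV.c1 s1 (gZ i) (gY (i+1))) (gX _)
  have hr := gp_refl S.hop _ hGP
  refine ⟨fun a b => ?_⟩
  apply hr.1
  ext u
  have : u = 0 := EV.zero_iff.1 (hlow 0 (by omega)) u
  simp [this]

end Main
end PfH

namespace PfH
set_option linter.unusedSectionVars false

lemma mkSetup (k : Type) [Field k] (A : Type) [Ring A] [Algebra k A]
    [FiniteDimensional k A]
    (Q : ModuleCat.{0} A) [Module.Finite A Q] (n m l : ℕ)
    (hpair : IsRelAGPair A Q n) (hpd : pdEq A Q l) (hid : idEq A Q m)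
    (hn : m + l + 2 ≤ n) : Setup A (Module.End A Q) Q n m l := by
  have hA : IsNoetherianRing A := IsNoetherianRing.of_finite k A
  have hkQ : Module.Finite k Q := Module.Finite.trans A Q
  have hkE : Module.Finite k (Module.End A Q) :=
    Module.Finite.of_injective (LinearMap.restrictScalarsₗ k A Q Q k)
      (LinearMap.restrictScalars_injective k)
  have hE : IsNoetherianRing (Module.End A Q) := IsNoetherianRing.of_finite k (Module.End A Q)
  have ht : IsScalarTower k (Module.End A Q) Q := ⟨fun c e q => rfl⟩
  have ht' : IsScalarTower k Aᵐᵒᵖ A := ⟨fun c e q => by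
    simp⟩
  obtain ⟨p1, p2, p3, p4⟩ := hpair
  refine ⟨hA, hE, isNoetherian_of_tower k inferInstance, inferInstance,
    isNoetherian_of_tower k inferInstance, ⟨fun f => ⟨f, fun q => rfl⟩,
      fun e h => LinearMap.ext h⟩, fun i hi => (extVanish_iff' Q Q hi).1 (p3 i hi), ?_, ?_, ?_,
      ?_, domdim_cop n _ p4, hn⟩
  · intro C _ _ i hi
    exact idLE_EV hid.1 hi
  · intro C _ _ i hi
    exact pdLE_EV hpd.1 hi
  · intro C _ _ i hi
    exact idLE_EV p1 hi
  · intro C _ _ i hi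
    exact AddC.right (AddC.ofEquiv (opEquiv A)) (idLE_EV p2 hi)

lemma mkInC {A : Type} [Ring A] {Q : ModuleCat.{0} A} {n m : ℕ}
    {X : ModuleCat.{0} (Module.End A Q)} : 
    (Module.Finite (Module.End A Q) X ∧
       (∀ i, 1 ≤ i → i ≤ m → ExtVanish (Module.End A Q) X (ModuleCat.of (Module.End A Q) Q) i) ∧
       (∀ j, 1 ≤ j → j ≤ n - m - 2 → ExtVanish (Module.End A Q) (ModuleCat.of (Module.End A Q) Q) X j)) ↔
    InC (Module.End A Q) Q n m X := by
  constructor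
  · rintro ⟨h1, h2, h3⟩
    exact ⟨h1, fun i hi hi' => (extVanish_iff' _ _ hi).1 (h2 i hi hi'),
      fun i hi hi' => (extVanish_iff' _ _ hi).1 (h3 i hi hi')⟩
  · rintro ⟨h1, h2, h3⟩
    exact ⟨h1, fun i hi hi' => (extVanish_iff' _ _ hi).2 (h2 i hi hi'),
      fun i hi hi' => (extVanish_iff' _ _ hi).2 (h3 i hi hi')⟩

end PfH

/-- Theorem 5.5(i): for a relative `n`-Auslander–Gorenstein pair
`(A, Q)` with `n ≥ m + l + 2`, the functor `Hom_Λ(−, Q)` induces an exact duality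
between `{X : Ext^i_Λ(X,Q) = 0 (1 ≤ i ≤ m), Ext^j_Λ(Q,X) = 0 (1 ≤ j ≤ n−m−2)}` and
the category of Gorenstein-projective left `A`-modules `⊥(_A A)`:
it lands in `⊥(_A A)`, is fully faithful, essentially surjective, and exact. -/
theorem stmt15 (k : Type) [Field k] (A : Type) [Ring A] [Algebra k A]
    [FiniteDimensional k A]
    (Q : ModuleCat.{0} A) [Module.Finite A Q] (n m l : ℕ)
    (hpair : IsRelAGPair A Q n) (hpd : pdEq A Q l) (hid : idEq A Q m)
    (hn : m + l + 2 ≤ n) :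
    (∀ X : ModuleCat.{0} (Module.End A Q),
      (Module.Finite (Module.End A Q) X ∧
       (∀ i, 1 ≤ i → i ≤ m → ExtVanish (Module.End A Q) X (ModuleCat.of (Module.End A Q) Q) i) ∧
       (∀ j, 1 ≤ j → j ≤ n - m - 2 → ExtVanish (Module.End A Q) (ModuleCat.of (Module.End A Q) Q) X j)) →
      (Module.Finite A (X →ₗ[Module.End A Q] Q) ∧
       ∀ i, 1 ≤ i → ExtVanish A (ModuleCat.of A (X →ₗ[Module.End A Q] Q))
         (ModuleCat.of A A) i)) ∧
    (∀ X Y : ModuleCat.{0} (Module.End A Q),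
      (Module.Finite (Module.End A Q) X ∧
       (∀ i, 1 ≤ i → i ≤ m → ExtVanish (Module.End A Q) X (ModuleCat.of (Module.End A Q) Q) i) ∧
       (∀ j, 1 ≤ j → j ≤ n - m - 2 → ExtVanish (Module.End A Q) (ModuleCat.of (Module.End A Q) Q) X j)) →
      (Module.Finite (Module.End A Q) Y ∧
       (∀ i, 1 ≤ i → i ≤ m → ExtVanish (Module.End A Q) Y (ModuleCat.of (Module.End A Q) Q) i) ∧
       (∀ j, 1 ≤ j → j ≤ n - m - 2 → ExtVanish (Module.End A Q) (ModuleCat.of (Module.End A Q) Q) Y j)) →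
      Function.Bijective (fun φ : X →ₗ[Module.End A Q] Y => lcompA A Q φ)) ∧
    (∀ N : ModuleCat.{0} A,
      (Module.Finite A N ∧ ∀ i, 1 ≤ i → ExtVanish A N (ModuleCat.of A A) i) →
      ∃ X : ModuleCat.{0} (Module.End A Q),
        (Module.Finite (Module.End A Q) X ∧
         (∀ i, 1 ≤ i → i ≤ m → ExtVanish (Module.End A Q) X (ModuleCat.of (Module.End A Q) Q) i) ∧
         (∀ j, 1 ≤ j → j ≤ n - m - 2 → ExtVanish (Module.End A Q) (ModuleCat.of (Module.End A Q) Q) X j)) ∧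
        Nonempty ((X →ₗ[Module.End A Q] Q) ≃ₗ[A] N)) ∧
    (∀ (X Y Z : ModuleCat.{0} (Module.End A Q))
       (f : X →ₗ[Module.End A Q] Y) (g : Y →ₗ[Module.End A Q] Z),
      (Module.Finite (Module.End A Q) X ∧
       (∀ i, 1 ≤ i → i ≤ m → ExtVanish (Module.End A Q) X (ModuleCat.of (Module.End A Q) Q) i) ∧
       (∀ j, 1 ≤ j → j ≤ n - m - 2 → ExtVanish (Module.End A Q) (ModuleCat.of (Module.End A Q) Q) X j)) →
      (Module.Finite (Module.End A Q) Y ∧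
       (∀ i, 1 ≤ i → i ≤ m → ExtVanish (Module.End A Q) Y (ModuleCat.of (Module.End A Q) Q) i) ∧
       (∀ j, 1 ≤ j → j ≤ n - m - 2 → ExtVanish (Module.End A Q) (ModuleCat.of (Module.End A Q) Q) Y j)) →
      (Module.Finite (Module.End A Q) Z ∧
       (∀ i, 1 ≤ i → i ≤ m → ExtVanish (Module.End A Q) Z (ModuleCat.of (Module.End A Q) Q) i) ∧
       (∀ j, 1 ≤ j → j ≤ n - m - 2 → ExtVanish (Module.End A Q) (ModuleCat.of (Module.End A Q) Q) Z j)) →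
      Function.Injective f → Function.Exact f g → Function.Surjective g →
      (∀ W : ModuleCat.{0} (Module.End A Q),
        IsOmegaOf (Module.End A Q) (n - m - 2) (ModuleCat.of (Module.End A Q) Q) W →
        ∀ h : W →ₗ[Module.End A Q] Z, ∃ h' : W →ₗ[Module.End A Q] Y, g ∘ₗ h' = h) →
      (Function.Injective (lcompA A Q g) ∧
       Function.Exact (lcompA A Q g) (lcompA A Q f) ∧
       Function.Surjective (lcompA A Q f))) := by
  have S := PfH.mkSetup k A Q n m l hpair hpd hid hn
  refine ⟨fun X hX => ?_, fun X Y _ hY => ?_, fun N hN => ?_,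
    fun X Y Z f g hX hY hZ hf hfg hg hl => ?_⟩
  · obtain ⟨h1, h2⟩ := S.part1 (PfH.mkInC.1 hX)
    refine ⟨h1, fun i hi => ?_⟩
    obtain ⟨i, rfl⟩ : ∃ j, i = j + 1 := ⟨i - 1, by omega⟩
    exact (PfH.extVanish_iff _ _ i).2 (h2 i)
  · exact S.part2 (PfH.mkInC.1 hY)
  · obtain ⟨h1, h2⟩ := hN
    have hG : PfH.GP A N := fun i => (PfH.extVanish_iff N (ModuleCat.of A A) i).1 (h2 _ (by omega))
    refine ⟨ModuleCat.of (Module.End A Q) (N →ₗ[A] Q), PfH.mkInC.2 (S.part3 hG), ?_⟩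
    exact ⟨(LinearEquiv.ofBijective _ (S.gpRefl hG)).symm⟩
  · refine ⟨PfH.dm_inj (A := Module.End A Q) (E := A) hg,
      PfH.dm_exact (A := Module.End A Q) (E := A) hfg hg,
      S.part4 (PfH.mkInC.1 hX) (PfH.mkInC.1 hY) (PfH.mkInC.1 hZ) ⟨hf, hfg, hg⟩ (fun hnm h => ?_)⟩
    refine hl (ModuleCat.of (Module.End A Q) Q) ?_ h
    have h0 : n - m - 2 = 0 := by omega
    rw [h0]
    exact ⟨LinearEquiv.refl _ _⟩

end Statement15
end
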